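/- arXiv:2201.12941 — 6 statements merged into one kernel-verified Lean document; each statement's English description precedes it below -/
import Mathlib

section
/- For every s ∈ ℝ one has 0 < L_n^Q(s) < 1 and log L_n^Q(s) = −∫_s^∞ ∫_{−∞}^{∞} K_n^Q(x,x|u) · ω_n(x|u)/(1 + exp(u + n^{2/3} Q(x))) dx du; in particular the (nonnegative-integrand) double integral on the right-hand side is finite. -/
open MeasureTheory

lemma aux_poly_int (w : ℝ → ℝ) (hw : ∀ k : ℕ, Integrable (fun x : ℝ => |x| ^ k * w x))
    (p : Polynomial ℝ) : Integrable (fun x : ℝ => p.eval x * w x) := by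
  have h0 : AEStronglyMeasurable w := by simpa using (hw 0).aestronglyMeasurable
  have hk : ∀ k : ℕ, Integrable (fun x : ℝ => x ^ k * w x) := by
    intro k
    refine (hw k).mono ((continuous_id.pow k).aestronglyMeasurable.mul h0) ?_
    filter_upwards with x
    simp
  simp_rw [Polynomial.eval_eq_sum_range, Finset.sum_mul]
  refine integrable_finsetSum _ fun i _ => ?_
  simpa [mul_assoc] using (hk i).const_mul (p.coeff i)

lemma aux_vdm {n : ℕ} (l : Fin n → ℝ) (P : Fin n → Polynomial ℝ)
    (hd : ∀ i, (P i).natDegree = i) (hm : ∀ i, (P i).Monic) :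
    (∏ p ∈ Finset.univ.filter (fun p : Fin n × Fin n => p.1 < p.2), (l p.2 - l p.1) ^ 2)
      = (Matrix.det (Matrix.of fun i j : Fin n => (P j).eval (l i))) ^ 2 := by
  rw [← Matrix.det_eval_matrixOfPolynomials_eq_det_vandermonde l P hd hm, Matrix.det_vandermonde,
    Finset.prod_pow]
  congr 1
  rw [Finset.prod_filter, ← Finset.univ_product_univ, Finset.prod_product]
  refine Finset.prod_congr rfl fun i _ => ?_
  rw [← Finset.prod_filter]
  refine Finset.prod_congr ?_ fun _ _ => rfl
  ext j; simp

lemma aux_andreief {n : ℕ} (w : ℝ → ℝ) (hw : ∀ k : ℕ, Integrable (fun x : ℝ => |x| ^ k * w x))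
    (P : Fin n → Polynomial ℝ)
    (hd : ∀ i, (P i).natDegree = i) (hm : ∀ i, (P i).Monic) :
    (∫ l : Fin n → ℝ,
      (∏ p ∈ Finset.univ.filter (fun p : Fin n × Fin n => p.1 < p.2), (l p.2 - l p.1) ^ 2) *
        ∏ j, w (l j)) =
    (n.factorial : ℝ) *
      Matrix.det (Matrix.of fun i j : Fin n => ∫ x, (P i).eval x * (P j).eval x * w x) := by
  set G : Matrix (Fin n) (Fin n) ℝ :=
    Matrix.of fun i j : Fin n => ∫ x, (P i).eval x * (P j).eval x * w x with hG
  have hint : ∀ i j, Integrable (fun x => (P i).eval x * (P j).eval x * w x) := by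
    intro i j
    simpa using aux_poly_int w hw (P i * P j)
  have h1 : ∀ l : Fin n → ℝ,
      (∏ p ∈ Finset.univ.filter (fun p : Fin n × Fin n => p.1 < p.2), (l p.2 - l p.1) ^ 2) *
        ∏ j, w (l j) = ∑ τ : Equiv.Perm (Fin n), ∑ σ : Equiv.Perm (Fin n),
          (((Equiv.Perm.sign τ : ℤ) : ℝ) * ((Equiv.Perm.sign σ : ℤ) : ℝ)) *
          ∏ j, ((P (σ j)).eval (l j) * (P (τ j)).eval (l j) * w (l j)) := by
    intro l
    rw [aux_vdm l P hd hm, sq, ← Matrix.det_transpose, Matrix.det_apply', Finset.sum_mul_sum,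
      Finset.sum_mul]
    refine Finset.sum_congr rfl fun τ _ => ?_
    rw [Finset.sum_mul]
    refine Finset.sum_congr rfl fun σ _ => ?_
    simp only [Matrix.transpose_apply, Matrix.of_apply, Finset.prod_mul_distrib]
    ring
  simp_rw [h1]
  have hprod : ∀ σ τ : Equiv.Perm (Fin n), Integrable (fun l : Fin n → ℝ =>
      ∏ j, ((P (σ j)).eval (l j) * (P (τ j)).eval (l j) * w (l j))) := fun σ τ =>
    Integrable.fintype_prod (f := fun j x => (P (σ j)).eval x * (P (τ j)).eval x * w x)
      fun j => hint _ _
  rw [integral_finsetSum _ fun τ _ => integrable_finsetSum _ fun σ _ => (hprod σ τ).const_mul _]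
  have h2 : ∀ τ : Equiv.Perm (Fin n), (∫ l : Fin n → ℝ, ∑ σ : Equiv.Perm (Fin n),
          (((Equiv.Perm.sign τ : ℤ) : ℝ) * ((Equiv.Perm.sign σ : ℤ) : ℝ)) *
          ∏ j, ((P (σ j)).eval (l j) * (P (τ j)).eval (l j) * w (l j))) = G.det := by
    intro τ
    rw [integral_finsetSum _ fun σ _ => (hprod σ τ).const_mul _]
    have h3 := Matrix.det_permute' τ G
    have h4 : ((Equiv.Perm.sign τ : ℤ) : ℝ) * ((Equiv.Perm.sign τ : ℤ) : ℝ) = 1 := by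
      rcases Int.units_eq_one_or (Equiv.Perm.sign τ) with h | h <;> simp [h]
    calc _ = ((Equiv.Perm.sign τ : ℤ) : ℝ) * (G.submatrix id τ).det := by
          rw [Matrix.det_apply', Finset.mul_sum]
          refine Finset.sum_congr rfl fun σ _ => ?_
          rw [integral_const_mul, mul_assoc]
          congr 2
          exact integral_fintype_prod_volume_eq_prod
            (fun j x => (P (σ j)).eval x * (P (τ j)).eval x * w x)
      _ = _ := by rw [h3, ← mul_assoc, h4, one_mul]
  simp_rw [h2]
  simp [Fintype.card_perm]

lemma aux_det_deriv {n : ℕ} (G : ℝ → Matrix (Fin n) (Fin n) ℝ) (G' : Matrix (Fin n) (Fin n) ℝ)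
    (s : ℝ) (hG : ∀ i j, HasDerivAt (fun u => G u i j) (G' i j) s)
    (h : Fin n → ℝ) (hh : ∀ i, h i ≠ 0) (hs : G s = Matrix.diagonal h) :
    HasDerivAt (fun u => (G u).det) ((G s).det * ∑ i, (h i)⁻¹ * G' i i) s := by
  simp_rw [Matrix.det_apply']
  have h1 := HasDerivAt.fun_sum (u := Finset.univ) (x := s)
    (A := fun (σ : Equiv.Perm (Fin n)) u => ((Equiv.Perm.sign σ : ℤ) : ℝ) * ∏ i, G u (σ i) i)
    (fun σ _ => (HasDerivAt.fun_finsetProd (u := Finset.univ)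
      (f := fun i u => G u (σ i) i) (fun i _ => hG (σ i) i)).const_mul _)
  refine h1.congr_deriv (Eq.symm ?_)
  rw [← Matrix.det_apply', hs, Matrix.det_diagonal]
  symm
  rw [Finset.sum_eq_single (1 : Equiv.Perm (Fin n))]
  · simp only [Equiv.Perm.sign_one, Equiv.Perm.one_apply, smul_eq_mul, Finset.mul_sum]
    simp only [Units.val_one, Int.cast_one, one_mul]
    refine Finset.sum_congr rfl fun i _ => ?_
    simp only [Matrix.diagonal_apply_eq]
    rw [← Finset.mul_prod_erase Finset.univ h (Finset.mem_univ i)]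
    field_simp [hh i]
  · intro σ _ hσ
    refine mul_eq_zero_of_right _ (Finset.sum_eq_zero fun i _ => ?_)
    obtain ⟨j, hj, hji⟩ : ∃ j, σ j ≠ j ∧ j ≠ i := by
      by_contra! hc
      apply hσ
      ext k
      by_cases hk : σ k = k
      · simp [hk]
      · have e1 := hc k hk
        have e2 := hc (σ k) (fun e => hk (σ.injective e))
        exact absurd (e2.trans e1.symm) hk
    rw [Finset.prod_eq_zero (i := j) (by simp [hji]) (by rw [Matrix.diagonal_apply_ne _ hj])]
    simp
  · simp

lemma aux_half (W : Polynomial ℝ) (hd : 2 ≤ W.natDegree) (hl : 0 < W.leadingCoeff) (k : ℕ) :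
    IntegrableOn (fun x : ℝ => |x| ^ k * Real.exp (-W.eval x)) (Set.Ioi 0) := by
  refine integrable_of_isBigO_exp_neg (b := 1) one_pos (by fun_prop) ?_
  have hX : (Polynomial.C 2 * Polynomial.X : Polynomial ℝ).degree < W.degree := by
    refine lt_of_le_of_lt (Polynomial.degree_C_mul_X_le _) ?_
    rw [Polynomial.degree_eq_natDegree (by rintro rfl; simp at hd)]
    exact_mod_cast hd
  have h1 : Filter.Tendsto (fun x => (W - Polynomial.C 2 * Polynomial.X).eval x)
      Filter.atTop Filter.atTop := by
    apply Polynomial.tendsto_atTop_of_leadingCoeff_nonneg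
    · rw [Polynomial.degree_sub_eq_left_of_degree_lt hX]
      exact Polynomial.natDegree_pos_iff_degree_pos.1 (by omega)
    · rw [Polynomial.leadingCoeff_sub_of_degree_lt hX]; exact hl.le
  have h2 : (fun x : ℝ => x ^ k) =O[Filter.atTop] (fun x => Real.exp x) :=
    (Real.isLittleO_pow_exp_atTop (n := k)).isBigO
  have h3 : (fun x : ℝ => |x| ^ k * Real.exp (-W.eval x)) =O[Filter.atTop]
      (fun x => Real.exp x * Real.exp (-2 * x)) := by
    refine Asymptotics.IsBigO.mul ?_ ?_
    · exact (Asymptotics.isBigO_norm_left.2 h2).congr_left (by intro x; simp)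
    · refine Asymptotics.IsBigO.of_bound 1 ?_
      filter_upwards [h1.eventually_ge_atTop 0] with x hx
      simp at hx
      simp
      linarith
  refine h3.congr_right fun x => ?_
  rw [← Real.exp_add]; congr 1; ring

lemma aux_full (W : Polynomial ℝ) (hd : 0 < W.natDegree) (he : Even W.natDegree)
    (hl : 0 < W.leadingCoeff) (k : ℕ) :
    Integrable (fun x : ℝ => |x| ^ k * Real.exp (-W.eval x)) := by
  have hd2 : 2 ≤ W.natDegree := by obtain ⟨m, hm⟩ := he; omega
  have h1 := aux_half W hd2 hl k
  have h2 := aux_half (W.comp (-Polynomial.X)) (by simpa [Polynomial.natDegree_comp] using hd2)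
    (by rw [Polynomial.leadingCoeff_comp (by simp)]; simp [he.neg_one_pow, hl]) k
  rw [← integrableOn_univ, ← Set.Iic_union_Ioi (a := (0:ℝ))]
  refine IntegrableOn.union ?_ h1
  have h3 := (integrableOn_Ici_iff_integrableOn_Ioi).2 h2
  rw [← neg_zero] at h3
  simpa using h3.comp_neg_Iic

lemma aux_sig (a E s : ℝ) :
    HasDerivAt (fun u => (1 + Real.exp (-u - a))⁻¹ * E)
      ((1 + Real.exp (-s - a))⁻¹ * E / (1 + Real.exp (s + a))) s := by
  have h1 : HasDerivAt (fun u : ℝ => 1 + Real.exp (-u - a)) (Real.exp (-s - a) * (-1)) s :=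
    (((hasDerivAt_id s).neg.sub_const a).exp).const_add 1
  have hp : (1 + Real.exp (-s - a)) ≠ 0 := by positivity
  refine ((h1.inv hp).mul_const E).congr_deriv ?_
  have h2 : Real.exp (s + a) = (Real.exp (-s - a))⁻¹ := by
    rw [← Real.exp_neg]; congr 1; ring
  have h3 := Real.exp_pos (-s - a)
  rw [h2]
  field_simp
  ring

lemma aux_int_deriv (q E : ℝ → ℝ) (hq : Continuous q) (hEc : Continuous E)
    (hE : ∀ k : ℕ, Integrable (fun x : ℝ => |x| ^ k * E x)) (p : Polynomial ℝ) (s : ℝ) :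
    Integrable (fun x => p.eval x *
      ((1 + Real.exp (-s - q x))⁻¹ * E x / (1 + Real.exp (s + q x)))) ∧
    HasDerivAt (fun u => ∫ x, p.eval x * ((1 + Real.exp (-u - q x))⁻¹ * E x))
      (∫ x, p.eval x * ((1 + Real.exp (-s - q x))⁻¹ * E x / (1 + Real.exp (s + q x)))) s := by
  have hc1 : ∀ u : ℝ, Continuous fun x => (1 + Real.exp (-u - q x))⁻¹ := fun u =>
    Continuous.inv₀ (by fun_prop) (fun x => by positivity)
  have hc2 : ∀ u : ℝ, Continuous fun x => (1 + Real.exp (u + q x))⁻¹ := fun u =>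
    Continuous.inv₀ (by fun_prop) (fun x => by positivity)
  have hb1 : ∀ t : ℝ, (1 + Real.exp t)⁻¹ ≤ 1 := fun t =>
    inv_le_one_of_one_le₀ (by have := Real.exp_pos t; linarith)
  have hb0 : ∀ t : ℝ, 0 ≤ (1 + Real.exp t)⁻¹ := fun t => by positivity
  have hpE : Integrable (fun x => |p.eval x * E x|) := (aux_poly_int E hE p).abs
  have hm : ∀ u, AEStronglyMeasurable
      (fun x => p.eval x * ((1 + Real.exp (-u - q x))⁻¹ * E x)) volume := fun u =>
    Continuous.aestronglyMeasurable (by have := hc1 u; fun_prop)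
  refine hasDerivAt_integral_of_dominated_loc_of_deriv_le (s := Set.univ)
    (F := fun u x => p.eval x * ((1 + Real.exp (-u - q x))⁻¹ * E x))
    (F' := fun u x => p.eval x *
      ((1 + Real.exp (-u - q x))⁻¹ * E x / (1 + Real.exp (u + q x))))
    (bound := fun x => |p.eval x * E x|) Filter.univ_mem
    (Filter.Eventually.of_forall hm) ?_ ?_ ?_ hpE ?_
  · refine hpE.mono (hm s) ?_
    filter_upwards with x
    rw [Real.norm_eq_abs, Real.norm_eq_abs, abs_abs, abs_mul, abs_mul, abs_mul]
    have := hb1 (-s - q x)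
    rw [abs_of_nonneg (hb0 (-s - q x))]
    gcongr
    exact mul_le_of_le_one_left (abs_nonneg _) this
  · refine Continuous.aestronglyMeasurable ?_
    simp_rw [div_eq_mul_inv]
    have := hc1 s
    have := hc2 s
    fun_prop
  · filter_upwards with x u _
    rw [Real.norm_eq_abs, div_eq_mul_inv, abs_mul, abs_mul, abs_mul, abs_mul,
      abs_of_nonneg (hb0 (-u - q x)), abs_of_nonneg (hb0 (u + q x))]
    have h1 := hb1 (-u - q x)
    have h2 := hb1 (u + q x)
    gcongr
    exact (mul_le_of_le_one_right (mul_nonneg (hb0 _) (abs_nonneg _)) h2).trans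
      (mul_le_of_le_one_left (abs_nonneg _) h1)
  · filter_upwards with x u _
    exact (aux_sig (q x) (E x) u).const_mul _

lemma aux_int_tendsto (q E : ℝ → ℝ) (hq : Continuous q) (hEc : Continuous E)
    (hE : ∀ k : ℕ, Integrable (fun x : ℝ => |x| ^ k * E x)) (p : Polynomial ℝ) :
    Filter.Tendsto (fun u => ∫ x, p.eval x * ((1 + Real.exp (-u - q x))⁻¹ * E x))
      Filter.atTop (nhds (∫ x, p.eval x * E x)) := by
  have hc1 : ∀ u : ℝ, Continuous fun x => (1 + Real.exp (-u - q x))⁻¹ := fun u =>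
    Continuous.inv₀ (by fun_prop) (fun x => by positivity)
  have hb1 : ∀ t : ℝ, (1 + Real.exp t)⁻¹ ≤ 1 := fun t =>
    inv_le_one_of_one_le₀ (by have := Real.exp_pos t; linarith)
  have hb0 : ∀ t : ℝ, 0 ≤ (1 + Real.exp t)⁻¹ := fun t => by positivity
  refine tendsto_integral_filter_of_dominated_convergence (fun x => |p.eval x * E x|)
    (Filter.Eventually.of_forall fun u => ?_) (Filter.Eventually.of_forall fun u => ?_)
    (aux_poly_int E hE p).abs ?_
  · exact Continuous.aestronglyMeasurable (by have := hc1 u; fun_prop)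
  · filter_upwards with x
    rw [Real.norm_eq_abs, abs_mul, abs_mul, abs_mul, abs_of_nonneg (hb0 (-u - q x))]
    gcongr
    exact mul_le_of_le_one_left (abs_nonneg _) (hb1 _)
  · filter_upwards with x
    have h1 : Filter.Tendsto (fun u : ℝ => Real.exp (-u - q x)) Filter.atTop (nhds 0) := by
      refine Real.tendsto_exp_atBot.comp ?_
      exact Filter.tendsto_atBot_add_const_right _ _ Filter.tendsto_neg_atTop_atBot
    have h2 := ((h1.const_add 1).inv₀ (by norm_num)).mul_const (E x)
    simpa using h2.const_mul (p.eval x)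

/-- positivity `0 < L_n^Q(s) < 1` and the integral representation of
`log L_n^Q(s)` in terms of the deformed Christoffel–Darboux kernel; in particular the
double integral is finite (integrability). -/
theorem stmt_0
    (n : ℕ) (hn : 1 ≤ n)
    (V : Polynomial ℝ) (hVnc : 0 < V.natDegree) (hVeven : Even V.natDegree)
    (hVlead : 0 < V.leadingCoeff)
    (Q : ℝ → ℝ) (hQ : Continuous Q)
    (ω : ℝ → ℝ → ℝ)
    (hω : ∀ s x, ω s x =
      (1 + Real.exp (-s - (n : ℝ) ^ ((2 : ℝ) / 3) * Q x))⁻¹ * Real.exp (-(n : ℝ) * V.eval x))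
    (hmom : ∀ (s : ℝ) (k : ℕ), Integrable (fun x : ℝ => |x| ^ k * ω s x))
    (ZQ : ℝ → ℝ) (Zn : ℝ)
    (hZQ : ∀ s, ZQ s = ∫ l : Fin n → ℝ,
      (∏ p ∈ Finset.univ.filter (fun p : Fin n × Fin n => p.1 < p.2), (l p.2 - l p.1) ^ 2) *
        ∏ j, ω s (l j))
    (hZn : Zn = ∫ l : Fin n → ℝ,
      (∏ p ∈ Finset.univ.filter (fun p : Fin n × Fin n => p.1 < p.2), (l p.2 - l p.1) ^ 2) *
        ∏ j, Real.exp (-(n : ℝ) * V.eval (l j)))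
    (L : ℝ → ℝ) (hL : ∀ s, L s = ZQ s / Zn)
    (P : ℝ → ℕ → Polynomial ℝ)
    (hPmonic : ∀ s k, k ≤ n → (P s k).Monic)
    (hPdeg : ∀ s k, k ≤ n → (P s k).natDegree = k)
    (hPorth : ∀ s k, k ≤ n → ∀ j < k, (∫ x : ℝ, (P s k).eval x * x ^ j * ω s x) = 0)
    (γ : ℝ → ℕ → ℝ)
    (hγpos : ∀ s k, k ≤ n → 0 < γ s k)
    (hγ : ∀ s k, k ≤ n → ((γ s k) ^ 2)⁻¹ = ∫ x : ℝ, ((P s k).eval x) ^ 2 * ω s x)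
    (K : ℝ → ℝ → ℝ → ℝ)
    (hK : ∀ s x y, K s x y =
      ∑ k ∈ Finset.range n, (γ s k) ^ 2 * (P s k).eval x * (P s k).eval y) :
    ∀ s : ℝ,
      0 < L s ∧ L s < 1 ∧
      (∀ u : ℝ, s ≤ u → Integrable (fun x : ℝ =>
        K u x x * ω u x / (1 + Real.exp (u + (n : ℝ) ^ ((2 : ℝ) / 3) * Q x)))) ∧
      IntegrableOn (fun u : ℝ => ∫ x : ℝ,
        K u x x * ω u x / (1 + Real.exp (u + (n : ℝ) ^ ((2 : ℝ) / 3) * Q x))) (Set.Ici s) ∧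
      Real.log (L s) = -∫ u in Set.Ici s, ∫ x : ℝ,
        K u x x * ω u x / (1 + Real.exp (u + (n : ℝ) ^ ((2 : ℝ) / 3) * Q x)) := by
  set c : ℝ := (n : ℝ) ^ ((2 : ℝ) / 3) with hc
  set q : ℝ → ℝ := fun x => c * Q x with hqdef
  set E : ℝ → ℝ := fun x => Real.exp (-(n : ℝ) * V.eval x) with hEdef
  have hq : Continuous q := by fun_prop
  have hEc : Continuous E := by fun_prop
  have hEpos : ∀ x, 0 < E x := fun x => Real.exp_pos _
  have hn0 : (0 : ℝ) < n := by exact_mod_cast hn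
  have hE : ∀ k : ℕ, Integrable (fun x : ℝ => |x| ^ k * E x) := by
    intro k
    have hdeg : (Polynomial.C (n : ℝ) * V).natDegree = V.natDegree :=
      Polynomial.natDegree_C_mul hn0.ne'
    have := aux_full (Polynomial.C (n : ℝ) * V) (by rw [hdeg]; exact hVnc)
      (by rw [hdeg]; exact hVeven)
      (by rw [Polynomial.leadingCoeff_mul, Polynomial.leadingCoeff_C]; positivity) k
    simpa [hEdef] using this
  have hω' : ∀ u, ω u = fun x => (1 + Real.exp (-u - q x))⁻¹ * E x := by
    intro u; ext x; rw [hω]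
  have hωpos : ∀ u x, 0 < ω u x := by
    intro u x; rw [hω]; positivity
  -- the trace
  set T : ℝ → ℝ := fun u => ∫ x : ℝ, K u x x * ω u x / (1 + Real.exp (u + c * Q x)) with hT
  have hh : ∀ u k, k ≤ n → 0 < ((γ u k) ^ 2)⁻¹ := fun u k hk => by
    have := hγpos u k hk; positivity
  -- derivative of one-dimensional integrals
  have hder : ∀ (p : Polynomial ℝ) (u : ℝ),
      Integrable (fun x => p.eval x * (ω u x / (1 + Real.exp (u + q x)))) ∧
      HasDerivAt (fun t => ∫ x, p.eval x * ω t x)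
        (∫ x, p.eval x * (ω u x / (1 + Real.exp (u + q x)))) u := by
    intro p u
    simp only [hω']
    exact aux_int_deriv q E hq hEc hE p u
  have hKint : ∀ u x, K u x x * ω u x / (1 + Real.exp (u + c * Q x)) =
      ∑ i : Fin n, (γ u i) ^ 2 * ((P u i * P u i).eval x * (ω u x / (1 + Real.exp (u + q x)))) := by
    intro u x
    rw [hK, ← Fin.sum_univ_eq_sum_range (fun k => (γ u k) ^ 2 * (P u k).eval x * (P u k).eval x),
      mul_div_assoc, Finset.sum_mul]
    refine Finset.sum_congr rfl fun i _ => ?_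
    rw [Polynomial.eval_mul]
    ring
  have hint : ∀ u, Integrable (fun x => K u x x * ω u x / (1 + Real.exp (u + c * Q x))) := by
    intro u
    simp_rw [hKint]
    exact integrable_finsetSum _ fun i _ => ((hder _ u).1).const_mul _
  have hTsum : ∀ u, T u = ∑ i : Fin n, (γ u i) ^ 2 *
      ∫ x, ((P u i * P u i).eval x * (ω u x / (1 + Real.exp (u + q x)))) := by
    intro u
    simp only [hT]
    simp_rw [hKint]
    rw [integral_finsetSum _ fun i _ => ((hder _ u).1).const_mul _]
    refine Finset.sum_congr rfl fun i _ => ?_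
    rw [integral_const_mul]
  -- orthogonality
  have horth : ∀ u, ∀ j k, k ≤ n → j < k →
      (∫ x, (P u j).eval x * (P u k).eval x * ω u x) = 0 := by
    intro u j k hk hjk
    have e : ∀ x, (P u j).eval x * (P u k).eval x * ω u x =
        ∑ i ∈ Finset.range ((P u j).natDegree + 1),
          (P u j).coeff i * ((P u k).eval x * x ^ i * ω u x) := by
      intro x
      rw [Polynomial.eval_eq_sum_range (p := P u j), Finset.sum_mul, Finset.sum_mul]
      exact Finset.sum_congr rfl fun i _ => by ring
    simp_rw [e]
    rw [integral_finsetSum]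
    · refine Finset.sum_eq_zero fun i hi => ?_
      rw [hPdeg u j (by omega), Finset.mem_range] at hi
      rw [integral_const_mul, hPorth u k hk i (by omega), mul_zero]
    · intro i _
      refine Integrable.const_mul ?_ _
      refine (aux_poly_int (ω u) (hmom u) (P u k * Polynomial.X ^ i)).congr
        (Filter.Eventually.of_forall fun x => ?_)
      change (P u k * Polynomial.X ^ i).eval x * ω u x = _
      rw [Polynomial.eval_mul, Polynomial.eval_pow, Polynomial.eval_X]
  -- Gram matrix
  have hdet : ∀ u t, ZQ t = (n.factorial : ℝ) * Matrix.det
      (Matrix.of fun i j : Fin n => ∫ x, (P u i).eval x * (P u j).eval x * ω t x) := by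
    intro u t
    rw [hZQ]
    exact aux_andreief (ω t) (hmom t) (fun i : Fin n => P u i)
      (fun i => hPdeg u i i.2.le) (fun i => hPmonic u i i.2.le)
  have hdiag : ∀ u, (Matrix.of fun i j : Fin n => ∫ x, (P u i).eval x * (P u j).eval x * ω u x)
      = Matrix.diagonal (fun i : Fin n => ((γ u i) ^ 2)⁻¹) := by
    intro u
    ext i j
    by_cases hij : i = j
    · subst hij
      rw [Matrix.diagonal_apply_eq, hγ u i i.2.le, Matrix.of_apply]
      simp_rw [sq]
    · rw [Matrix.diagonal_apply_ne _ hij, Matrix.of_apply]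
      rcases lt_or_gt_of_ne (fun h : (i : ℕ) = j => hij (Fin.ext h)) with h | h
      · exact horth u i j j.2.le h
      · simp_rw [mul_comm ((P u i).eval _)]
        exact horth u j i i.2.le h
  have hZpos : ∀ u, 0 < ZQ u := by
    intro u
    rw [hdet u u, hdiag u, Matrix.det_diagonal]
    refine mul_pos (by exact_mod_cast n.factorial_pos) (Finset.prod_pos fun i _ => ?_)
    exact hh u i i.2.le
  have hZder : ∀ u, HasDerivAt ZQ (ZQ u * T u) u := by
    intro u
    have h1 := aux_det_deriv
      (fun t => Matrix.of fun i j : Fin n => ∫ x, (P u i).eval x * (P u j).eval x * ω t x)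
      (Matrix.of fun i j : Fin n =>
        ∫ x, ((P u i * P u j).eval x * (ω u x / (1 + Real.exp (u + q x))))) u
      (fun i j => by simpa using (hder (P u i * P u j) u).2)
      (fun i : Fin n => ((γ u i) ^ 2)⁻¹) (fun i => (hh u i i.2.le).ne') (hdiag u)
    have h2 := h1.const_mul (n.factorial : ℝ)
    have h3 : ZQ = fun t => (n.factorial : ℝ) * Matrix.det
      (Matrix.of fun i j : Fin n => ∫ x, (P u i).eval x * (P u j).eval x * ω t x) :=
      funext fun t => hdet u t
    rw [← mul_assoc, ← hdet u u, ← h3] at h2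
    refine h2.congr_deriv ?_
    rw [hTsum]
    simp
  have hTpos : ∀ u, 0 < T u := by
    intro u
    rw [hTsum]
    have hnn : ∀ i : Fin n, 0 ≤ fun x =>
        ((P u i * P u i).eval x * (ω u x / (1 + Real.exp (u + q x)))) := by
      intro i x
      have h1 := (hωpos u x).le
      have h2 := mul_self_nonneg ((P u i).eval x)
      simp only [Polynomial.eval_mul, Pi.zero_apply]
      positivity
    refine Finset.sum_pos' (fun i _ => mul_nonneg (sq_nonneg _) (integral_nonneg (hnn i)))
      ⟨⟨0, hn⟩, Finset.mem_univ _, ?_⟩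
    refine mul_pos (pow_pos (hγpos u 0 (Nat.zero_le _)) 2) ?_
    have hP0 : P u 0 = 1 :=
      (hPmonic u 0 (Nat.zero_le _)).natDegree_eq_zero.1 (hPdeg u 0 (Nat.zero_le _))
    rw [integral_pos_iff_support_of_nonneg (hnn _) (hder _ u).1]
    have : (Function.support fun x =>
        ((P u 0 * P u 0).eval x * (ω u x / (1 + Real.exp (u + q x))))) = Set.univ := by
      ext x
      have h1 := hωpos u x
      have h2 : 0 < ω u x / (1 + Real.exp (u + q x)) := by positivity
      simp only [hP0, Function.mem_support, Set.mem_univ, iff_true, mul_one, Polynomial.eval_one,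
        one_mul]
      exact h2.ne'
    simp only [this]
    simp
  have hZlim : Filter.Tendsto ZQ Filter.atTop (nhds Zn) := by
    have h0 : Zn = (n.factorial : ℝ) * Matrix.det (Matrix.of fun i j : Fin n =>
        ∫ x, (Polynomial.X ^ (i : ℕ) * Polynomial.X ^ (j : ℕ) : Polynomial ℝ).eval x * E x) := by
      rw [hZn]
      simp only [Polynomial.eval_mul]
      exact aux_andreief E hE (fun i : Fin n => Polynomial.X ^ (i : ℕ)) (by simp)
        (fun i => Polynomial.monic_X_pow _)
    have h1 : ZQ = fun t => (n.factorial : ℝ) * Matrix.det (Matrix.of fun i j : Fin n =>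
        ∫ x, (Polynomial.X ^ (i : ℕ) * Polynomial.X ^ (j : ℕ) : Polynomial ℝ).eval x * ω t x) := by
      ext t
      rw [hZQ]
      simpa using aux_andreief (ω t) (hmom t) (fun i : Fin n => Polynomial.X ^ (i : ℕ)) (by simp)
        (fun i => Polynomial.monic_X_pow _)
    rw [h0, h1]
    refine Filter.Tendsto.const_mul _ ?_
    simp_rw [Matrix.det_apply']
    refine tendsto_finsetSum _ fun σ _ => Filter.Tendsto.const_mul _ ?_
    refine tendsto_finsetProd _ fun i _ => ?_
    simp only [hω', Matrix.of_apply]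
    exact aux_int_tendsto q E hq hEc hE _
  have hmono : StrictMono ZQ := strictMono_of_deriv_pos fun u => by
    rw [(hZder u).deriv]; exact mul_pos (hZpos u) (hTpos u)
  have hlt : ∀ u, ZQ u < Zn := fun u =>
    lt_of_lt_of_le (hmono (lt_add_one u)) (hmono.monotone.ge_of_tendsto hZlim _)
  intro s
  have hZnpos : 0 < Zn := (hZpos s).trans (hlt s)
  have hLder : ∀ u, HasDerivAt (fun t => Real.log (L t)) (T u) u := by
    intro u
    have hLf : L = fun t => ZQ t / Zn := funext hL
    have h1 : HasDerivAt L (ZQ u * T u / Zn) u := by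
      rw [hLf]; exact (hZder u).div_const Zn
    have hne : L u ≠ 0 := by rw [hL]; exact (div_pos (hZpos u) hZnpos).ne'
    refine (h1.log hne).congr_deriv ?_
    rw [hL]
    have := (hZpos u).ne'
    field_simp
  have hLlim : Filter.Tendsto (fun t => Real.log (L t)) Filter.atTop (nhds 0) := by
    have h1 : Filter.Tendsto L Filter.atTop (nhds 1) := by
      have hLf : L = fun t => ZQ t / Zn := funext hL
      rw [hLf, ← div_self hZnpos.ne']
      exact hZlim.div_const Zn
    have := h1.log one_ne_zero
    simpa using this
  refine ⟨?_, ?_, fun u _ => hint u, ?_, ?_⟩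
  · rw [hL]; exact div_pos (hZpos s) hZnpos
  · rw [hL, div_lt_one hZnpos]; exact hlt s
  · rw [integrableOn_Ici_iff_integrableOn_Ioi]
    exact integrableOn_Ioi_deriv_of_nonneg' (fun u _ => hLder u) (fun u _ => (hTpos u).le) hLlim
  · rw [integral_Ici_eq_integral_Ioi]
    have h1 : ∫ u in Set.Ioi s, T u = 0 - Real.log (L s) :=
      integral_Ioi_of_hasDerivAt_of_nonneg' (fun u _ => hLder u) (fun u _ => (hTpos u).le) hLlim
    change Real.log (L s) = -∫ u in Set.Ioi s, T u
    rw [h1]; ring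
end

section
/- For each fixed x ∈ ℝ the map s ↦ K_n^Q(x,x|s) is differentiable, the map s ↦ Z_n^Q(s) is differentiable and positive, and for every s ∈ ℝ one has the deformation identity d/ds log Z_n^Q(s) = −∫_ℝ ∂_s K_n^Q(x,x|s) · ω_n(x|s) dx (the integral on the right being absolutely convergent). -/
open MeasureTheory

theorem det_deriv {n : ℕ} (H : ℝ → Matrix (Fin n) (Fin n) ℝ) (H' : Matrix (Fin n) (Fin n) ℝ) (s : ℝ)
    (h : ∀ i j, HasDerivAt (fun u => H u i j) (H' i j) s) :
    HasDerivAt (fun u => (H u).det) (Matrix.trace ((H s).adjugate * H')) s := by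
  have h1 : HasDerivAt (fun u => (H u).det) (∑ σ : Equiv.Perm (Fin n), ((Equiv.Perm.sign σ : ℤ) : ℝ) *
      ∑ i, (∏ j ∈ Finset.univ.erase i, H s (σ j) j) • H' (σ i) i) s := by
    simp only [Matrix.det_apply']
    refine HasDerivAt.fun_sum fun σ _ => HasDerivAt.const_mul _ ?_
    exact HasDerivAt.fun_finsetProd fun i _ => h _ _
  convert h1 using 1
  simp only [Finset.mul_sum]
  rw [Finset.sum_comm, Matrix.trace]
  refine Finset.sum_congr rfl fun i _ => ?_
  have : ((H s).adjugate * H').diag i = ((H s).updateCol i (fun k => H' k i)).det := by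
    rw [← Matrix.cramer_apply, Matrix.cramer_eq_adjugate_mulVec]
    rfl
  rw [this, Matrix.det_apply']
  refine Finset.sum_congr rfl fun σ _ => ?_
  congr 1
  rw [← Finset.prod_erase_mul _ _ (Finset.mem_univ i), smul_eq_mul]
  congr 1
  · refine Finset.prod_congr rfl fun j hj => ?_
    rw [Matrix.updateCol_ne (Finset.ne_of_mem_erase hj)]
  · simp

theorem inv_diff {n : ℕ} (H : ℝ → Matrix (Fin n) (Fin n) ℝ) (H' : Matrix (Fin n) (Fin n) ℝ) (s : ℝ)
    (h : ∀ i j, HasDerivAt (fun u => H u i j) (H' i j) s) (hd : (H s).det ≠ 0) (i j : Fin n) :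
    DifferentiableAt ℝ (fun u => (H u)⁻¹ i j) s := by
  simp only [Matrix.inv_def, Matrix.smul_apply, Ring.inverse_eq_inv', Matrix.adjugate_apply, smul_eq_mul]
  refine ((det_deriv H H' s h).differentiableAt.inv hd).mul ?_
  refine (det_deriv (fun u => (H u).updateRow j (Pi.single i 1)) 
    (H'.updateRow j 0) s ?_).differentiableAt
  intro k l
  by_cases hk : k = j
  · subst hk
    simpa using hasDerivAt_const _ _
  · simpa [Matrix.updateRow_ne hk] using h k l

theorem inv_trace {n : ℕ} (H : ℝ → Matrix (Fin n) (Fin n) ℝ) (H' : Matrix (Fin n) (Fin n) ℝ) (s : ℝ)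
    (h : ∀ i j, HasDerivAt (fun u => H u i j) (H' i j) s) (hd : ∀ u, (H u).det ≠ 0)
    (G' : Matrix (Fin n) (Fin n) ℝ)
    (hG : ∀ i j, HasDerivAt (fun u => (H u)⁻¹ i j) (G' i j) s) :
    HasDerivAt (fun u => (H u).det) ((H s).det * -Matrix.trace (G' * H s)) s := by
  have key : G' * H s + (H s)⁻¹ * H' = 0 := by
    ext i j
    have h1 : HasDerivAt (fun u => ((H u)⁻¹ * H u) i j) ((G' * H s + (H s)⁻¹ * H') i j) s := by
      simp only [Matrix.mul_apply, Matrix.add_apply, ← Finset.sum_add_distrib]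
      exact HasDerivAt.fun_sum fun k _ => (hG i k).mul (h k j)
    have h2 : (fun u => ((H u)⁻¹ * H u) i j) = fun u => (1 : Matrix (Fin n) (Fin n) ℝ) i j := by
      funext u
      rw [Matrix.nonsing_inv_mul _ (hd u).isUnit]
    rw [h2] at h1
    exact h1.unique (hasDerivAt_const _ _)
  convert det_deriv H H' s h using 1
  have : G' * H s = -((H s)⁻¹ * H') := eq_neg_of_add_eq_zero_left key
  rw [this, Matrix.trace_neg, neg_neg, Matrix.inv_def, Matrix.smul_mul, Matrix.trace_smul,
    Ring.inverse_eq_inv', smul_eq_mul, mul_inv_cancel_left₀ (hd s)]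

theorem vand_int {n : ℕ} (w : ℝ → ℝ) (hw : ∀ k : ℕ, Integrable (fun x : ℝ => x ^ k * w x)) :
    (∫ l : Fin n → ℝ,
      (∏ p ∈ Finset.univ.filter (fun p : Fin n × Fin n => p.1 < p.2), (l p.2 - l p.1) ^ 2) *
        ∏ j, w (l j)) = (n.factorial : ℝ) *
        (Matrix.of fun i j : Fin n => ∫ x : ℝ, x ^ ((i : ℕ) + j) * w x).det := by
  set M : Matrix (Fin n) (Fin n) ℝ := Matrix.of fun i j : Fin n => ∫ x : ℝ, x ^ ((i : ℕ) + j) * w x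
    with hM
  have h0 : ∀ l : Fin n → ℝ, (∏ p ∈ Finset.univ.filter (fun p : Fin n × Fin n => p.1 < p.2), (l p.2 - l p.1) ^ 2) *
        ∏ j, w (l j) = ∑ σ : Equiv.Perm (Fin n), ∑ τ : Equiv.Perm (Fin n),
        (((Equiv.Perm.sign σ : ℤ) : ℝ) * ((Equiv.Perm.sign τ : ℤ) : ℝ)) *
          ∏ j, ((l j) ^ ((σ j : ℕ) + τ j) * w (l j)) := by
    intro l
    have h1 : (∏ p ∈ Finset.univ.filter (fun p : Fin n × Fin n => p.1 < p.2), (l p.2 - l p.1) ^ 2)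
      = (Matrix.vandermonde l).det ^ 2 := by
      rw [Matrix.det_vandermonde, Finset.prod_pow]
      congr 1
      rw [Finset.prod_sigma']
      refine Finset.prod_bij' (fun p _ => ⟨p.1, p.2⟩) (fun p _ => (p.1, p.2)) ?_ ?_ ?_ ?_ ?_ <;> simp
    rw [h1, ← Matrix.det_transpose, Matrix.det_apply', sq, Finset.sum_mul_sum, Finset.sum_mul]
    refine Finset.sum_congr rfl fun σ _ => ?_
    rw [Finset.sum_mul]
    refine Finset.sum_congr rfl fun τ _ => ?_
    simp only [Matrix.transpose_apply, Matrix.vandermonde_apply, pow_add, Finset.prod_mul_distrib]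
    ring
  simp only [h0]
  have hint : ∀ σ τ : Equiv.Perm (Fin n), Integrable (fun l : Fin n → ℝ => 
     (((Equiv.Perm.sign σ : ℤ) : ℝ) * ((Equiv.Perm.sign τ : ℤ) : ℝ)) *
          ∏ j, ((l j) ^ ((σ j : ℕ) + τ j) * w (l j))) := by
    intro σ τ
    refine Integrable.const_mul ?_ _
    exact Integrable.fintype_prod (f := fun j x => x ^ ((σ j : ℕ) + τ j) * w x) fun j => hw _
  rw [integral_finsetSum _ fun σ _ => integrable_finsetSum _ fun τ _ => hint σ τ]
  have : ∀ σ : Equiv.Perm (Fin n), (∫ l : Fin n → ℝ, ∑ τ : Equiv.Perm (Fin n),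
        (((Equiv.Perm.sign σ : ℤ) : ℝ) * ((Equiv.Perm.sign τ : ℤ) : ℝ)) *
          ∏ j, ((l j) ^ ((σ j : ℕ) + τ j) * w (l j))) = M.det := by
    intro σ
    rw [integral_finsetSum _ fun τ _ => hint σ τ]
    have h3 : ((Equiv.Perm.sign σ : ℤ) : ℝ) * ((M.submatrix σ id).transpose).det = M.det := by
      rw [Matrix.det_transpose, Matrix.det_permute, ← mul_assoc, ← Int.cast_mul]
      simp
    rw [← h3, Matrix.det_apply', Finset.mul_sum]
    refine Finset.sum_congr rfl fun τ _ => ?_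
    rw [integral_const_mul, mul_assoc]
    congr 2
    exact integral_fintype_prod_eq_prod (fun j x => x ^ ((σ j : ℕ) + τ j) * w x)
  rw [Finset.sum_congr rfl fun σ _ => this σ]
  simp [Fintype.card_perm]

theorem poly_int (w : ℝ → ℝ) (hw : ∀ k : ℕ, Integrable (fun x : ℝ => x ^ k * w x)) (p : Polynomial ℝ) :
    Integrable (fun x : ℝ => p.eval x * w x) := by
  simp only [Polynomial.eval_eq_sum_range, Finset.sum_mul, mul_assoc]
  exact integrable_finsetSum _ fun i _ => (hw i).const_mul _

theorem eval_fin {n : ℕ} (p : Polynomial ℝ) (hp : p.natDegree < n) (x : ℝ) :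
    p.eval x = ∑ i : Fin n, p.coeff i * x ^ (i : ℕ) := by
  rw [Polynomial.eval_eq_sum_range' hp, Finset.sum_range]

theorem orth_lt (w : ℝ → ℝ) (hw : ∀ k : ℕ, Integrable (fun x : ℝ => x ^ k * w x))
    (p q : Polynomial ℝ) (k : ℕ) (ho : ∀ j < k, (∫ x : ℝ, p.eval x * x ^ j * w x) = 0)
    (hq : q.natDegree < k) : (∫ x : ℝ, p.eval x * q.eval x * w x) = 0 := by
  have h1 : ∀ x, p.eval x * q.eval x * w x =
      ∑ j ∈ Finset.range k, q.coeff j * (p.eval x * x ^ j * w x) := by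
    intro x
    rw [Polynomial.eval_eq_sum_range' hq, Finset.mul_sum, Finset.sum_mul]
    exact Finset.sum_congr rfl fun j _ => by ring
  simp only [h1]
  rw [integral_finsetSum]
  · refine Finset.sum_eq_zero fun j hj => ?_
    rw [integral_const_mul, ho j (Finset.mem_range.1 hj), mul_zero]
  · intro j _
    have := poly_int w hw (p * Polynomial.X ^ j)
    simp only [Polynomial.eval_mul, Polynomial.eval_pow, Polynomial.eval_X] at this
    exact this.const_mul _

theorem gram {n : ℕ} (w : ℝ → ℝ) (hw : ∀ k : ℕ, Integrable (fun x : ℝ => x ^ k * w x))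
    (P : ℕ → Polynomial ℝ) (hPdeg : ∀ k, k ≤ n → (P k).natDegree = k)
    (ho : ∀ k, k ≤ n → ∀ j < k, (∫ x : ℝ, (P k).eval x * x ^ j * w x) = 0)
    (γ : ℕ → ℝ) (hγpos : ∀ k, k ≤ n → 0 < γ k)
    (hγ : ∀ k, k ≤ n → ((γ k) ^ 2)⁻¹ = ∫ x : ℝ, ((P k).eval x) ^ 2 * w x)
    (M : Matrix (Fin n) (Fin n) ℝ) (hM : ∀ i j, M i j = ∫ x : ℝ, x ^ ((i : ℕ) + j) * w x) :
    0 < M.det ∧ ∀ x y : ℝ, ∑ k ∈ Finset.range n, (γ k) ^ 2 * (P k).eval x * (P k).eval y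
      = ∑ i : Fin n, ∑ j : Fin n, M⁻¹ i j * (x ^ (i : ℕ) * y ^ (j : ℕ)) := by
  have hdeg : ∀ k : Fin n, (P k).natDegree < n := fun k => by rw [hPdeg k k.2.le]; exact k.2
  set L : Matrix (Fin n) (Fin n) ℝ := Matrix.of fun k i => (P k).coeff i with hL
  set D : Matrix (Fin n) (Fin n) ℝ := Matrix.diagonal fun k => (γ k) ^ 2 with hD
  have h1 : ∀ k l, (L * M * L.transpose) k l = ∫ x : ℝ, (P k).eval x * (P l).eval x * w x := by
    intro k l
    have h2 : ∀ x, (P k).eval x * (P l).eval x * w x = ∑ j : Fin n, ∑ i : Fin n,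
        ((P k).coeff i * (P l).coeff j) * (x ^ ((i : ℕ) + j) * w x) := by
      intro x
      rw [eval_fin _ (hdeg k), eval_fin _ (hdeg l), Finset.sum_mul_sum, Finset.sum_comm,
        Finset.sum_mul]
      refine Finset.sum_congr rfl fun i _ => ?_
      rw [Finset.sum_mul]
      refine Finset.sum_congr rfl fun j _ => ?_
      ring
    simp only [h2]
    rw [integral_finsetSum _ fun j _ => integrable_finsetSum _ fun i _ => (hw _).const_mul _]
    simp only [Matrix.mul_apply, Finset.sum_mul]
    refine Finset.sum_congr rfl fun j _ => ?_
    rw [integral_finsetSum _ fun i _ => (hw _).const_mul _]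
    refine Finset.sum_congr rfl fun i _ => ?_
    rw [integral_const_mul, hM]
    simp only [hL, Matrix.of_apply, Matrix.transpose_apply]
    ring
  have h3 : D * (L * M * L.transpose) = 1 := by
    ext k l
    rw [hD, Matrix.diagonal_mul, h1]
    by_cases hkl : k = l
    · subst hkl
      have := hγ k k.2.le
      simp only [sq ((P k).eval _)] at this
      rw [← this, Matrix.one_apply_eq]
      exact mul_inv_cancel₀ (pow_pos (hγpos k k.2.le) 2).ne'
    · rw [Matrix.one_apply_ne hkl]
      rcases lt_or_gt_of_ne hkl with h | h
      · have := orth_lt w hw (P l) (P k) l (ho l l.2.le) (by rw [hPdeg k k.2.le]; exact h)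
        simp only [mul_comm ((P k).eval _)]
        rw [this, mul_zero]
      · rw [orth_lt w hw (P k) (P l) k (ho k k.2.le) (by rw [hPdeg l l.2.le]; exact h), mul_zero]
  have h4 : (L.transpose * D * L) * M = 1 := by
    have : (D * L * M) * L.transpose = 1 := by rw [← h3]; simp only [Matrix.mul_assoc]
    rw [← mul_eq_one_comm.1 this]
    simp only [Matrix.mul_assoc]
  refine ⟨?_, ?_⟩
  · have h5 := congrArg Matrix.det h4
    rw [Matrix.det_mul, Matrix.det_mul, Matrix.det_mul, Matrix.det_transpose, Matrix.det_one, hD,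
      Matrix.det_diagonal] at h5
    have h6 : 0 ≤ L.det * (∏ i : Fin n, γ i ^ 2) * L.det := by
      have : 0 ≤ ∏ i : Fin n, γ i ^ 2 := Finset.prod_nonneg fun i _ => sq_nonneg _
      nlinarith [mul_nonneg this (sq_nonneg L.det)]
    by_contra hneg
    nlinarith [mul_nonneg h6 (neg_nonneg.2 (not_lt.1 hneg))]
  · intro x y
    rw [Matrix.inv_eq_left_inv h4, Finset.sum_range]
    have : ∀ i j, (L.transpose * D * L) i j = ∑ k : Fin n, γ k ^ 2 * (P k).coeff i * (P k).coeff j := by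
      intro i j
      rw [Matrix.mul_apply]
      refine Finset.sum_congr rfl fun k _ => ?_
      rw [hD, Matrix.mul_diagonal]
      simp only [hL, Matrix.of_apply, Matrix.transpose_apply]
      ring
    simp only [this, Finset.sum_mul]
    rw [Finset.sum_congr rfl fun i _ => Finset.sum_comm, Finset.sum_comm]
    refine Finset.sum_congr rfl fun k _ => ?_
    rw [eval_fin _ (hdeg k) x, eval_fin _ (hdeg k) y, mul_assoc, Finset.sum_mul_sum, Finset.mul_sum]
    refine Finset.sum_congr rfl fun i _ => ?_
    rw [Finset.mul_sum]
    exact Finset.sum_congr rfl fun j _ => by ring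

theorem mom_deriv (ω : ℝ → ℝ → ℝ) (a b : ℝ → ℝ) (ha : Continuous a) (hb : Continuous b)
    (hω : ∀ s x, ω s x = (1 + Real.exp (-s - a x))⁻¹ * Real.exp (b x))
    (hmom : ∀ (s : ℝ) (k : ℕ), Integrable (fun x : ℝ => |x| ^ k * ω s x)) :
    (∀ (s : ℝ) (k : ℕ), Integrable (fun x : ℝ => x ^ k * ω s x)) ∧
    ∀ (k : ℕ) (s : ℝ), ∃ d, HasDerivAt (fun u => ∫ x : ℝ, x ^ k * ω u x) d s := by
  have hpos : ∀ s x, 0 < ω s x := fun s x => by rw [hω]; positivity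
  have hcont : ∀ s, Continuous (ω s) := by
    intro s
    rw [show ω s = fun x => (1 + Real.exp (-s - a x))⁻¹ * Real.exp (b x) from funext (hω s)]
    refine Continuous.mul (Continuous.inv₀ (by fun_prop) fun x => by positivity) (by fun_prop)
  have hint : ∀ (s : ℝ) (k : ℕ), Integrable (fun x : ℝ => x ^ k * ω s x) := by
    intro s k
    refine (hmom s k).mono' ((continuous_id.pow k).mul (hcont s)).aestronglyMeasurable ?_
    refine Filter.Eventually.of_forall fun x => ?_
    rw [Real.norm_eq_abs, abs_mul, abs_pow, abs_of_pos (hpos s x)]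
  refine ⟨hint, fun k s => ?_⟩
  have hmono : ∀ u v x, u ≤ v → ω u x ≤ ω v x := by
    intro u v x huv
    rw [hω, hω]
    gcongr
  let F' : ℝ → ℝ → ℝ := fun u x => x ^ k *
    ((Real.exp (-u - a x) / (1 + Real.exp (-u - a x)) ^ 2) * Real.exp (b x))
  refine ⟨∫ x, F' s x, (hasDerivAt_integral_of_dominated_loc_of_deriv_le (F' := F')
    (bound := fun x => |x| ^ k * ω (s + 1) x)
    (Metric.ball_mem_nhds s one_pos) ?_ (hint s k) ?_ ?_ (hmom _ k) ?_).2⟩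
  · exact Filter.Eventually.of_forall fun u => (hint u k).aestronglyMeasurable
  · refine Continuous.aestronglyMeasurable ?_
    refine (continuous_id.pow k).mul (Continuous.mul (Continuous.div (by fun_prop) (by fun_prop) fun x => by positivity) (by fun_prop))
  · refine Filter.Eventually.of_forall fun x u hu => ?_
    have hu' : u ≤ s + 1 := by
      rw [Metric.mem_ball, Real.dist_eq] at hu
      linarith [(abs_lt.1 hu).2]
    refine le_trans ?_ (mul_le_mul_of_nonneg_left (hmono u _ x hu') (by positivity))
    simp only [F']
    have hp : 0 < Real.exp (-u - a x) / (1 + Real.exp (-u - a x)) ^ 2 * Real.exp (b x) := by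
      positivity
    rw [Real.norm_eq_abs, abs_mul, abs_pow, abs_of_pos hp, hω]
    gcongr
    have he := Real.exp_pos (-u - a x)
    rw [div_le_iff₀ (by positivity), sq, inv_mul_cancel_left₀ (by positivity)]
    linarith
  · refine Filter.Eventually.of_forall fun x u _ => ?_
    simp only [F', hω]
    refine HasDerivAt.const_mul _ (HasDerivAt.mul_const ?_ _)
    have h1 : HasDerivAt (fun u => 1 + Real.exp (-u - a x)) (Real.exp (-u - a x) * (-1)) u :=
      ((((hasDerivAt_id u).neg).sub_const (a x)).exp).const_add 1
    have h2 := h1.fun_inv (by positivity)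
    rwa [mul_neg_one, neg_neg] at h2

/-- differentiability in `s` of the diagonal kernel and of the deformed partition
function, positivity of the latter, and Krasovsky's deformation identity
`d/ds log Z_n^Q(s) = -∫ ∂_s K_n^Q(x,x|s) ω_n(x|s) dx`. -/
theorem stmt_3
    (n : ℕ) (hn : 1 ≤ n)
    (V : Polynomial ℝ) (hVnc : 0 < V.natDegree) (hVeven : Even V.natDegree)
    (hVlead : 0 < V.leadingCoeff)
    (Q : ℝ → ℝ) (hQ : Continuous Q)
    (ω : ℝ → ℝ → ℝ)
    (hω : ∀ s x, ω s x =
      (1 + Real.exp (-s - (n : ℝ) ^ ((2 : ℝ) / 3) * Q x))⁻¹ * Real.exp (-(n : ℝ) * V.eval x))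
    (hmom : ∀ (s : ℝ) (k : ℕ), Integrable (fun x : ℝ => |x| ^ k * ω s x))
    (ZQ : ℝ → ℝ)
    (hZQ : ∀ s, ZQ s = ∫ l : Fin n → ℝ,
      (∏ p ∈ Finset.univ.filter (fun p : Fin n × Fin n => p.1 < p.2), (l p.2 - l p.1) ^ 2) *
        ∏ j, ω s (l j))
    (P : ℝ → ℕ → Polynomial ℝ)
    (hPmonic : ∀ s k, k ≤ n → (P s k).Monic)
    (hPdeg : ∀ s k, k ≤ n → (P s k).natDegree = k)
    (hPorth : ∀ s k, k ≤ n → ∀ j < k, (∫ x : ℝ, (P s k).eval x * x ^ j * ω s x) = 0)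
    (γ : ℝ → ℕ → ℝ)
    (hγpos : ∀ s k, k ≤ n → 0 < γ s k)
    (hγ : ∀ s k, k ≤ n → ((γ s k) ^ 2)⁻¹ = ∫ x : ℝ, ((P s k).eval x) ^ 2 * ω s x)
    (K : ℝ → ℝ → ℝ → ℝ)
    (hK : ∀ s x y, K s x y =
      ∑ k ∈ Finset.range n, (γ s k) ^ 2 * (P s k).eval x * (P s k).eval y) :
    (∀ x : ℝ, Differentiable ℝ (fun s : ℝ => K s x x)) ∧
    Differentiable ℝ ZQ ∧
    (∀ s : ℝ, 0 < ZQ s) ∧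
    (∀ s : ℝ,
      Integrable (fun x : ℝ => deriv (fun u : ℝ => K u x x) s * ω s x) ∧
      deriv (fun u : ℝ => Real.log (ZQ u)) s =
        -∫ x : ℝ, deriv (fun u : ℝ => K u x x) s * ω s x) := by
  obtain ⟨hint, hder⟩ := mom_deriv ω (fun x => (n : ℝ) ^ ((2 : ℝ) / 3) * Q x)
    (fun x => -(n : ℝ) * V.eval x) (by fun_prop) (by fun_prop) hω hmom
  choose d hd using hder
  set H : ℝ → Matrix (Fin n) (Fin n) ℝ := fun s =>
    Matrix.of fun i j : Fin n => ∫ x : ℝ, x ^ ((i : ℕ) + j) * ω s x with hH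
  have hHd : ∀ s i j, HasDerivAt (fun u => H u i j)
      ((Matrix.of fun i j : Fin n => d ((i : ℕ) + j) s) i j) s := fun s i j => hd _ _
  have hg := fun s => gram (n := n) (ω s) (hint s) (P s) (hPdeg s) (hPorth s) (γ s) (hγpos s) (hγ s)
    (H s) (fun _ _ => rfl)
  have hdet : ∀ s, (H s).det ≠ 0 := fun s => (hg s).1.ne'
  have hZ : ZQ = fun s => (n.factorial : ℝ) * (H s).det := by
    funext s
    rw [hZQ, vand_int (ω s) (hint s)]
  have hKx : ∀ x, (fun u => K u x x) =
      fun u => ∑ i : Fin n, ∑ j : Fin n, (H u)⁻¹ i j * (x ^ (i : ℕ) * x ^ (j : ℕ)) := by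
    intro x
    funext u
    rw [hK, (hg u).2]
  set G' : ℝ → Matrix (Fin n) (Fin n) ℝ := fun s =>
    Matrix.of fun i j => deriv (fun u => (H u)⁻¹ i j) s with hG'
  have hG : ∀ s i j, HasDerivAt (fun u => (H u)⁻¹ i j) (G' s i j) s := fun s i j =>
    (inv_diff H _ s (hHd s) (hdet s) i j).hasDerivAt
  have hKd : ∀ x s, HasDerivAt (fun u => K u x x)
      (∑ i : Fin n, ∑ j : Fin n, G' s i j * (x ^ (i : ℕ) * x ^ (j : ℕ))) s := by
    intro x s
    rw [hKx]
    exact HasDerivAt.fun_sum fun i _ => HasDerivAt.fun_sum fun j _ => (hG s i j).mul_const _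
  have hZd : ∀ s, HasDerivAt ZQ
      ((n.factorial : ℝ) * ((H s).det * -Matrix.trace (G' s * H s))) s := by
    intro s
    rw [hZ]
    exact (inv_trace H _ s (hHd s) hdet (G' s) (hG s)).const_mul _
  have hfac : (0 : ℝ) < n.factorial := by exact_mod_cast n.factorial_pos
  have hZpos : ∀ s, 0 < ZQ s := fun s => by
    rw [hZ]
    exact mul_pos hfac (hg s).1
  refine ⟨fun x s => (hKd x s).differentiableAt, fun s => (hZd s).differentiableAt, hZpos, ?_⟩
  intro s
  have he : (fun x : ℝ => deriv (fun u : ℝ => K u x x) s * ω s x) =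
      fun x => ∑ i : Fin n, ∑ j : Fin n, G' s i j * (x ^ ((j : ℕ) + i) * ω s x) := by
    funext x
    rw [(hKd x s).deriv, Finset.sum_mul]
    refine Finset.sum_congr rfl fun i _ => ?_
    rw [Finset.sum_mul]
    refine Finset.sum_congr rfl fun j _ => ?_
    ring
  rw [he]
  refine ⟨integrable_finsetSum _ fun i _ => integrable_finsetSum _ fun j _ =>
    (hint s _).const_mul _, ?_⟩
  rw [((hZd s).log (hZpos s).ne').deriv]
  have ht : ∫ x : ℝ, ∑ i : Fin n, ∑ j : Fin n, G' s i j * (x ^ ((j : ℕ) + i) * ω s x) =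
      Matrix.trace (G' s * H s) := by
    rw [Matrix.trace]
    refine (integral_finsetSum _ fun i _ => integrable_finsetSum _ fun j _ =>
      (hint s _).const_mul _).trans ?_
    refine Finset.sum_congr rfl fun i _ => ?_
    refine (integral_finsetSum _ fun j _ => (hint s _).const_mul _).trans ?_
    rw [Matrix.diag_apply, Matrix.mul_apply]
    refine Finset.sum_congr rfl fun j _ => ?_
    rw [integral_const_mul]
    rfl
  rw [ht, hZ]
  have := hdet s
  field_simp
end

section
/- Let M > 0 and an integer N ≥ 1 be fixed. Then there exist constants C > 0 and t_0 > 0 such that for all t ≥ t_0 and all y ≥ −M, | ∫_0^a g(x) log(1 + e^{−y−tx}) dx − Σ_{k=0}^N (g̃^{(k)}(0)/k!) · F_{k−κ}(y) · t^{−(k+1−κ)} | ≤ C · t^{−(N+2−κ)}. -/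
open MeasureTheory
open scoped ENNReal

lemma aux_L_nonneg (z : ℝ) : 0 ≤ Real.log (1 + Real.exp z) :=
  Real.log_nonneg (by linarith [Real.exp_pos z])

lemma aux_L_le {M y t x : ℝ} (hy : -M ≤ y) :
    Real.log (1 + Real.exp (-y - t * x)) ≤ Real.exp M * Real.exp (-(t * x)) := by
  have h1 := Real.log_le_sub_one_of_pos (x := 1 + Real.exp (-y - t * x)) (by positivity)
  have h2 : Real.exp (-y - t * x) ≤ Real.exp (M + -(t * x)) := Real.exp_le_exp.2 (by linarith)
  rw [Real.exp_add] at h2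
  linarith

lemma aux_L_cont (t y : ℝ) : Continuous (fun x : ℝ => Real.log (1 + Real.exp (-y - t * x))) := by
  apply Continuous.log
  · fun_prop
  · intro x; positivity

lemma aux_gamma_int {β t : ℝ} (hβ : -1 < β) (ht : 0 < t) :
    IntegrableOn (fun x : ℝ => x ^ β * Real.exp (-(t * x))) (Set.Ioi 0) := by
  have := integrableOn_rpow_mul_exp_neg_mul_rpow (p := 1) (s := β) (b := t) hβ one_pos ht
  refine this.congr_fun (fun x hx => ?_) measurableSet_Ioi
  simp

lemma aux_int {β t y : ℝ} (hβ : -1 < β) (ht : 0 < t) :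
    IntegrableOn (fun x : ℝ => x ^ β * Real.log (1 + Real.exp (-y - t * x))) (Set.Ioi 0) := by
  refine Integrable.mono' (g := fun x : ℝ => Real.exp (-y) * (x ^ β * Real.exp (-(t * x))))
    ((aux_gamma_int hβ ht).const_mul _) ?_ ?_
  · apply Measurable.aestronglyMeasurable
    exact (measurable_id.pow_const β).mul (aux_L_cont t y).measurable
  · refine (ae_restrict_iff' measurableSet_Ioi).2 (ae_of_all _ fun x hx => ?_)
    have hx0 : 0 ≤ x ^ β := Real.rpow_nonneg (le_of_lt hx) _
    rw [Real.norm_of_nonneg (mul_nonneg hx0 (aux_L_nonneg _))]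
    have := aux_L_le (M := -y) (y := y) (t := t) (x := x) (by simp)
    calc _ ≤ x ^ β * (Real.exp (-y) * Real.exp (-(t * x))) := by gcongr
      _ = _ := by ring

lemma aux_F {β t y : ℝ} (ht : 0 < t) :
    (∫ v in Set.Ioi (0 : ℝ), v ^ β * Real.log (1 + Real.exp (-y - v))) * t ^ (-(β + 1)) =
    ∫ x in Set.Ioi (0 : ℝ), x ^ β * Real.log (1 + Real.exp (-y - t * x)) := by
  have h := integral_comp_mul_left_Ioi
    (fun v : ℝ => v ^ β * Real.log (1 + Real.exp (-y - v))) 0 ht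
  rw [mul_zero, smul_eq_mul] at h
  have h2 : ∫ x in Set.Ioi (0 : ℝ), (t * x) ^ β * Real.log (1 + Real.exp (-y - t * x)) =
      t ^ β * ∫ x in Set.Ioi (0 : ℝ), x ^ β * Real.log (1 + Real.exp (-y - t * x)) := by
    rw [← integral_const_mul]
    refine setIntegral_congr_fun measurableSet_Ioi fun x hx => ?_
    rw [Real.mul_rpow ht.le (le_of_lt hx)]
    ring
  rw [h2] at h
  have h3 : t ^ (-(β + 1)) = (t ^ β)⁻¹ * t⁻¹ := by
    rw [Real.rpow_neg ht.le, Real.rpow_add_one ht.ne', mul_inv]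
  have h4 : t ^ β ≠ 0 := (Real.rpow_pos_of_pos ht _).ne'
  rw [h3]
  field_simp
  field_simp at h
  linarith

lemma aux_taylor (δ : ℝ) (hδ0 : 0 < δ) (gtil : ℝ → ℝ)
    (hgtil : ∃ U : Set ℝ, IsOpen U ∧ Set.Icc (0 : ℝ) δ ⊆ U ∧ ContDiffOn ℝ (⊤ : ℕ∞) gtil U)
    (N : ℕ) : ∃ K : ℝ, 0 ≤ K ∧ ∀ x ∈ Set.Icc 0 δ, |gtil x - ∑ k ∈ Finset.range (N + 1),
      (iteratedDeriv k gtil 0 / (k.factorial : ℝ)) * x ^ k| ≤ K * x ^ (N + 1) := by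
  obtain ⟨U, hU, hs, hc⟩ := hgtil
  have h0 : (0 : ℝ) ∈ Set.Icc 0 δ := ⟨le_rfl, hδ0.le⟩
  have hat : ∀ n : ℕ, ContDiffAt ℝ n gtil 0 := fun n =>
    (hc.contDiffAt (hU.mem_nhds (hs h0))).of_le (by exact_mod_cast le_top)
  obtain ⟨K, hK⟩ := exists_taylor_mean_remainder_bound (n := N) (f := gtil) hδ0.le
    ((hc.mono hs).of_le (by exact_mod_cast le_top))
  refine ⟨|K|, abs_nonneg _, fun x hx => ?_⟩
  have h := hK x hx
  rw [taylor_within_apply, Real.norm_eq_abs, sub_zero] at h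
  have e : ∑ k ∈ Finset.range (N + 1), (iteratedDeriv k gtil 0 / (k.factorial : ℝ)) * x ^ k =
      ∑ k ∈ Finset.range (N + 1), ((k.factorial : ℝ)⁻¹ * x ^ k) •
        iteratedDerivWithin k gtil (Set.Icc 0 δ) 0 := by
    refine Finset.sum_congr rfl fun k _ => ?_
    rw [iteratedDerivWithin_eq_iteratedDeriv (uniqueDiffOn_Icc hδ0) (hat k) h0, smul_eq_mul]
    ring
  rw [e]
  refine h.trans ?_
  have := pow_nonneg hx.1 (N + 1)
  gcongr
  exact le_abs_self K

lemma aux_exp {δ κ t : ℝ} (hδ : 0 < δ) (hκ0 : 0 ≤ κ) (N : ℕ) (ht : 1 ≤ t) :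
    Real.exp (-(t * δ)) ≤ ((N + 2).factorial / δ ^ (N + 2)) * t ^ (-((N : ℝ) + 2 - κ)) := by
  have ht0 : 0 < t := by linarith
  have h1 := Real.pow_div_factorial_le_exp (t * δ) (by positivity) (N + 2)
  have h2 : t ^ (-((N : ℝ) + 2)) ≤ t ^ (-((N : ℝ) + 2 - κ)) :=
    Real.rpow_le_rpow_of_exponent_le ht (by linarith)
  have h3 : t ^ (-((N : ℝ) + 2)) = (t ^ (N + 2))⁻¹ := by
    rw [Real.rpow_neg ht0.le, ← Real.rpow_natCast]; push_cast; rfl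
  refine le_trans ?_ (mul_le_mul_of_nonneg_left h2 (by positivity))
  rw [h3, Real.exp_neg]
  refine (inv_anti₀ (by positivity) h1).trans (le_of_eq ?_)
  rw [mul_pow, inv_div]
  field_simp

/-- Watson's lemma for Fermi-type Laplace integrals, `f(x) = x`. -/
theorem stmt_4
    (a : ℝ≥0∞) (ha : 0 < a)
    (κ : ℝ) (hκ0 : 0 ≤ κ) (hκ1 : κ < 1)
    (I : Set ℝ) (hI : I = {x : ℝ | 0 < x ∧ ENNReal.ofReal x < a})
    (g : ℝ → ℝ) (hg : IntegrableOn g I)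
    (δ : ℝ) (hδ0 : 0 < δ) (hδa : ENNReal.ofReal δ < a)
    (gtil : ℝ → ℝ)
    (hgtil : ∃ U : Set ℝ, IsOpen U ∧ Set.Icc (0 : ℝ) δ ⊆ U ∧ ContDiffOn ℝ (⊤ : ℕ∞) gtil U)
    (hgg : ∀ x : ℝ, 0 < x → x < δ → g x = gtil x * x ^ (-κ))
    (F : ℝ → ℝ → ℝ)
    (hF : ∀ β y, F β y = ∫ v in Set.Ioi (0 : ℝ), v ^ β * Real.log (1 + Real.exp (-y - v)))
    (M : ℝ) (hM : 0 < M) (N : ℕ) (hN : 1 ≤ N) :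
    ∃ C > 0, ∃ t0 > 0, ∀ t : ℝ, t0 ≤ t → ∀ y : ℝ, -M ≤ y →
      |(∫ x in I, g x * Real.log (1 + Real.exp (-y - t * x))) -
        ∑ k ∈ Finset.range (N + 1),
          (iteratedDeriv k gtil 0 / (k.factorial : ℝ)) * F ((k : ℝ) - κ) y *
            t ^ (-((k : ℝ) + 1 - κ))|
        ≤ C * t ^ (-((N : ℝ) + 2 - κ)) := by
  have hImeas : MeasurableSet I := by
    rw [hI]
    exact measurableSet_Ioi.inter (measurableSet_lt ENNReal.measurable_ofReal measurable_const)
  have hIsub : I ⊆ Set.Ioi 0 := by rw [hI]; exact fun x hx => hx.1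
  obtain ⟨K, hK0, hK⟩ := aux_taylor δ hδ0 gtil hgtil N
  set c : ℕ → ℝ := fun k => iteratedDeriv k gtil 0 / (k.factorial : ℝ) with hc
  set A : ℝ := ∑ k ∈ Finset.range (N + 1), |c k| * δ ^ ((k : ℝ) - (N + 1)) with hA
  have hA0 : 0 ≤ A := Finset.sum_nonneg fun k _ => by positivity
  set G : ℝ := ∫ x in I, |g x| with hG
  have hG0 : 0 ≤ G := integral_nonneg fun x => abs_nonneg _
  have hβ : ∀ k : ℕ, -1 < (k : ℝ) - κ := fun k => by
    have : (0 : ℝ) ≤ k := Nat.cast_nonneg k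
    linarith
  have hβN : -1 < (N : ℝ) + 1 - κ := by have := hβ N; linarith
  set B : ℝ := Real.exp M * ((K + A) * Real.Gamma ((N : ℝ) + 2 - κ) +
    G * ((N + 2).factorial / δ ^ (N + 2))) with hB
  have hΓ : 0 ≤ Real.Gamma ((N : ℝ) + 2 - κ) := (Real.Gamma_pos_of_pos (by linarith)).le
  have hB0 : 0 ≤ B := by positivity
  refine ⟨B + 1, by linarith, 1, one_pos, fun t ht y hy => ?_⟩
  have ht0 : 0 < t := by linarith
  set L : ℝ → ℝ := fun x => Real.log (1 + Real.exp (-y - t * x)) with hL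
  have hL0 : ∀ x, 0 ≤ L x := fun x => aux_L_nonneg _
  have hLe : ∀ x, L x ≤ Real.exp M * Real.exp (-(t * x)) := fun x => aux_L_le hy
  have hLM : ∀ x, 0 < x → L x ≤ Real.exp M := fun x hx => (hLe x).trans (by
    have : Real.exp (-(t * x)) ≤ 1 := Real.exp_le_one_iff.2 (by nlinarith)
    nlinarith [Real.exp_pos M])
  -- integrability
  have hgL : IntegrableOn (fun x => g x * L x) I := by
    refine Integrable.mul_bdd (c := Real.exp M) hg (aux_L_cont t y).aestronglyMeasurable ?_
    refine (ae_restrict_iff' hImeas).2 (ae_of_all _ fun x hx => ?_)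
    rw [Real.norm_of_nonneg (hL0 x)]
    exact hLM x (hIsub hx)
  have hgL' : IntegrableOn (fun x => I.indicator g x * L x) (Set.Ioi 0) := by
    have h1 : (fun x => I.indicator g x * L x) = I.indicator (fun x => g x * L x) := by
      ext x; by_cases hx : x ∈ I <;> simp [hx]
    rw [h1]
    exact (hgL.integrable_indicator hImeas).integrableOn
  have hint : ∫ x in I, g x * L x = ∫ x in Set.Ioi 0, I.indicator g x * L x := by
    have h1 : (fun x => I.indicator g x * L x) = I.indicator (fun x => g x * L x) := by
      ext x; by_cases hx : x ∈ I <;> simp [hx]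
    rw [h1, setIntegral_indicator hImeas, Set.inter_eq_self_of_subset_right hIsub]
  have hpi : ∀ k ∈ Finset.range (N + 1),
      IntegrableOn (fun x : ℝ => c k * (x ^ ((k : ℝ) - κ) * L x)) (Set.Ioi 0) :=
    fun k _ => (aux_int (hβ k) ht0).const_mul _
  have hsum : ∑ k ∈ Finset.range (N + 1), c k * F ((k : ℝ) - κ) y * t ^ (-((k : ℝ) + 1 - κ)) =
      ∫ x in Set.Ioi (0 : ℝ), ∑ k ∈ Finset.range (N + 1), c k * (x ^ ((k : ℝ) - κ) * L x) := by
    rw [integral_finsetSum _ hpi]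
    refine Finset.sum_congr rfl fun k _ => ?_
    rw [integral_const_mul, ← aux_F ht0, hF, mul_assoc]
    congr 3
    ring
  rw [hint, hsum, ← integral_sub hgL' (integrable_finsetSum _ hpi)]
  -- the dominating function
  set H : ℝ → ℝ := fun x => Real.exp M * (K + A) * (x ^ ((N : ℝ) + 1 - κ) * Real.exp (-(t * x))) +
    Real.exp M * Real.exp (-(t * δ)) * I.indicator (fun x => |g x|) x with hH
  have hH1 := (aux_gamma_int hβN ht0).const_mul (Real.exp M * (K + A))
  have hH2 : IntegrableOn (fun x => Real.exp M * Real.exp (-(t * δ)) *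
      I.indicator (fun x => |g x|) x) (Set.Ioi 0) :=
    (((IntegrableOn.integrable_indicator (f := fun x => |g x|) hg.abs hImeas)).integrableOn).const_mul _
  have hHint : IntegrableOn H (Set.Ioi 0) := hH1.add hH2
  have hbound : ∀ x ∈ Set.Ioi (0 : ℝ), ‖I.indicator g x * L x -
      ∑ k ∈ Finset.range (N + 1), c k * (x ^ ((k : ℝ) - κ) * L x)‖ ≤ H x := by
    intro x hx
    have hx0 : 0 < x := hx
    have e1 : I.indicator g x * L x -
      ∑ k ∈ Finset.range (N + 1), c k * (x ^ ((k : ℝ) - κ) * L x) =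
      (I.indicator g x - ∑ k ∈ Finset.range (N + 1), c k * x ^ ((k : ℝ) - κ)) * L x := by
      rw [sub_mul, Finset.sum_mul]
      simp only [mul_assoc]
    rw [e1, Real.norm_eq_abs, abs_mul, abs_of_nonneg (hL0 x)]
    have hP : 0 ≤ x ^ ((N : ℝ) + 1 - κ) := Real.rpow_nonneg hx0.le _
    have hind : 0 ≤ I.indicator (fun x => |g x|) x :=
      Set.indicator_nonneg (fun _ _ => abs_nonneg _) _
    rcases lt_or_ge x δ with hxδ | hxδ
    · have hxI : x ∈ I := by
        rw [hI]
        exact ⟨hx0, lt_of_le_of_lt (ENNReal.ofReal_le_ofReal hxδ.le) hδa⟩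
      have e2 : I.indicator g x - ∑ k ∈ Finset.range (N + 1), c k * x ^ ((k : ℝ) - κ) =
          (gtil x - ∑ k ∈ Finset.range (N + 1), c k * x ^ k) * x ^ (-κ) := by
        rw [Set.indicator_of_mem hxI, hgg x hx0 hxδ, sub_mul, Finset.sum_mul]
        congr 1
        refine Finset.sum_congr rfl fun k _ => ?_
        rw [sub_eq_add_neg, Real.rpow_add hx0, Real.rpow_natCast, mul_assoc]
      have h3 : |I.indicator g x - ∑ k ∈ Finset.range (N + 1), c k * x ^ ((k : ℝ) - κ)| ≤
          (K + A) * x ^ ((N : ℝ) + 1 - κ) := by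
        rw [e2, abs_mul, abs_of_nonneg (Real.rpow_nonneg hx0.le (-κ))]
        calc _ ≤ K * x ^ (N + 1) * x ^ (-κ) :=
              mul_le_mul_of_nonneg_right (hK x ⟨hx0.le, hxδ.le⟩) (Real.rpow_nonneg hx0.le _)
          _ = K * x ^ ((N : ℝ) + 1 - κ) := by
              rw [sub_eq_add_neg ((N : ℝ) + 1), Real.rpow_add hx0, mul_assoc,
                ← Real.rpow_natCast]
              push_cast
              rfl
          _ ≤ _ := by nlinarith
      calc _ ≤ ((K + A) * x ^ ((N : ℝ) + 1 - κ)) * (Real.exp M * Real.exp (-(t * x))) :=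
            mul_le_mul h3 (hLe x) (hL0 x) (by positivity)
        _ = Real.exp M * (K + A) * (x ^ ((N : ℝ) + 1 - κ) * Real.exp (-(t * x))) := by ring
        _ ≤ H x := by
            rw [hH]
            exact le_add_of_nonneg_right (by positivity)
    · have h3 : |∑ k ∈ Finset.range (N + 1), c k * x ^ ((k : ℝ) - κ)| ≤
          (K + A) * x ^ ((N : ℝ) + 1 - κ) := by
        calc _ ≤ ∑ k ∈ Finset.range (N + 1), |c k * x ^ ((k : ℝ) - κ)| :=
              Finset.abs_sum_le_sum_abs _ _
          _ ≤ ∑ k ∈ Finset.range (N + 1),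
              |c k| * δ ^ ((k : ℝ) - (N + 1)) * x ^ ((N : ℝ) + 1 - κ) := by
              refine Finset.sum_le_sum fun k hk => ?_
              rw [abs_mul, abs_of_nonneg (Real.rpow_nonneg hx0.le ((k : ℝ) - κ)), mul_assoc]
              have hkN : (k : ℝ) ≤ N := by
                exact_mod_cast Nat.lt_succ_iff.1 (Finset.mem_range.1 hk)
              have h5 : x ^ ((k : ℝ) - (N + 1)) ≤ δ ^ ((k : ℝ) - (N + 1)) :=
                Real.rpow_le_rpow_of_nonpos hδ0 hxδ (by linarith)
              have h6 : x ^ ((k : ℝ) - κ) = x ^ ((k : ℝ) - (N + 1)) * x ^ ((N : ℝ) + 1 - κ) := by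
                rw [← Real.rpow_add hx0]; congr 1; ring
              rw [h6]
              gcongr
          _ = A * x ^ ((N : ℝ) + 1 - κ) := by rw [hA, Finset.sum_mul]
          _ ≤ _ := by nlinarith
      have h4 : |I.indicator g x| = I.indicator (fun x => |g x|) x := by
        by_cases hxI : x ∈ I <;> simp [hxI]
      have h7 : L x ≤ Real.exp M * Real.exp (-(t * δ)) := (hLe x).trans (by gcongr)
      calc _ ≤ (|I.indicator g x| + |∑ k ∈ Finset.range (N + 1), c k * x ^ ((k : ℝ) - κ)|) * L x :=
            mul_le_mul_of_nonneg_right (abs_sub _ _) (hL0 x)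
        _ = |∑ k ∈ Finset.range (N + 1), c k * x ^ ((k : ℝ) - κ)| * L x +
            I.indicator (fun x => |g x|) x * L x := by rw [h4]; ring
        _ ≤ ((K + A) * x ^ ((N : ℝ) + 1 - κ)) * (Real.exp M * Real.exp (-(t * x))) +
            I.indicator (fun x => |g x|) x * (Real.exp M * Real.exp (-(t * δ))) :=
            add_le_add (mul_le_mul h3 (hLe x) (hL0 x) (by positivity))
              (mul_le_mul_of_nonneg_left h7 hind)
        _ = H x := by rw [hH]; ring
  have hfin := norm_integral_le_of_norm_le hHint
    ((ae_restrict_iff' measurableSet_Ioi).2 (ae_of_all _ hbound))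
  rw [Real.norm_eq_abs] at hfin
  refine hfin.trans ?_
  have hI1 : ∫ x in Set.Ioi (0 : ℝ), x ^ ((N : ℝ) + 1 - κ) * Real.exp (-(t * x)) =
      t ^ (-((N : ℝ) + 2 - κ)) * Real.Gamma ((N : ℝ) + 2 - κ) := by
    have h := Real.integral_rpow_mul_exp_neg_mul_Ioi (a := (N : ℝ) + 2 - κ) (r := t)
      (by linarith) ht0
    rw [show (N : ℝ) + 2 - κ - 1 = (N : ℝ) + 1 - κ by ring] at h
    rw [h, Real.rpow_neg ht0.le, one_div, Real.inv_rpow ht0.le]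
  have hI2 : ∫ x in Set.Ioi (0 : ℝ), I.indicator (fun x => |g x|) x = G := by
    rw [setIntegral_indicator hImeas, Set.inter_eq_self_of_subset_right hIsub]
  rw [hH, integral_add hH1 hH2, integral_const_mul, integral_const_mul, hI1, hI2]
  have hE := aux_exp (κ := κ) hδ0 hκ0 N ht
  have hT : 0 ≤ t ^ (-((N : ℝ) + 2 - κ)) := Real.rpow_nonneg ht0.le _
  have hE2 := mul_le_mul_of_nonneg_left hE (mul_nonneg (Real.exp_pos M).le hG0)
  have hfinal : Real.exp M * (K + A) * (t ^ (-((N : ℝ) + 2 - κ)) * Real.Gamma ((N : ℝ) + 2 - κ)) +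
      Real.exp M * G * ((N + 2).factorial / δ ^ (N + 2) * t ^ (-((N : ℝ) + 2 - κ))) =
      B * t ^ (-((N : ℝ) + 2 - κ)) := by rw [hB]; ring
  nlinarith
end

section
/- Let M > 0 and an integer N ≥ 1 be fixed. Then ĝ is well defined and C^∞ on a neighborhood of 0, and there exist constants C > 0 and t_0 > 0 such that for all t ≥ t_0 and all y ≥ −M, | ∫_0^a g(x) log(1 + e^{−y − t f(x)}) dx − Σ_{k=0}^N (ĝ^{(k)}(0)/k!) · F_{k−κ}(y) · t^{−(k+1−κ)} | ≤ C · t^{−(N+2−κ)}. -/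
open MeasureTheory
open scoped ENNReal

lemma had_deriv (r : ℝ) (n : ℕ) (φ : ℝ → ℝ) (hφ : ContDiffOn ℝ (⊤ : ℕ∞) φ (Set.Ioo (-r) r))
    (x : ℝ) (hx : x ∈ Set.Ioo (-r) r) :
    HasDerivAt (fun u => ∫ s in (0:ℝ)..1, s ^ n * φ (s * u))
      (∫ s in (0:ℝ)..1, s ^ (n+1) * deriv φ (s * x)) x := by
  obtain ⟨r', hr1, hr2⟩ := exists_between (abs_lt.2 hx)
  have hr0 : 0 < r' := (abs_nonneg x).trans_lt hr1
  have hsub : Set.Icc (-r') r' ⊆ Set.Ioo (-r) r := fun z hz => ⟨by linarith [hz.1], by linarith [hz.2]⟩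
  have hd : ContinuousOn (deriv φ) (Set.Ioo (-r) r) :=
    (hφ.continuousOn_deriv_of_isOpen isOpen_Ioo (by simp))
  obtain ⟨B, hB⟩ := isCompact_Icc.exists_bound_of_continuousOn (hd.mono hsub)
  have hmem : ∀ s ∈ Set.uIcc (0:ℝ) 1, ∀ z ∈ Set.Ioo (-r') r', s * z ∈ Set.Icc (-r') r' := by
    intro s hs z hz
    rw [Set.uIcc_of_le zero_le_one] at hs
    refine abs_le.1 ?_
    rw [abs_mul, abs_of_nonneg hs.1]
    have : |z| ≤ r' := (abs_lt.2 hz).le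
    nlinarith [hs.2, abs_nonneg z]
  have hIoc : ∀ s ∈ Set.uIoc (0:ℝ) 1, s ∈ Set.uIcc (0:ℝ) 1 := fun s hs => Set.uIoc_subset_uIcc hs
  have hc : ∀ (m : ℕ) (ψ : ℝ → ℝ), ContinuousOn ψ (Set.Ioo (-r) r) → ∀ z ∈ Set.Ioo (-r') r',
      IntervalIntegrable (fun s => s ^ m * ψ (s * z)) volume 0 1 := by
    intro m ψ hψ z hz
    apply ContinuousOn.intervalIntegrable
    apply ContinuousOn.mul (by fun_prop)
    exact hψ.comp (by fun_prop) (fun s hs => hsub (hmem s hs z hz))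
  have hxr : x ∈ Set.Ioo (-r') r' := abs_lt.1 hr1
  have hnh : Set.Ioo (-r') r' ∈ nhds x := Ioo_mem_nhds hxr.1 hxr.2
  refine (intervalIntegral.hasDerivAt_integral_of_dominated_loc_of_deriv_le
    (F := fun u s => s ^ n * φ (s * u)) (F' := fun u s => s ^ (n+1) * deriv φ (s * u))
    (bound := fun _ => B) hnh ?_ ?_ ?_ ?_ ?_ ?_).2
  · filter_upwards [hnh] with z hz
    exact (intervalIntegrable_iff.1 (hc n φ hφ.continuousOn z hz)).aestronglyMeasurable
  · exact hc n φ hφ.continuousOn x hxr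
  · exact (intervalIntegrable_iff.1 (hc _ _ hd x hxr)).aestronglyMeasurable
  · refine Filter.Eventually.of_forall fun s hs z hz => ?_
    have h1 := hB _ (hmem s (hIoc s hs) z hz)
    have hs' := hIoc s hs
    rw [Set.uIcc_of_le zero_le_one] at hs'
    rw [norm_mul, norm_pow, Real.norm_of_nonneg hs'.1]
    have : s ^ (n+1) ≤ 1 := pow_le_one₀ hs'.1 hs'.2
    have := pow_nonneg hs'.1 (n+1)
    nlinarith [norm_nonneg (deriv φ (s * z))]
  · simp
  · refine Filter.Eventually.of_forall fun s hs z hz => ?_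
    have h1 := hsub (hmem s (hIoc s hs) z hz)
    have h2 : HasDerivAt φ (deriv φ (s * z)) (s * z) :=
      ((hφ.contDiffAt (isOpen_Ioo.mem_nhds h1)).differentiableAt (by simp)).hasDerivAt
    have h3 : HasDerivAt (fun u => s * u) s z := by simpa using (hasDerivAt_id z).const_mul s
    exact ((h2.comp z h3).const_mul (s ^ n)).congr_deriv (by ring)

lemma had_smooth (r : ℝ) (m : ℕ) : ∀ (n : ℕ) (φ : ℝ → ℝ),
    ContDiffOn ℝ (⊤ : ℕ∞) φ (Set.Ioo (-r) r) →
    ContDiffOn ℝ m (fun u => ∫ s in (0:ℝ)..1, s ^ n * φ (s * u)) (Set.Ioo (-r) r) := by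
  induction m with
  | zero =>
    intro n φ hφ
    simp only [Nat.cast_zero, contDiffOn_zero]
    exact fun x hx => (had_deriv r n φ hφ x hx).continuousAt.continuousWithinAt
  | succ m ih =>
    intro n φ hφ
    push_cast
    rw [contDiffOn_succ_iff_deriv_of_isOpen isOpen_Ioo]
    refine ⟨fun x hx => (had_deriv r n φ hφ x hx).differentiableAt.differentiableWithinAt,
      by simp, ?_⟩
    refine (ih (n+1) (deriv φ) (hφ.deriv_of_isOpen isOpen_Ioo (by simp))).congr ?_
    exact fun x hx => (had_deriv r n φ hφ x hx).deriv

lemma hadamard (r : ℝ) (h : ℝ → ℝ) (hh : ContDiffOn ℝ (⊤ : ℕ∞) h (Set.Ioo (-r) r)) (h0 : h 0 = 0) :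
    ∃ q : ℝ → ℝ, ContDiffOn ℝ (⊤ : ℕ∞) q (Set.Ioo (-r) r) ∧ q 0 = deriv h 0 ∧
      ∀ u ∈ Set.Ioo (-r) r, h u = u * q u := by
  have hd : ContDiffOn ℝ (⊤ : ℕ∞) (deriv h) (Set.Ioo (-r) r) := hh.deriv_of_isOpen isOpen_Ioo (by simp)
  refine ⟨fun u => ∫ s in (0:ℝ)..1, s ^ 0 * deriv h (s * u), ?_, by simp, ?_⟩
  · rw [contDiffOn_infty]
    exact fun m => had_smooth r m 0 _ hd
  · intro u hu
    have hmem : ∀ s ∈ Set.uIcc (0:ℝ) 1, s * u ∈ Set.Ioo (-r) r := by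
      intro s hs
      rw [Set.uIcc_of_le zero_le_one] at hs
      refine abs_lt.1 ?_
      rw [abs_mul, abs_of_nonneg hs.1]
      have : |u| < r := abs_lt.2 hu
      nlinarith [hs.2, abs_nonneg u]
    have := intervalIntegral.integral_eq_sub_of_hasDerivAt (a := 0) (b := 1)
      (f := fun s => h (s * u)) (f' := fun s => u * deriv h (s * u)) ?_ ?_
    · simp only [one_mul, zero_mul, h0, sub_zero, intervalIntegral.integral_const_mul] at this
      simp [this]
    · intro s hs
      have h2 : HasDerivAt h (deriv h (s * u)) (s * u) :=
        ((hh.contDiffAt (isOpen_Ioo.mem_nhds (hmem s hs))).differentiableAt (by simp)).hasDerivAt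
      have h3 : HasDerivAt (fun s => s * u) u s := by simpa using (hasDerivAt_id s).mul_const u
      exact (h2.comp s h3).congr_deriv (by ring)
    · apply ContinuousOn.intervalIntegrable
      apply ContinuousOn.mul (by fun_prop)
      exact hd.continuousOn.comp (by fun_prop) hmem

lemma local_inv (f : ℝ → ℝ) (V : Set ℝ) (hV : IsOpen V) (h0V : (0:ℝ) ∈ V)
    (hf : ContDiffOn ℝ (⊤ : ℕ∞) f V) (hf0 : f 0 = 0) (hf'0 : 0 < deriv f 0)
    (δ : ℝ) (hδ : 0 < δ) (W : Set ℝ) (hW : W ∈ nhds (0:ℝ)) :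
    ∃ (ρ η : ℝ) (finv q : ℝ → ℝ), 0 < ρ ∧ ρ ≤ δ ∧ 0 < η ∧
      (∀ x ∈ Set.Icc (0 : ℝ) ρ, finv (f x) = x) ∧
      (∀ u ∈ Set.Ioo (-η) η, f (finv u) = u) ∧
      ContDiffOn ℝ (⊤ : ℕ∞) finv (Set.Ioo (-η) η) ∧
      ContDiffOn ℝ (⊤ : ℕ∞) q (Set.Ioo (-η) η) ∧
      (∀ u ∈ Set.Ioo (-η) η, 0 < q u ∧ 0 < deriv finv u ∧ finv u = u * q u ∧ finv u ∈ W) := by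
  have hfa : ContDiffAt ℝ (⊤ : ℕ∞) f 0 := hf.contDiffAt (hV.mem_nhds h0V)
  have hsd : HasStrictDerivAt f (deriv f 0) 0 := hfa.hasStrictDerivAt (by simp)
  set e := (hsd.hasStrictFDerivAt_equiv hf'0.ne').toOpenPartialHomeomorph f with he
  have hef : ∀ x, e x = f x := fun x => rfl
  have h0s : (0:ℝ) ∈ e.source := (hsd.hasStrictFDerivAt_equiv hf'0.ne').mem_toOpenPartialHomeomorph_source
  have h0t : (0:ℝ) ∈ e.target := by
    have := e.map_source h0s
    rwa [hef, hf0] at this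
  have hs0 : e.symm 0 = 0 := by
    have := e.left_inv h0s
    rwa [hef, hf0] at this
  have hca : ContinuousAt e.symm 0 := e.continuousAt_symm h0t
  have hdc : ContinuousOn (deriv f) V := hf.continuousOn_deriv_of_isOpen hV (by simp)
  have hpos : ∀ᶠ x in nhds (0:ℝ), x ∈ V ∧ 0 < deriv f x ∧ x ∈ W ∧ x ∈ e.source := by
    filter_upwards [hV.mem_nhds h0V, (hdc.continuousAt (hV.mem_nhds h0V)).eventually (lt_mem_nhds hf'0),
      hW, e.open_source.mem_nhds h0s] with x h1 h2 h3 h4 using ⟨h1, h2, h3, h4⟩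
  have hev : ∀ᶠ u in nhds (0:ℝ), u ∈ e.target ∧ (e.symm u ∈ V ∧ 0 < deriv f (e.symm u) ∧ e.symm u ∈ W ∧ e.symm u ∈ e.source) := by
    refine Filter.Eventually.and (e.open_target.mem_nhds h0t) ?_
    have hpos' : ∀ᶠ x in nhds (e.symm 0), x ∈ V ∧ 0 < deriv f x ∧ x ∈ W ∧ x ∈ e.source := by
      rwa [hs0]
    exact hca.eventually hpos'
  obtain ⟨r, hr0, hr⟩ := Metric.eventually_nhds_iff_ball.1 hev
  rw [Real.ball_eq_Ioo, zero_sub, zero_add] at hr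
  have hsm : ContDiffOn ℝ (⊤ : ℕ∞) e.symm (Set.Ioo (-r) r) := by
    intro u hu
    obtain ⟨h1, h2, h3, h4, h5⟩ := hr u hu
    have hc := hf.contDiffAt (hV.mem_nhds h2)
    exact (e.contDiffAt_symm_deriv h3.ne' h1 (hc.differentiableAt (by simp)).hasDerivAt hc).contDiffWithinAt
  have hder : ∀ u ∈ Set.Ioo (-r) r, 0 < deriv e.symm u := by
    intro u hu
    obtain ⟨h1, h2, h3, h4, h5⟩ := hr u hu
    have hc := hf.contDiffAt (hV.mem_nhds h2)
    rw [(e.hasDerivAt_symm h1 h3.ne' (hc.differentiableAt (by simp)).hasDerivAt).deriv]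
    positivity
  obtain ⟨q, hq, hq0, hqe⟩ := hadamard r e.symm hsm hs0
  have h0r : (0:ℝ) ∈ Set.Ioo (-r) r := ⟨by linarith, hr0⟩
  have hqev : ∀ᶠ u in nhds (0:ℝ), 0 < q u ∧ u ∈ Set.Ioo (-r) r := by
    refine ((hq.continuousOn.continuousAt (isOpen_Ioo.mem_nhds h0r)).eventually (lt_mem_nhds ?_)).and (isOpen_Ioo.mem_nhds h0r)
    rw [hq0]; exact hder 0 h0r
  obtain ⟨η, hη0, hη⟩ := Metric.eventually_nhds_iff_ball.1 hqev
  rw [Real.ball_eq_Ioo, zero_sub, zero_add] at hη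
  obtain ⟨σ, hσ0, hσ⟩ := Metric.eventually_nhds_iff_ball.1 hpos
  rw [Real.ball_eq_Ioo, zero_sub, zero_add] at hσ
  have hsub : Set.Ioo (-η) η ⊆ Set.Ioo (-r) r := fun u hu => (hη u hu).2
  refine ⟨min δ (σ/2), η, e.symm, q, by positivity, min_le_left _ _, hη0, ?_, ?_, hsm.mono hsub, hq.mono hsub, ?_⟩
  · intro x hx
    have : x ∈ e.source := (hσ x ⟨by linarith [hx.1], by linarith [hx.2.trans (min_le_right _ _)]⟩).2.2.2
    exact e.left_inv this
  · intro u hu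
    exact e.right_inv (hr u (hsub hu)).1
  · intro u hu
    exact ⟨(hη u hu).1, hder u (hsub hu), hqe u (hsub hu), (hr u (hsub hu)).2.2.2.1⟩

lemma log_bd (z : ℝ) : 0 ≤ Real.log (1 + Real.exp z) ∧ Real.log (1 + Real.exp z) ≤ Real.exp z := by
  have := Real.exp_pos z
  refine ⟨Real.log_nonneg (by linarith), ?_⟩
  have := Real.log_le_sub_one_of_pos (show 0 < 1 + Real.exp z by linarith)
  linarith

lemma int_exp (β t : ℝ) (hβ : -1 < β) (ht : 0 < t) :
    IntegrableOn (fun u : ℝ => u ^ β * Real.exp (-(t * u))) (Set.Ioi 0) := by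
  have := integrableOn_rpow_mul_exp_neg_mul_rpow hβ one_pos ht
  simpa using this

lemma int_L (β t y : ℝ) (hβ : -1 < β) (ht : 0 < t) :
    IntegrableOn (fun u : ℝ => u ^ β * Real.log (1 + Real.exp (-y - t * u))) (Set.Ioi 0) := by
  refine ((int_exp β t hβ ht).const_mul (Real.exp (-y))).mono' ?_ ?_
  · apply Measurable.aestronglyMeasurable
    fun_prop
  · refine (ae_restrict_mem measurableSet_Ioi).mono fun u hu => ?_
    have hu' : (0:ℝ) < u := hu
    obtain ⟨h1, h2⟩ := log_bd (-y - t * u)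
    rw [norm_mul, Real.norm_of_nonneg h1, Real.norm_of_nonneg (by positivity)]
    have h3 : Real.exp (-y - t * u) = Real.exp (-y) * Real.exp (-(t * u)) := by
      rw [← Real.exp_add, sub_eq_add_neg]
    rw [h3] at h2 ⊢
    have := Real.rpow_nonneg hu'.le β
    nlinarith

lemma scale (β t y : ℝ) (ht : 0 < t) :
    ∫ u in Set.Ioi (0:ℝ), u ^ β * Real.log (1 + Real.exp (-y - t * u)) =
      (∫ v in Set.Ioi (0:ℝ), v ^ β * Real.log (1 + Real.exp (-y - v))) * t ^ (-(β + 1)) := by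
  have h := integral_comp_mul_left_Ioi (fun v => v ^ β * Real.log (1 + Real.exp (-y - v))) 0 ht
  rw [mul_zero, smul_eq_mul] at h
  have h2 : ∫ u in Set.Ioi (0:ℝ), (t * u) ^ β * Real.log (1 + Real.exp (-y - t * u)) =
      t ^ β * ∫ u in Set.Ioi (0:ℝ), u ^ β * Real.log (1 + Real.exp (-y - t * u)) := by
    rw [← integral_const_mul]
    refine setIntegral_congr_fun measurableSet_Ioi fun u hu => ?_
    rw [Real.mul_rpow ht.le (le_of_lt hu)]; ring
  rw [h2] at h
  have h3 : t ^ (-(β+1)) = (t ^ β)⁻¹ * t⁻¹ := by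
    rw [Real.rpow_neg ht.le, Real.rpow_add ht, Real.rpow_one, mul_inv]
  have h4 : t ^ β ≠ 0 := (Real.rpow_pos_of_pos ht β).ne'
  rw [h3]
  field_simp
  field_simp at h
  linarith

lemma taylor_bd (G : ℝ → ℝ) (η b : ℝ) (hb : 0 < b) (hbη : b < η)
    (hG : ContDiffOn ℝ (⊤ : ℕ∞) G (Set.Ioo (-η) η)) (N : ℕ) :
    ∃ K : ℝ, 0 < K ∧ ∀ u : ℝ, 0 < u → |(Set.Ioo 0 b).indicator G u -
      ∑ k ∈ Finset.range (N + 1), (iteratedDeriv k G 0 / (k.factorial : ℝ)) * u ^ k| ≤ K * u ^ (N+1) := by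
  have hsub : Set.Icc 0 b ⊆ Set.Ioo (-η) η := fun u hu => ⟨by linarith [hu.1], by linarith [hu.2]⟩
  obtain ⟨K0, hK0⟩ := exists_taylor_mean_remainder_bound (n := N) hb.le
    ((hG.mono hsub).of_le (by exact_mod_cast le_top))
  have h0 : (0:ℝ) ∈ Set.Icc 0 b := ⟨le_rfl, hb.le⟩
  have hat : ContDiffAt ℝ (⊤ : ℕ∞) G 0 := hG.contDiffAt (isOpen_Ioo.mem_nhds (hsub h0))
  set c : ℕ → ℝ := fun k => iteratedDeriv k G 0 / (k.factorial : ℝ) with hc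
  have hT : ∀ u, taylorWithinEval G N (Set.Icc 0 b) 0 u = ∑ k ∈ Finset.range (N + 1), c k * u ^ k := by
    intro u
    rw [taylor_within_apply]
    refine Finset.sum_congr rfl fun k _ => ?_
    rw [iteratedDerivWithin_eq_iteratedDeriv (uniqueDiffOn_Icc hb)
      (hat.of_le (by exact_mod_cast le_top)) h0, hc, smul_eq_mul, sub_zero]
    simp only
    ring
  have hS : 0 ≤ ∑ k ∈ Finset.range (N + 1), |c k| / b ^ (N + 1 - k) := Finset.sum_nonneg fun k _ => by positivity
  refine ⟨|K0| + 1 + ∑ k ∈ Finset.range (N + 1), |c k| / b ^ (N + 1 - k), by positivity, fun u hu => ?_⟩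
  have hup : 0 < u ^ (N+1) := by positivity
  by_cases hub : u < b
  · rw [Set.indicator_of_mem (show u ∈ Set.Ioo 0 b from ⟨hu, hub⟩)]
    have h1 := hK0 u ⟨hu.le, hub.le⟩
    rw [hT, Real.norm_eq_abs, sub_zero] at h1
    refine h1.trans ?_
    have := le_abs_self K0
    gcongr
    linarith
  · rw [Set.indicator_of_notMem (fun h => hub h.2), zero_sub, abs_neg]
    push Not at hub
    refine (Finset.abs_sum_le_sum_abs _ _).trans ?_
    have : ∑ k ∈ Finset.range (N + 1), |c k * u ^ k| ≤
        (∑ k ∈ Finset.range (N + 1), |c k| / b ^ (N + 1 - k)) * u ^ (N+1) := by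
      rw [Finset.sum_mul]
      refine Finset.sum_le_sum fun k hk => ?_
      rw [abs_mul, abs_of_pos (pow_pos hu k)]
      have hk' : k ≤ N + 1 := by have := Finset.mem_range.1 hk; omega
      have h1 : u ^ (N+1) = u ^ (N+1-k) * u ^ k := by rw [← pow_add]; congr 1; omega
      have h2 : b ^ (N+1-k) ≤ u ^ (N+1-k) := by gcongr
      rw [h1, div_mul_eq_mul_div, le_div_iff₀ (by positivity)]
      have h3 := mul_le_mul_of_nonneg_left h2 (show 0 ≤ |c k| * u ^ k by positivity)
      linarith
    refine this.trans ?_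
    gcongr
    have := abs_nonneg K0
    linarith

lemma watson (κ : ℝ) (hκ0 : 0 ≤ κ) (hκ1 : κ < 1) (G : ℝ → ℝ) (η b : ℝ) (hb : 0 < b) (hbη : b < η)
    (hG : ContDiffOn ℝ (⊤ : ℕ∞) G (Set.Ioo (-η) η)) (N : ℕ) (M : ℝ)
    (F : ℝ → ℝ → ℝ)
    (hF : ∀ β y, F β y = ∫ v in Set.Ioi (0 : ℝ), v ^ β * Real.log (1 + Real.exp (-y - v))) :
    ∃ C : ℝ, 0 < C ∧ ∀ t : ℝ, 0 < t → ∀ y : ℝ, -M ≤ y →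
        |(∫ u in Set.Ioo 0 b, G u * (u ^ (-κ) * Real.log (1 + Real.exp (-y - t * u)))) -
          ∑ k ∈ Finset.range (N + 1),
            (iteratedDeriv k G 0 / (k.factorial : ℝ)) * F ((k : ℝ) - κ) y *
              t ^ (-((k : ℝ) + 1 - κ))|
          ≤ C * t ^ (-((N : ℝ) + 2 - κ)) := by
  obtain ⟨K, hK, hR⟩ := taylor_bd G η b hb hbη hG N
  have hN0 : (0:ℝ) ≤ N := Nat.cast_nonneg N
  have hΓ : 0 < Real.Gamma (N + 2 - κ) := Real.Gamma_pos_of_pos (by linarith)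
  refine ⟨K * Real.exp M * Real.Gamma (N + 2 - κ), by positivity, fun t ht y hy => ?_⟩
  set L : ℝ → ℝ := fun u => Real.log (1 + Real.exp (-y - t * u)) with hL
  have hk1 : ∀ k : ℕ, -1 < (k:ℝ) - κ := fun k => by
    have : (0:ℝ) ≤ k := Nat.cast_nonneg k
    linarith
  have e1 : ∀ k : ℕ, (iteratedDeriv k G 0 / (k.factorial : ℝ)) * F ((k : ℝ) - κ) y *
              t ^ (-((k : ℝ) + 1 - κ)) = ∫ u in Set.Ioi (0:ℝ),
              (iteratedDeriv k G 0 / (k.factorial : ℝ)) * (u ^ ((k:ℝ) - κ) * L u) := by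
    intro k
    rw [integral_const_mul, hL, scale _ t y ht, hF, mul_assoc]
    congr 3; ring
  have iL : ∀ k : ℕ, IntegrableOn (fun u : ℝ => (iteratedDeriv k G 0 / (k.factorial : ℝ)) * (u ^ ((k:ℝ) - κ) * L u)) (Set.Ioi 0) :=
    fun k => (int_L _ t y (hk1 k) ht).const_mul _
  have iG : IntegrableOn (fun u => G u * (u ^ (-κ) * L u)) (Set.Ioo 0 b) := by
    have h0 : IntegrableOn (fun u : ℝ => u ^ (-κ) * L u) (Set.Icc 0 b) := by
      rw [integrableOn_Icc_iff_integrableOn_Ioc]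
      exact (int_L (-κ) t y (by linarith) ht).mono_set (fun u hu => hu.1)
    refine (h0.continuousOn_mul (g := G) (hG.continuousOn.mono ?_) isCompact_Icc).mono_set Set.Ioo_subset_Icc_self
    exact fun u hu => ⟨by linarith [hu.1], by linarith [hu.2]⟩
  have e2 : ∫ u in Set.Ioo 0 b, G u * (u ^ (-κ) * L u) =
      ∫ u in Set.Ioi (0:ℝ), (Set.Ioo 0 b).indicator (fun u => G u * (u ^ (-κ) * L u)) u := by
    rw [setIntegral_indicator measurableSet_Ioo]
    congr 2
    exact (Set.inter_eq_right.2 fun u hu => hu.1).symm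
  have iG' : IntegrableOn ((Set.Ioo 0 b).indicator (fun u => G u * (u ^ (-κ) * L u))) (Set.Ioi 0) :=
    ((integrable_indicator_iff measurableSet_Ioo).2 iG).integrableOn
  simp_rw [e1]
  rw [e2, ← integral_finsetSum _ (fun k _ => iL k), ← integral_sub iG' (integrable_finsetSum _ (fun k _ => iL k))]
  have hN1 : -1 < (N:ℝ) + 1 - κ := by linarith
  have hbd := norm_integral_le_of_norm_le (μ := volume.restrict (Set.Ioi (0:ℝ)))
    (f := fun u => (Set.Ioo 0 b).indicator (fun u => G u * (u ^ (-κ) * L u)) u -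
      ∑ k ∈ Finset.range (N + 1), (iteratedDeriv k G 0 / (k.factorial : ℝ)) * (u ^ ((k:ℝ) - κ) * L u))
    ((int_exp ((N:ℝ) + 1 - κ) t hN1 ht).const_mul (K * Real.exp M)) ?_
  · rw [Real.norm_eq_abs] at hbd
    refine hbd.trans (le_of_eq ?_)
    rw [integral_const_mul]
    have := Real.integral_rpow_mul_exp_neg_mul_Ioi (a := N + 2 - κ) (r := t) (by linarith) ht
    rw [show (N:ℝ) + 2 - κ - 1 = N + 1 - κ by ring] at this
    rw [this, one_div, Real.inv_rpow ht.le, ← Real.rpow_neg ht.le]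
    ring
  · refine (ae_restrict_mem measurableSet_Ioi).mono fun u hu => ?_
    have hu' : (0:ℝ) < u := hu
    have hfac : (Set.Ioo 0 b).indicator (fun u => G u * (u ^ (-κ) * L u)) u -
      ∑ k ∈ Finset.range (N + 1), (iteratedDeriv k G 0 / (k.factorial : ℝ)) * (u ^ ((k:ℝ) - κ) * L u)
      = ((Set.Ioo 0 b).indicator G u - ∑ k ∈ Finset.range (N + 1), (iteratedDeriv k G 0 / (k.factorial : ℝ)) * u ^ k) * (u ^ (-κ) * L u) := by
      rw [sub_mul, Finset.sum_mul]
      congr 1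
      · by_cases h : u ∈ Set.Ioo 0 b <;> simp [h]
      · refine Finset.sum_congr rfl fun k _ => ?_
        rw [sub_eq_add_neg, Real.rpow_add hu', Real.rpow_natCast]
        ring
    obtain ⟨h1, h2⟩ := log_bd (-y - t * u)
    have h3 : Real.exp (-y - t * u) ≤ Real.exp M * Real.exp (-(t * u)) := by
      rw [← Real.exp_add]; apply Real.exp_le_exp.2; linarith
    have h4 : u ^ ((N:ℝ) + 1 - κ) = u ^ (N+1) * u ^ (-κ) := by
      rw [sub_eq_add_neg, Real.rpow_add hu']
      congr 1
      exact_mod_cast Real.rpow_natCast u (N+1)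
    have h5 : 0 < u ^ (-κ) := Real.rpow_pos_of_pos hu' _
    rw [hfac, norm_mul, Real.norm_eq_abs, Real.norm_of_nonneg (mul_nonneg h5.le h1), h4]
    calc _ ≤ (K * u ^ (N+1)) * (u ^ (-κ) * (Real.exp M * Real.exp (-(t * u)))) := by
            gcongr
            · exact hR u hu'
            · exact h2.trans h3
      _ = _ := by ring

/-- Watson-type lemma with a general phase `f`: the function `ĝ` is well defined
and `C^∞` near `0`, and the Laplace-type integral admits the asymptotic expansion with
coefficients `ĝ^{(k)}(0) F_{k-κ}(y) / k!`. -/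
theorem stmt_6
    (a : ℝ≥0∞) (ha : 0 < a)
    (κ : ℝ) (hκ0 : 0 ≤ κ) (hκ1 : κ < 1)
    (I : Set ℝ) (hI : I = {x : ℝ | 0 < x ∧ ENNReal.ofReal x < a})
    (g : ℝ → ℝ) (hg : IntegrableOn g I)
    (δ : ℝ) (hδ0 : 0 < δ) (hδa : ENNReal.ofReal δ < a)
    (gtil : ℝ → ℝ)
    (hgtil : ∃ U : Set ℝ, IsOpen U ∧ Set.Icc (0 : ℝ) δ ⊆ U ∧ ContDiffOn ℝ (⊤ : ℕ∞) gtil U)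
    (hgg : ∀ x : ℝ, 0 < x → x < δ → g x = gtil x * x ^ (-κ))
    (f : ℝ → ℝ) (hfmeas : Measurable f)
    (hfpos : ∀ x ∈ I, 0 < f x)
    (hfsm : ∃ U : Set ℝ, IsOpen U ∧ Set.Icc (0 : ℝ) δ ⊆ U ∧ ContDiffOn ℝ (⊤ : ℕ∞) f U)
    (hf0 : f 0 = 0) (hf'0 : 0 < deriv f 0)
    (hinf : ∀ δ' : ℝ, 0 < δ' → ENNReal.ofReal δ' < a →
      ∃ c > 0, ∀ x ∈ I, δ' ≤ x → c ≤ f x)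
    (F : ℝ → ℝ → ℝ)
    (hF : ∀ β y, F β y = ∫ v in Set.Ioi (0 : ℝ), v ^ β * Real.log (1 + Real.exp (-y - v)))
    (M : ℝ) (hM : 0 < M) (N : ℕ) (hN : 1 ≤ N) :
    ∃ (ρ ρ₁ : ℝ) (finv ghat : ℝ → ℝ) (U : Set ℝ) (C t0 : ℝ),
      0 < ρ ∧ ρ ≤ δ ∧ 0 < ρ₁ ∧
      (∀ x ∈ Set.Icc (0 : ℝ) ρ, finv (f x) = x) ∧
      (∀ u ∈ Set.Ico (0 : ℝ) ρ₁, f (finv u) = u) ∧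
      IsOpen U ∧ (0 : ℝ) ∈ U ∧ ContDiffOn ℝ (⊤ : ℕ∞) ghat U ∧
      (∀ u ∈ Set.Ioo (0 : ℝ) ρ₁, ghat u = u ^ κ * g (finv u) * deriv finv u) ∧
      0 < C ∧ 0 < t0 ∧
      ∀ t : ℝ, t0 ≤ t → ∀ y : ℝ, -M ≤ y →
        |(∫ x in I, g x * Real.log (1 + Real.exp (-y - t * f x))) -
          ∑ k ∈ Finset.range (N + 1),
            (iteratedDeriv k ghat 0 / (k.factorial : ℝ)) * F ((k : ℝ) - κ) y *
              t ^ (-((k : ℝ) + 1 - κ))|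
          ≤ C * t ^ (-((N : ℝ) + 2 - κ)) := by
  obtain ⟨Ug, hUgo, hUgs, hgs⟩ := hgtil
  obtain ⟨Uf, hUfo, hUfs, hfs⟩ := hfsm
  have h0I : (0:ℝ) ∈ Set.Icc 0 δ := ⟨le_rfl, hδ0.le⟩
  obtain ⟨ρ, η, finv, q, hρ0, hρδ, hη0, hleft, hright, hsm, hqs, hall⟩ :=
    local_inv f Uf hUfo (hUfs h0I) hfs hf0 hf'0 δ hδ0 (Ug ∩ Set.Iio δ)
      (Filter.inter_mem (hUgo.mem_nhds (hUgs h0I)) (Iio_mem_nhds hδ0))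
  set G : ℝ → ℝ := fun u => gtil (finv u) * q u ^ (-κ) * deriv finv u with hG
  have hGs : ContDiffOn ℝ (⊤ : ℕ∞) G (Set.Ioo (-η) η) := by
    refine ((hgs.comp hsm fun u hu => (hall u hu).2.2.2.1).mul
      (hqs.rpow_const_of_ne fun u hu => (hall u hu).1.ne')).mul
      (hsm.deriv_of_isOpen isOpen_Ioo (by simp))
  have hIoo : ∀ u ∈ Set.Ioo 0 η, u ∈ Set.Ioo (-η) η := fun u hu => ⟨by linarith [hu.1], hu.2⟩
  have hpos : ∀ u ∈ Set.Ioo 0 η, 0 < finv u ∧ finv u < δ := by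
    intro u hu
    obtain ⟨h1, h2, h3, h4⟩ := hall u (hIoo u hu)
    exact ⟨by rw [h3]; exact mul_pos hu.1 h1, h4.2⟩
  have hGe : ∀ u ∈ Set.Ioo 0 η, g (finv u) * deriv finv u = G u * u ^ (-κ) := by
    intro u hu
    obtain ⟨h1, h2, h3, h4⟩ := hall u (hIoo u hu)
    have h5 : finv u ^ (-κ) = u ^ (-κ) * q u ^ (-κ) := by
      rw [h3, Real.mul_rpow hu.1.le h1.le]
    rw [hgg _ (hpos u hu).1 (hpos u hu).2, hG, h5]
    ring
  set b := η / 2 with hb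
  have hb0 : 0 < b := by positivity
  have hbη : b < η := by linarith
  obtain ⟨C1, hC1, hw⟩ := watson κ hκ0 hκ1 G η b hb0 hbη hGs N M F hF
  have hbI : ∀ u ∈ Set.Ioo 0 b, u ∈ Set.Ioo 0 η := fun u hu => ⟨hu.1, hu.2.trans hbη⟩
  set A := finv '' Set.Ioo 0 b with hA
  have hinj : Set.InjOn finv (Set.Ioo 0 b) := by
    intro u hu v hv h
    rw [← hright u (hIoo u (hbI u hu)), ← hright v (hIoo v (hbI v hv)), h]
  have hAm : MeasurableSet A := measurableSet_Ioo.image_of_continuousOn_injOn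
    (hsm.continuousOn.mono fun u hu => hIoo u (hbI u hu)) hinj
  have hIm : MeasurableSet I := by
    rw [hI]
    exact (measurableSet_lt measurable_const measurable_id).inter
      (measurableSet_lt ENNReal.measurable_ofReal measurable_const)
  have hAI : A ⊆ I := by
    rintro x ⟨u, hu, rfl⟩
    obtain ⟨h1, h2⟩ := hpos u (hbI u hu)
    rw [hI]
    exact ⟨h1, (ENNReal.ofReal_le_ofReal h2.le).trans_lt hδa⟩
  obtain ⟨c1, hc1, hfar⟩ := hinf ρ hρ0 ((ENNReal.ofReal_le_ofReal hρδ).trans_lt hδa)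
  set c := min c1 b with hc
  have hc0 : 0 < c := lt_min hc1 hb0
  have hcf : ∀ x ∈ I \ A, c ≤ f x := by
    rintro x ⟨hxI, hxA⟩
    by_cases hx : ρ ≤ x
    · exact (min_le_left _ _).trans (hfar x hxI hx)
    · push Not at hx
      have hx0 : 0 < x := by rw [hI] at hxI; exact hxI.1
      by_contra hlt
      push Not at hlt
      exact hxA ⟨f x, ⟨hfpos x hxI, hlt.trans_le (min_le_right _ _)⟩, hleft x ⟨hx0.le, hx.le⟩⟩
  set B := ∫ x in I, ‖g x‖ with hB
  have hB0 : 0 ≤ B := integral_nonneg fun x => norm_nonneg _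
  obtain ⟨t1, ht1⟩ := Filter.eventually_atTop.1
    ((tendsto_rpow_mul_exp_neg_mul_atTop_nhds_zero ((N:ℝ) + 2 - κ) c hc0).eventually (gt_mem_nhds one_pos))
  refine ⟨ρ, η, finv, G, Set.Ioo (-η) η, C1 + Real.exp M * B, max t1 1, hρ0, hρδ, hη0, hleft,
    fun u hu => hright u ⟨by linarith [hu.1], hu.2⟩, isOpen_Ioo, ⟨by linarith, hη0⟩, hGs, ?_,
    by positivity, by positivity, ?_⟩
  · intro u hu
    rw [mul_assoc, hGe u hu, mul_comm (G u), ← mul_assoc, ← Real.rpow_add hu.1]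
    simp
  intro t ht y hy
  have ht0 : 0 < t := by linarith [le_max_right t1 1]
  have hLm : Measurable fun x => Real.log (1 + Real.exp (-y - t * f x)) := by fun_prop
  have hLb : ∀ c', ∀ x, c' ≤ f x → ‖Real.log (1 + Real.exp (-y - t * f x))‖ ≤
      Real.exp M * Real.exp (-c' * t) := by
    intro c' x hx
    obtain ⟨h1, h2⟩ := log_bd (-y - t * f x)
    rw [Real.norm_of_nonneg h1]
    refine h2.trans ?_
    rw [← Real.exp_add]
    apply Real.exp_le_exp.2
    nlinarith
  have hint : IntegrableOn (fun x => g x * Real.log (1 + Real.exp (-y - t * f x))) I := by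
    refine Integrable.mul_bdd (c := Real.exp M * Real.exp (-0 * t)) hg hLm.aestronglyMeasurable ?_
    exact (ae_restrict_mem hIm).mono fun x hx => hLb 0 x (hfpos x hx).le
  rw [← integral_inter_add_sdiff hAm hint, Set.inter_eq_right.2 hAI]
  have hnear : ∫ x in A, g x * Real.log (1 + Real.exp (-y - t * f x)) =
      ∫ u in Set.Ioo 0 b, G u * (u ^ (-κ) * Real.log (1 + Real.exp (-y - t * u))) := by
    rw [hA, integral_image_eq_integral_abs_deriv_smul (f' := deriv finv) measurableSet_Ioo ?_ hinj]
    · refine setIntegral_congr_fun measurableSet_Ioo fun u hu => ?_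
      have hu' := hIoo u (hbI u hu)
      simp only [smul_eq_mul]
      rw [abs_of_pos (hall u hu').2.1, hright u hu', ← mul_assoc, ← mul_assoc, ← hGe u (hbI u hu)]
      ring
    · intro u hu
      exact ((hsm.contDiffAt (isOpen_Ioo.mem_nhds (hIoo u (hbI u hu)))).differentiableAt
        (by simp)).hasDerivAt.hasDerivWithinAt
  have hfarb : |∫ x in I \ A, g x * Real.log (1 + Real.exp (-y - t * f x))| ≤
      Real.exp M * B * t ^ (-((N:ℝ) + 2 - κ)) := by
    have hgn : IntegrableOn (fun x => ‖g x‖) (I \ A) := Integrable.norm (hg.mono_set Set.sdiff_subset)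
    have h1 := norm_integral_le_of_norm_le (μ := volume.restrict (I \ A))
      (f := fun x => g x * Real.log (1 + Real.exp (-y - t * f x)))
      (hgn.mul_const (Real.exp M * Real.exp (-c * t)))
      ((ae_restrict_mem (hIm.diff hAm)).mono fun x hx => by
        rw [norm_mul]
        exact mul_le_mul_of_nonneg_left (hLb c x (hcf x hx)) (norm_nonneg _))
    rw [Real.norm_eq_abs, integral_mul_const] at h1
    have h2 : ∫ x in I \ A, ‖g x‖ ≤ B :=
      setIntegral_mono_set hg.norm (Filter.Eventually.of_forall fun x => norm_nonneg _)
        (Filter.Eventually.of_forall Set.sdiff_subset)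
    have h3 : Real.exp (-c * t) ≤ t ^ (-((N:ℝ) + 2 - κ)) := by
      have := ht1 t ((le_max_left _ _).trans ht)
      have hp := Real.rpow_pos_of_pos ht0 ((N:ℝ) + 2 - κ)
      rw [Real.rpow_neg ht0.le, ← one_div, le_div_iff₀ hp]
      linarith
    calc _ ≤ _ := h1
      _ ≤ B * (Real.exp M * t ^ (-((N:ℝ) + 2 - κ))) := by gcongr
      _ = _ := by ring
  rw [hnear]
  have h1 := hw t ht0 y hy
  rw [abs_le] at h1 hfarb ⊢
  constructor <;> nlinarith [h1.1, h1.2, hfarb.1, hfarb.2]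
end

section
/- Let M > 0, α ∈ [0,1) and an integer N ≥ 1 be fixed. Then there exist constants C > 0 and t_0 > 0 such that for all t ≥ t_0 and all y with −M t^α ≤ y ≤ −1/M, | ∫_0^a g(x) log(1 + e^{−y − t f(x)}) dx − Σ_{k=0}^N (ĝ^{(k)}(0)/k!) · φ_{k−κ}(y) · t^{−(k+1−κ)} | ≤ C · t^{−(N+2−κ)} · |y|^{N+3−κ}. -/
open MeasureTheory
open scoped ENNReal

namespace LapAux
open Set Filter Topology

lemma hadamard_deriv (r : ℝ) (F : ℝ → ℝ)
    (hF : ContDiffOn ℝ (⊤ : ℕ∞) F (Ioo (-r) r)) (n : ℕ) (x : ℝ) (hx : x ∈ Ioo (-r) r) :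
    HasDerivAt (fun x => ∫ s in (0:ℝ)..1, s ^ n * F (s * x))
      (∫ s in (0:ℝ)..1, s ^ (n+1) * deriv F (s * x)) x := by
  obtain ⟨q, hq1, hq2⟩ : ∃ q, |x| < q ∧ q < r := exists_between (abs_lt.2 hx)
  have hq0 : 0 ≤ q := (abs_nonneg x).trans hq1.le
  have hsub : Icc (-q) q ⊆ Ioo (-r) r := fun z hz => ⟨by linarith [hz.1], by linarith [hz.2]⟩
  have hdF : ContDiffOn ℝ (⊤ : ℕ∞) (deriv F) (Ioo (-r) r) :=
    ((contDiffOn_infty_iff_deriv_of_isOpen isOpen_Ioo).1 hF).2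
  have hcF : ContinuousOn F (Icc (-q) q) := hF.continuousOn.mono hsub
  have hcdF : ContinuousOn (deriv F) (Icc (-q) q) := hdF.continuousOn.mono hsub
  obtain ⟨B, hB⟩ := isCompact_Icc.exists_bound_of_continuousOn hcdF
  have hmem : ∀ z ∈ Ioo (-q) q, ∀ s ∈ Icc (0:ℝ) 1, s * z ∈ Icc (-q) q := by
    intro z hz s hs
    refine abs_le.1 ?_
    rw [abs_mul, abs_of_nonneg hs.1]
    have : |z| ≤ q := (abs_lt.2 hz).le
    nlinarith [hs.1, hs.2, abs_nonneg z]
  have hcont : ∀ (G : ℝ → ℝ) (k : ℕ), ContinuousOn G (Icc (-q) q) → ∀ z ∈ Ioo (-q) q,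
      ContinuousOn (fun s => s ^ k * G (s * z)) (Icc 0 1) := by
    intro G k hG z hz
    exact (by fun_prop : ContinuousOn (fun s : ℝ => s ^ k) (Icc 0 1)).mul
      (hG.comp (by fun_prop) (fun s hs => hmem z hz s hs))
  have hxq : x ∈ Ioo (-q) q := abs_lt.1 hq1
  have hii : ∀ (G : ℝ → ℝ) (k : ℕ), ContinuousOn G (Icc (-q) q) → ∀ z ∈ Ioo (-q) q,
      IntervalIntegrable (fun s => s ^ k * G (s * z)) volume 0 1 := by
    intro G k hG z hz
    apply ContinuousOn.intervalIntegrable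
    rw [uIcc_of_le zero_le_one]
    exact hcont G k hG z hz
  have h := intervalIntegral.hasDerivAt_integral_of_dominated_loc_of_deriv_le
    (μ := volume) (a := 0) (b := 1) (F := fun x s => s ^ n * F (s * x))
    (F' := fun x s => s ^ (n+1) * deriv F (s * x)) (x₀ := x) (s := Ioo (-q) q)
    (bound := fun _ => B) (Ioo_mem_nhds hxq.1 hxq.2) ?_ (hii F n hcF x hxq) ?_ ?_ (by simp) ?_
  · exact h.2
  · filter_upwards [Ioo_mem_nhds hxq.1 hxq.2] with z hz
    have := (hii F n hcF z hz).aestronglyMeasurable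
    rwa [uIoc_of_le zero_le_one]
  · have := (hii (deriv F) (n+1) hcdF x hxq).aestronglyMeasurable
    rwa [uIoc_of_le zero_le_one]
  · refine Eventually.of_forall fun s hs z hz => ?_
    rw [uIoc_of_le zero_le_one] at hs
    have h1 := hB _ (hmem z hz s ⟨hs.1.le, hs.2⟩)
    rw [norm_mul, norm_pow, Real.norm_of_nonneg hs.1.le]
    have h2 : s ^ (n+1) ≤ 1 := pow_le_one₀ hs.1.le hs.2
    have h3 : 0 ≤ s ^ (n+1) := pow_nonneg hs.1.le _
    nlinarith [norm_nonneg (deriv F (s * z))]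
  · refine Eventually.of_forall fun s hs z hz => ?_
    rw [uIoc_of_le zero_le_one] at hs
    have h1 : DifferentiableAt ℝ F (s * z) :=
      ((hF.differentiableOn (by simp)).differentiableAt
        (isOpen_Ioo.mem_nhds (hsub (hmem z hz s ⟨hs.1.le, hs.2⟩))))
    have h2 : HasDerivAt (fun z => F (s * z)) (deriv F (s * z) * s) z := by
      refine h1.hasDerivAt.comp z ?_
      simpa using (hasDerivAt_id z).const_mul s
    refine (h2.const_mul (s ^ n)).congr_deriv ?_
    ring

lemma hadamard_contDiff_nat (r : ℝ) (m : ℕ) : ∀ (F : ℝ → ℝ)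
    (_ : ContDiffOn ℝ (⊤ : ℕ∞) F (Ioo (-r) r)) (n : ℕ),
    ContDiffOn ℝ m (fun x => ∫ s in (0:ℝ)..1, s ^ n * F (s * x)) (Ioo (-r) r) := by
  induction m with
  | zero =>
    intro F hF n
    simp only [Nat.cast_zero, contDiffOn_zero]
    exact fun x hx => (hadamard_deriv r F hF n x hx).continuousAt.continuousWithinAt
  | succ m ih =>
    intro F hF n
    have hdF : ContDiffOn ℝ (⊤ : ℕ∞) (deriv F) (Ioo (-r) r) :=
      ((contDiffOn_infty_iff_deriv_of_isOpen isOpen_Ioo).1 hF).2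
    push_cast
    rw [contDiffOn_succ_iff_deriv_of_isOpen isOpen_Ioo]
    refine ⟨fun x hx => (hadamard_deriv r F hF n x hx).differentiableAt.differentiableWithinAt,
      by simp, ?_⟩
    exact (ih (deriv F) hdF (n+1)).congr fun x hx => (hadamard_deriv r F hF n x hx).deriv

lemma hadamard (r : ℝ) (f : ℝ → ℝ) (hf : ContDiffOn ℝ (⊤ : ℕ∞) f (Ioo (-r) r))
    (hf0 : f 0 = 0) (hpos : ∀ x ∈ Ioo (-r) r, 0 < deriv f x) :
    ∃ h : ℝ → ℝ, ContDiffOn ℝ (⊤ : ℕ∞) h (Ioo (-r) r) ∧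
      ∀ x ∈ Ioo (-r) r, 0 < h x ∧ f x = h x * x := by
  have hdF : ContDiffOn ℝ (⊤ : ℕ∞) (deriv f) (Ioo (-r) r) :=
    ((contDiffOn_infty_iff_deriv_of_isOpen isOpen_Ioo).1 hf).2
  refine ⟨fun x => ∫ s in (0:ℝ)..1, s ^ 0 * deriv f (s * x), ?_, ?_⟩
  · rw [contDiffOn_infty]
    exact fun m => hadamard_contDiff_nat r m _ hdF 0
  · intro x hx
    have hmem : ∀ s ∈ Icc (0:ℝ) 1, s * x ∈ Ioo (-r) r := by
      intro s hs
      have hx' := abs_lt.2 hx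
      refine abs_lt.1 ?_
      rw [abs_mul, abs_of_nonneg hs.1]
      nlinarith [hs.1, hs.2, abs_nonneg x]
    have hcont : ContinuousOn (fun s => deriv f (s * x)) (Icc 0 1) :=
      hdF.continuousOn.comp (by fun_prop) hmem
    have hint : IntervalIntegrable (fun s => deriv f (s * x)) volume 0 1 := by
      apply ContinuousOn.intervalIntegrable
      rwa [uIcc_of_le zero_le_one]
    simp only [pow_zero, one_mul]
    constructor
    · exact intervalIntegral.intervalIntegral_pos_of_pos_on hint
        (fun s hs => hpos _ (hmem s ⟨hs.1.le, hs.2.le⟩)) zero_lt_one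
    · have := intervalIntegral.integral_eq_sub_of_hasDerivAt (a := 0) (b := 1)
        (f := fun s => f (s * x)) (f' := fun s => deriv f (s * x) * x) ?_ (hint.mul_const x)
      · simp only [intervalIntegral.integral_mul_const, one_mul, zero_mul, hf0, sub_zero] at this
        exact this.symm
      · intro s hs
        rw [uIcc_of_le zero_le_one] at hs
        have h1 : DifferentiableAt ℝ f (s * x) :=
          (hf.differentiableOn (by simp)).differentiableAt (isOpen_Ioo.mem_nhds (hmem s hs))
        refine h1.hasDerivAt.comp s ?_
        simpa using (hasDerivAt_id s).mul_const x

lemma construct (κ : ℝ) (g gtil f : ℝ → ℝ) (δ : ℝ) (hδ0 : 0 < δ)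
    (hgtil : ∃ U : Set ℝ, IsOpen U ∧ Set.Icc (0 : ℝ) δ ⊆ U ∧ ContDiffOn ℝ (⊤ : ℕ∞) gtil U)
    (hgg : ∀ x : ℝ, 0 < x → x < δ → g x = gtil x * x ^ (-κ))
    (hfsm : ∃ U : Set ℝ, IsOpen U ∧ Set.Icc (0 : ℝ) δ ⊆ U ∧ ContDiffOn ℝ (⊤ : ℕ∞) f U)
    (hf0 : f 0 = 0) (hf'0 : 0 < deriv f 0) :
    ∃ (ρ b : ℝ) (finv ghat : ℝ → ℝ) (U : Set ℝ), 0 < ρ ∧ ρ < δ ∧ 0 < b ∧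
      (∀ x ∈ Set.Icc (0 : ℝ) ρ, finv (f x) = x) ∧
      (∀ u ∈ Set.Icc (0 : ℝ) b, f (finv u) = u) ∧
      IsOpen U ∧ Icc 0 b ⊆ U ∧ ContDiffOn ℝ (⊤ : ℕ∞) ghat U ∧
      (∀ u ∈ Set.Ioo (0 : ℝ) b, ghat u = u ^ κ * g (finv u) * deriv finv u) ∧
      finv '' Ioo 0 b = Ioo 0 ρ ∧
      (∀ u ∈ Ioo 0 b, HasDerivAt finv (deriv finv u) u ∧ 0 < deriv finv u) := by
  obtain ⟨Ug, hUg, hUgs, hgc⟩ := hgtil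
  obtain ⟨Uf, hUf, hUfs, hfc⟩ := hfsm
  have h0g : (0:ℝ) ∈ Ug := hUgs ⟨le_rfl, hδ0.le⟩
  have h0f : (0:ℝ) ∈ Uf := hUfs ⟨le_rfl, hδ0.le⟩
  have hfa : ContDiffAt ℝ (⊤ : ℕ∞) f 0 := hfc.contDiffAt (hUf.mem_nhds h0f)
  have hfd : HasDerivAt f (deriv f 0) 0 := (hfa.differentiableAt (by simp)).hasDerivAt
  have hfd' : HasFDerivAt f ((ContinuousLinearEquiv.unitsEquivAut ℝ (Units.mk0 _ hf'0.ne') : ℝ ≃L[ℝ] ℝ) : ℝ →L[ℝ] ℝ) 0 := by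
    exact hfd.hasFDerivAt_equiv hf'0.ne'
  set e := ContDiffAt.toOpenPartialHomeomorph f hfa hfd' (by simp) with he
  have hecoe : (e : ℝ → ℝ) = f := ContDiffAt.toOpenPartialHomeomorph_coe hfa hfd' (by simp)
  have h0e : (0:ℝ) ∈ e.source := ContDiffAt.mem_toOpenPartialHomeomorph_source hfa hfd' (by simp)
  have hdc : ContinuousAt (deriv f) 0 :=
    (((contDiffOn_infty_iff_deriv_of_isOpen hUf).1 hfc).2.continuousOn).continuousAt
      (hUf.mem_nhds h0f)
  have hev : ∀ᶠ x in 𝓝 (0:ℝ), x ∈ Ug ∧ x ∈ Uf ∧ x ∈ e.source ∧ 0 < deriv f x := by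
    filter_upwards [hUg.mem_nhds h0g, hUf.mem_nhds h0f, e.open_source.mem_nhds h0e,
      hdc.eventually (lt_mem_nhds hf'0)] with x h1 h2 h3 h4
    exact ⟨h1, h2, h3, h4⟩
  obtain ⟨r, hr, hrb⟩ := Metric.eventually_nhds_iff_ball.1 hev
  rw [Real.ball_eq_Ioo, zero_sub, zero_add] at hrb
  set J := Ioo (-r) r with hJ
  have hfJ : ContDiffOn ℝ (⊤ : ℕ∞) f J := hfc.mono fun x hx => (hrb x hx).2.1
  have hgJ : ContDiffOn ℝ (⊤ : ℕ∞) gtil J := hgc.mono fun x hx => (hrb x hx).1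
  obtain ⟨h, hhc, hh⟩ := hadamard r f hfJ hf0 (fun x hx => (hrb x hx).2.2.2)
  set finv : ℝ → ℝ := (e.symm : ℝ → ℝ) with hfinv
  have hleft : ∀ x ∈ J, finv (f x) = x := by
    intro x hx
    have := e.left_inv (hrb x hx).2.2.1
    rwa [hecoe] at this
  set V := e.target ∩ e.symm ⁻¹' J with hV
  have hVo : IsOpen V := e.isOpen_inter_preimage_symm isOpen_Ioo
  have hJV : ∀ x ∈ J, f x ∈ V := by
    intro x hx
    refine ⟨?_, ?_⟩
    · have := e.map_source (hrb x hx).2.2.1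
      rwa [hecoe] at this
    · show finv (f x) ∈ J
      rw [hleft x hx]; exact hx
  have hder : ∀ u ∈ V, HasDerivAt e (deriv f (finv u)) (e.symm u) := by
    intro u hu
    rw [hecoe]
    exact ((hfJ.differentiableOn (by simp)).differentiableAt (isOpen_Ioo.mem_nhds hu.2)).hasDerivAt
  have hdpos : ∀ u ∈ V, 0 < deriv f (finv u) := fun u hu => (hrb _ hu.2).2.2.2
  have hfinvc : ContDiffOn ℝ (⊤ : ℕ∞) finv V := by
    intro u hu
    refine ContDiffAt.contDiffWithinAt ?_
    refine e.contDiffAt_symm_deriv (hdpos u hu).ne' hu.1 (hder u hu) ?_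
    rw [hecoe]
    exact hfJ.contDiffAt (isOpen_Ioo.mem_nhds hu.2)
  have hfinvd : ∀ u ∈ V, HasDerivAt finv (deriv f (finv u))⁻¹ u := fun u hu =>
    e.hasDerivAt_symm hu.1 (hdpos u hu).ne' (hder u hu)
  have hdfinv : ContDiffOn ℝ (⊤ : ℕ∞) (deriv finv) V :=
    ((contDiffOn_infty_iff_deriv_of_isOpen hVo).1 hfinvc).2
  have hmaps : MapsTo finv V J := fun u hu => hu.2
  set ρ := min r δ / 2 with hρ
  have hmin : 0 < min r δ := lt_min hr hδ0
  have hρ0 : 0 < ρ := by positivity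
  have hρr : ρ < r := by have := min_le_left r δ; linarith
  have hρδ : ρ < δ := by have := min_le_right r δ; linarith
  have hIJ : Icc 0 ρ ⊆ J := fun x hx => ⟨by linarith [hx.1], by linarith [hx.2]⟩
  have hmono : StrictMonoOn f J := by
    apply strictMonoOn_of_deriv_pos (convex_Ioo _ _) hfJ.continuousOn
    rw [interior_Ioo]
    exact fun x hx => (hrb x hx).2.2.2
  have h0J : (0:ℝ) ∈ J := hIJ ⟨le_rfl, hρ0.le⟩
  have hρJ : ρ ∈ J := hIJ ⟨hρ0.le, le_rfl⟩
  have hb : 0 < f ρ := by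
    have := hmono h0J hρJ hρ0
    rwa [hf0] at this
  have himg : ∀ u ∈ Icc 0 (f ρ), ∃ x ∈ Icc 0 ρ, f x = u := by
    intro u hu
    have := intermediate_value_Icc hρ0.le (hfJ.continuousOn.mono hIJ)
    rw [hf0] at this
    exact this hu
  have himg' : ∀ u ∈ Ioo 0 (f ρ), ∃ x ∈ Ioo 0 ρ, f x = u := by
    intro u hu
    obtain ⟨x, hx, hxu⟩ := himg u ⟨hu.1.le, hu.2.le⟩
    refine ⟨x, ⟨lt_of_le_of_ne hx.1 ?_, lt_of_le_of_ne hx.2 ?_⟩, hxu⟩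
    · rintro rfl
      rw [hf0] at hxu; linarith [hu.1]
    · rintro h; rw [h] at hxu; linarith [hu.2]
  have hIV : Icc 0 (f ρ) ⊆ V := by
    intro u hu
    obtain ⟨x, hx, rfl⟩ := himg u hu
    exact hJV x (hIJ hx)
  refine ⟨ρ, f ρ, finv, fun u => gtil (finv u) * h (finv u) ^ κ * deriv finv u, V, hρ0, hρδ, hb,
    fun x hx => hleft x (hIJ hx), ?_, hVo, hIV, ?_, ?_, ?_, ?_⟩
  · intro u hu
    obtain ⟨x, hx, rfl⟩ := himg u hu
    rw [hleft x (hIJ hx)]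
  · refine ((hgJ.comp hfinvc hmaps).mul ?_).mul hdfinv
    exact (hhc.comp hfinvc hmaps).rpow_const_of_ne fun u hu => (hh _ (hmaps hu)).1.ne'
  · intro u hu
    obtain ⟨x, hx, rfl⟩ := himg' u hu
    have hxJ := hIJ ⟨hx.1.le, hx.2.le⟩
    dsimp only
    rw [hleft x hxJ, hgg x hx.1 (hx.2.trans hρδ)]
    congr 1
    rw [(hh x hxJ).2]
    rw [Real.mul_rpow (hh x hxJ).1.le hx.1.le, Real.rpow_neg hx.1.le]
    have := (Real.rpow_pos_of_pos hx.1 κ).ne'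
    field_simp
  · ext x
    constructor
    · rintro ⟨u, hu, rfl⟩
      obtain ⟨x, hx, rfl⟩ := himg' u hu
      rw [hleft x (hIJ ⟨hx.1.le, hx.2.le⟩)]; exact hx
    · intro hx
      have hxJ := hIJ ⟨hx.1.le, hx.2.le⟩
      refine ⟨f x, ⟨?_, hmono hxJ hρJ hx.2⟩, hleft x hxJ⟩
      have := hmono h0J hxJ hx.1
      rwa [hf0] at this
  · intro u hu
    have huV := hIV ⟨hu.1.le, hu.2.le⟩
    have := hfinvd u huV
    rw [this.deriv]
    exact ⟨this, inv_pos.2 (hdpos u huV)⟩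

/-- softplus -/
noncomputable def sp (s : ℝ) : ℝ := Real.log (1 + Real.exp s)

lemma sp_nonneg (s : ℝ) : 0 ≤ sp s := Real.log_nonneg (by linarith [Real.exp_pos s])

lemma sp_le_exp (s : ℝ) : sp s ≤ Real.exp s := by
  have := Real.log_le_sub_one_of_pos (x := 1 + Real.exp s) (by positivity)
  unfold sp; linarith

lemma sp_eq (s : ℝ) : sp s = s + sp (-s) := by
  unfold sp
  have h : 1 + Real.exp s = Real.exp s * (1 + Real.exp (-s)) := by
    rw [mul_add, ← Real.exp_add]; simp [add_comm]
  rw [h, Real.log_mul (Real.exp_pos s).ne' (by positivity), Real.log_exp]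

lemma sp_cont : Continuous sp := by
  unfold sp
  exact (by fun_prop : Continuous fun s => 1 + Real.exp s).log (fun s => by positivity)

lemma sp_scale (r c : ℝ) (hr : 1 ≤ r) : sp (r * c) ≤ r * sp c := by
  unfold sp
  rw [← Real.log_rpow (by positivity)]
  apply Real.log_le_log (by positivity)
  have := Real.add_rpow_le_rpow_add (p := r) zero_le_one (Real.exp_pos c).le hr
  rwa [Real.one_rpow, ← Real.exp_mul, mul_comm] at this

lemma int_exp (β t : ℝ) (hβ : -1 < β) (ht : 0 < t) :
    IntegrableOn (fun u : ℝ => u ^ β * Real.exp (-t * u)) (Ioi 0) := by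
  simpa using integrableOn_rpow_mul_exp_neg_mul_rpow (p := 1) hβ one_pos ht

lemma meas_sp (β t Y : ℝ) : Measurable (fun u : ℝ => u ^ β * sp (Y - t * u)) :=
  (measurable_id.pow_const β).mul (sp_cont.comp (by fun_prop)).measurable

lemma int_sp (β t Y : ℝ) (hβ : -1 < β) (ht : 0 < t) :
    IntegrableOn (fun u : ℝ => u ^ β * sp (Y - t * u)) (Ioi 0) := by
  refine Integrable.mono' ((int_exp β t hβ ht).const_mul (Real.exp Y))
    (meas_sp β t Y).aestronglyMeasurable ?_
  refine (ae_restrict_mem measurableSet_Ioi).mono fun u hu => ?_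
  have hu' : 0 ≤ u ^ β := Real.rpow_nonneg (le_of_lt hu) β
  rw [Real.norm_of_nonneg (mul_nonneg hu' (sp_nonneg _))]
  calc u ^ β * sp (Y - t * u) ≤ u ^ β * Real.exp (Y - t * u) := by
        gcongr; exact sp_le_exp _
    _ = _ := by rw [sub_eq_add_neg, Real.exp_add, neg_mul]; ring

lemma trans_integral (F : ℝ → ℝ) (c : ℝ) :
    ∫ x in Ioi c, F x = ∫ x in Ioi 0, F (x + c) := by
  have := (measurePreserving_add_right volume c).setIntegral_preimage_emb
    (measurableEmbedding_addRight c) F (Ioi c)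
  simpa using this.symm

lemma trans_int (F : ℝ → ℝ) (c : ℝ) :
    IntegrableOn (fun x => F (x + c)) (Ioi 0) ↔ IntegrableOn F (Ioi c) := by
  have := (measurePreserving_add_right volume c).integrableOn_comp_preimage
    (measurableEmbedding_addRight c) (f := F) (s := Ioi c)
  simpa [Function.comp_def] using this

lemma phi_eq (β Y : ℝ) (hβ : -1 < β) (hY : 0 < Y) :
    Y ^ (β + 2) / ((β + 1) * (β + 2)) +
      (∫ u in Set.Ioi (0 : ℝ), (|-Y - u| ^ β + |-Y + u| ^ β) * sp (-u)) -
      (∫ u in Set.Ioi Y, |-Y + u| ^ β * sp (-u)) =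
    ∫ u in Ioi 0, u ^ β * sp (Y - u) := by
  have hI : IntegrableOn (fun u : ℝ => u ^ β * sp (Y - u)) (Ioi 0) := by
    simpa using int_sp β 1 Y hβ one_pos
  have hI1 : IntegrableOn (fun u : ℝ => u ^ β * sp (Y - u)) (Ioc 0 Y) :=
    hI.mono_set Ioc_subset_Ioi_self
  have hI2 : IntegrableOn (fun u : ℝ => u ^ β * sp (Y - u)) (Ioi Y) :=
    hI.mono_set (Ioi_subset_Ioi hY.le)
  have hA : IntegrableOn (fun u : ℝ => |-Y - u| ^ β * sp (-u)) (Ioi 0) := by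
    refine ((trans_int _ Y).2 hI2).congr_fun (fun u hu => ?_) measurableSet_Ioi
    have hu : 0 < u := hu
    have : |-Y - u| = u + Y := by rw [abs_of_neg (by linarith)]; ring
    simp only [this]; congr 2; ring
  have hAe : ∫ u in Ioi 0, |-Y - u| ^ β * sp (-u) = ∫ u in Ioi Y, u ^ β * sp (Y - u) := by
    rw [trans_integral _ Y]
    refine setIntegral_congr_fun measurableSet_Ioi (fun u hu => ?_)
    have hu : 0 < u := hu
    have : |-Y - u| = u + Y := by rw [abs_of_neg (by linarith)]; ring
    simp only [this]; congr 2; ring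
  have hB2 : IntegrableOn (fun u : ℝ => |-Y + u| ^ β * sp (-u)) (Ioi Y) := by
    rw [← trans_int]
    refine (int_sp β 1 (-Y) hβ one_pos).congr_fun (fun u hu => ?_) measurableSet_Ioi
    have hu : 0 < u := hu
    have : |-Y + (u + Y)| = u := by rw [abs_of_pos (by linarith)]; ring
    simp only [this]; congr 2; ring
  have hR : IntervalIntegrable (fun u : ℝ => u ^ β) volume 0 Y :=
    intervalIntegral.intervalIntegrable_rpow' hβ
  have hC : IntervalIntegrable (fun u : ℝ => u ^ β * sp (u - Y)) volume 0 Y :=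
    hR.mul_continuousOn (sp_cont.comp (by fun_prop)).continuousOn
  have hLin : IntervalIntegrable (fun u : ℝ => u ^ β * (Y - u)) volume 0 Y :=
    hR.mul_continuousOn (by fun_prop)
  have hB1' : IntervalIntegrable (fun v : ℝ => (Y - v) ^ β * sp (-v)) volume 0 Y := by
    have := (hC.comp_sub_left Y).symm
    simpa using this
  have hcong : ∀ v ∈ Ioc 0 Y, (Y - v) ^ β * sp (-v) = |-Y + v| ^ β * sp (-v) := by
    intro v hv
    rw [abs_of_nonpos (by linarith [hv.2])]; congr 2; ring
  have hB1 : IntegrableOn (fun u : ℝ => |-Y + u| ^ β * sp (-u)) (Ioc 0 Y) := by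
    refine ((intervalIntegrable_iff_integrableOn_Ioc_of_le hY.le).1 hB1').congr_fun
      hcong measurableSet_Ioc
  have hBe : ∫ u in Ioc 0 Y, |-Y + u| ^ β * sp (-u) = ∫ u in (0:ℝ)..Y, u ^ β * sp (u - Y) := by
    rw [← setIntegral_congr_fun measurableSet_Ioc hcong,
      ← intervalIntegral.integral_of_le hY.le]
    have := intervalIntegral.integral_comp_sub_left (a := 0) (b := Y)
      (fun u : ℝ => u ^ β * sp (u - Y)) Y
    simpa using this
  have hB : IntegrableOn (fun u : ℝ => |-Y + u| ^ β * sp (-u)) (Ioi 0) := by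
    rw [← Ioc_union_Ioi_eq_Ioi hY.le]; exact hB1.union hB2
  have hlin : ∫ u in (0:ℝ)..Y, u ^ β * (Y - u) = Y ^ (β + 2) / ((β + 1) * (β + 2)) := by
    have hR1 : IntervalIntegrable (fun u : ℝ => u ^ (β+1)) volume 0 Y :=
      intervalIntegral.intervalIntegrable_rpow' (by linarith)
    have h1 : ∫ u in (0:ℝ)..Y, u ^ β * (Y - u) = ∫ u in (0:ℝ)..Y, (u ^ β * Y - u ^ (β+1)) := by
      rw [intervalIntegral.integral_of_le hY.le, intervalIntegral.integral_of_le hY.le]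
      refine setIntegral_congr_fun measurableSet_Ioc (fun u hu => ?_)
      simp only [Real.rpow_add_one hu.1.ne']; ring
    rw [h1, intervalIntegral.integral_sub (hR.mul_const Y) hR1,
      intervalIntegral.integral_mul_const, integral_rpow (Or.inl hβ),
      integral_rpow (Or.inl (by linarith)), Real.zero_rpow (by linarith),
      Real.zero_rpow (by linarith), show β + 1 + 1 = β + 2 by ring,
      show β + 2 = (β + 1) + 1 by ring, Real.rpow_add_one hY.ne' (β+1)]
    have : β + 1 ≠ 0 := by linarith
    have : β + 1 + 1 ≠ 0 := by linarith
    field_simp; ring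
  have hsum : ∫ u in Set.Ioi (0 : ℝ), (|-Y - u| ^ β + |-Y + u| ^ β) * sp (-u) =
      (∫ u in Ioi Y, u ^ β * sp (Y - u)) + ((∫ u in (0:ℝ)..Y, u ^ β * sp (u - Y)) +
        ∫ u in Ioi Y, |-Y + u| ^ β * sp (-u)) := by
    rw [← hAe, ← hBe, ← setIntegral_union Ioc_disjoint_Ioi_same measurableSet_Ioi hB1 hB2,
      Ioc_union_Ioi_eq_Ioi hY.le, ← integral_add hA hB]
    simp only [add_mul]
  have hsplit : ∫ u in Ioi 0, u ^ β * sp (Y - u) =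
      (∫ u in (0:ℝ)..Y, u ^ β * (Y - u)) + (∫ u in (0:ℝ)..Y, u ^ β * sp (u - Y)) +
        ∫ u in Ioi Y, u ^ β * sp (Y - u) := by
    rw [← Ioc_union_Ioi_eq_Ioi hY.le, setIntegral_union Ioc_disjoint_Ioi_same measurableSet_Ioi
      hI1 hI2, ← intervalIntegral.integral_add hLin hC, ← intervalIntegral.integral_of_le hY.le]
    congr 1
    refine intervalIntegral.integral_congr fun u _ => ?_
    rw [sp_eq (Y - u), neg_sub]; ring
  rw [hsum, hsplit, hlin]; ring

lemma scale (β t Y : ℝ) (ht : 0 < t) :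
    ∫ u in Ioi 0, u ^ β * sp (Y - t * u) = t ^ (-(β + 1)) * ∫ u in Ioi 0, u ^ β * sp (Y - u) := by
  have h := integral_comp_mul_left_Ioi (fun u : ℝ => u ^ β * sp (Y - u)) 0 ht
  rw [mul_zero, smul_eq_mul] at h
  have h2 : ∫ u in Ioi 0, (t * u) ^ β * sp (Y - t * u) =
      t ^ β * ∫ u in Ioi 0, u ^ β * sp (Y - t * u) := by
    rw [← integral_const_mul]
    refine setIntegral_congr_fun measurableSet_Ioi (fun u hu => ?_)
    rw [Real.mul_rpow ht.le (le_of_lt hu)]; ring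
  rw [h2] at h
  rw [neg_add, Real.rpow_add ht, Real.rpow_neg ht.le, Real.rpow_neg_one, mul_assoc, ← h]
  have := (Real.rpow_pos_of_pos ht β).ne'
  field_simp

lemma phi_bound (β m : ℝ) (hβ : -1 < β) (hm : 0 < m) : ∃ C, 0 ≤ C ∧ ∀ Y, m ≤ Y →
    ∫ u in Ioi 0, u ^ β * sp (Y - u) ≤ C * Y ^ (β + 2) := by
  have hC0 : 0 ≤ ∫ u in Ioi 0, u ^ β * sp (m - m * u) :=
    setIntegral_nonneg measurableSet_Ioi fun u hu =>
      mul_nonneg (Real.rpow_nonneg (le_of_lt hu) β) (sp_nonneg _)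
  refine ⟨m⁻¹ * ∫ u in Ioi 0, u ^ β * sp (m - m * u), by positivity, fun Y hY => ?_⟩
  have hY0 : 0 < Y := hm.trans_le hY
  have h1 := scale β Y Y hY0
  have h2 : ∫ u in Ioi 0, u ^ β * sp (Y - Y * u) ≤
      ∫ u in Ioi 0, (Y / m) * (u ^ β * sp (m - m * u)) := by
    refine setIntegral_mono_on (int_sp β Y Y hβ hY0) ((int_sp β m m hβ hm).const_mul _)
      measurableSet_Ioi fun u hu => ?_
    have h3 := sp_scale (Y / m) (m - m * u) ((one_le_div hm).2 hY)
    rw [show Y / m * (m - m * u) = Y - Y * u by field_simp] at h3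
    have hu' : 0 ≤ u ^ β := Real.rpow_nonneg (le_of_lt hu) β
    nlinarith
  rw [integral_const_mul, h1, Real.rpow_neg hY0.le] at h2
  have hp := Real.rpow_pos_of_pos hY0 (β + 1)
  rw [inv_mul_le_iff₀ hp] at h2
  rw [show β + 2 = (β + 1) + 1 by ring, Real.rpow_add_one hY0.ne']
  refine h2.trans (le_of_eq ?_)
  field_simp

lemma tail_bound (β b : ℝ) (hβ : -1 < β) (hb : 0 < b) : ∃ C, 0 ≤ C ∧ ∀ t Y, 1 ≤ t →
    ∫ u in Ioi b, u ^ β * sp (Y - t * u) ≤ C * Real.exp (Y - b * t) := by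
  have hC0 : 0 ≤ ∫ u in Ioi 0, u ^ β * Real.exp (-1 * u) :=
    setIntegral_nonneg measurableSet_Ioi fun u hu =>
      mul_nonneg (Real.rpow_nonneg (le_of_lt hu) β) (Real.exp_pos _).le
  refine ⟨Real.exp b * ∫ u in Ioi 0, u ^ β * Real.exp (-1 * u), by positivity, fun t Y ht => ?_⟩
  have hsub : Ioi b ⊆ Ioi (0:ℝ) := Ioi_subset_Ioi hb.le
  calc ∫ u in Ioi b, u ^ β * sp (Y - t * u)
      ≤ ∫ u in Ioi b, Real.exp (Y - b * t + b) * (u ^ β * Real.exp (-1 * u)) := by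
        refine setIntegral_mono_on ((int_sp β t Y hβ (by linarith)).mono_set hsub)
          (((int_exp β 1 hβ one_pos).mono_set hsub).const_mul _) measurableSet_Ioi fun u hu => ?_
        have hu1 : b < u := hu
        have hu' : 0 ≤ u ^ β := Real.rpow_nonneg (by linarith) β
        rw [mul_left_comm, ← Real.exp_add]
        refine mul_le_mul_of_nonneg_left ((sp_le_exp _).trans (Real.exp_le_exp.2 ?_)) hu'
        nlinarith
    _ = Real.exp (Y - b * t + b) * ∫ u in Ioi b, (u ^ β * Real.exp (-1 * u)) := by
        rw [integral_const_mul]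
    _ ≤ Real.exp (Y - b * t + b) * ∫ u in Ioi 0, (u ^ β * Real.exp (-1 * u)) := by
        refine mul_le_mul_of_nonneg_left ?_ (Real.exp_pos _).le
        refine setIntegral_mono_set (int_exp β 1 hβ one_pos) ?_ hsub.eventuallyLE
        refine (ae_restrict_mem measurableSet_Ioi).mono fun u hu => ?_
        exact mul_nonneg (Real.rpow_nonneg (le_of_lt hu) β) (Real.exp_pos _).le
    _ = _ := by rw [Real.exp_add]; ring

lemma decay (M α c p : ℝ) (hα1 : α < 1) (hc : 0 < c) :
    ∀ᶠ t : ℝ in atTop, Real.exp (M * t ^ α - c * t) ≤ t ^ (-p) := by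
  have h1 : Tendsto (fun t : ℝ => M * t ^ (-(1 - α))) atTop (𝓝 (M * 0)) :=
    (tendsto_rpow_neg_atTop (by linarith)).const_mul M
  rw [mul_zero] at h1
  have h2 := tendsto_rpow_mul_exp_neg_mul_atTop_nhds_zero p (c/2) (by linarith)
  filter_upwards [h1.eventually (gt_mem_nhds (half_pos hc)), h2.eventually (gt_mem_nhds one_pos),
    eventually_gt_atTop 0] with t h3 h4 ht
  have h5 : M * t ^ α ≤ c / 2 * t := by
    have : t ^ α = t ^ (-(1-α)) * t := by
      rw [← Real.rpow_add_one ht.ne']; congr 1; ring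
    rw [this, ← mul_assoc]
    exact mul_le_mul_of_nonneg_right h3.le ht.le
  rw [Real.rpow_neg ht.le, ← one_div, le_div_iff₀ (Real.rpow_pos_of_pos ht p), mul_comm]
  refine le_trans ?_ h4.le
  gcongr
  linarith

lemma taylor_bd (ghat : ℝ → ℝ) (U : Set ℝ) (b : ℝ) (hb : 0 < b) (hU : IsOpen U)
    (hbU : Icc 0 b ⊆ U) (hg : ContDiffOn ℝ (⊤ : ℕ∞) ghat U) (N : ℕ) :
    ∃ C, 0 ≤ C ∧ ∀ u ∈ Icc 0 b, |ghat u - ∑ k ∈ Finset.range (N + 1),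
      (iteratedDeriv k ghat 0 / (k.factorial : ℝ)) * u ^ k| ≤ C * u ^ (N + 1) := by
  have h0 : (0:ℝ) ∈ Icc 0 b := ⟨le_rfl, hb.le⟩
  obtain ⟨C, hC⟩ := exists_taylor_mean_remainder_bound (f := ghat) (n := N) hb.le
    ((hg.mono hbU).of_le (by exact_mod_cast le_top))
  refine ⟨|C|, abs_nonneg _, fun u hu => ?_⟩
  have h := hC u hu
  rw [taylor_within_apply, Real.norm_eq_abs, sub_zero] at h
  have he : ∀ k, iteratedDerivWithin k ghat (Icc 0 b) 0 = iteratedDeriv k ghat 0 := fun k =>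
    iteratedDerivWithin_eq_iteratedDeriv (uniqueDiffOn_Icc hb)
      ((hg.contDiffAt (hU.mem_nhds (hbU h0))).of_le (by exact_mod_cast le_top)) h0
  have : ∑ k ∈ Finset.range (N + 1), (iteratedDeriv k ghat 0 / (k.factorial : ℝ)) * u ^ k =
      ∑ k ∈ Finset.range (N + 1), (((k.factorial : ℝ))⁻¹ * u ^ k) • 
        iteratedDerivWithin k ghat (Icc 0 b) 0 := by
    refine Finset.sum_congr rfl fun k _ => ?_
    rw [he, smul_eq_mul]; ring
  rw [this]
  exact h.trans (mul_le_mul_of_nonneg_right (le_abs_self C) (pow_nonneg hu.1 _))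

lemma main_part (κ : ℝ) (hκ1 : κ < 1) (ghat : ℝ → ℝ) (U : Set ℝ) (b : ℝ)
    (hb : 0 < b) (hU : IsOpen U)
    (hbU : Icc 0 b ⊆ U) (hg : ContDiffOn ℝ (⊤ : ℕ∞) ghat U) (N : ℕ) (m : ℝ) (hm : 0 < m) :
    ∃ C, 0 ≤ C ∧ ∀ t Y, 1 ≤ t → m ≤ Y →
      |(∫ u in Ioo 0 b, ghat u * u ^ (-κ) * sp (Y - t * u)) -
        ∑ k ∈ Finset.range (N + 1), (iteratedDeriv k ghat 0 / (k.factorial : ℝ)) *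
          (∫ u in Ioi 0, u ^ ((k : ℝ) - κ) * sp (Y - u)) * t ^ (-((k : ℝ) + 1 - κ))| ≤
      C * (t ^ (-((N : ℝ) + 2 - κ)) * Y ^ ((N : ℝ) + 3 - κ) + Real.exp (Y - b * t)) := by
  obtain ⟨C1, hC1, hT⟩ := taylor_bd ghat U b hb hU hbU hg N
  have hβ : ∀ k : ℕ, -1 < (k : ℝ) - κ := fun k => by
    have : (0:ℝ) ≤ k := Nat.cast_nonneg k
    linarith
  have hβN : -1 < (N : ℝ) + 1 - κ := by
    have : (0:ℝ) ≤ N := Nat.cast_nonneg N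
    linarith
  obtain ⟨C2, hC2, hP⟩ := phi_bound ((N : ℝ) + 1 - κ) m hβN hm
  choose C3 hC3 hTail using fun k : ℕ => tail_bound ((k : ℝ) - κ) b (hβ k) hb
  set c : ℕ → ℝ := fun k => iteratedDeriv k ghat 0 / (k.factorial : ℝ) with hc
  set S := ∑ k ∈ Finset.range (N + 1), |c k| * C3 k with hS
  have hS0 : 0 ≤ S := Finset.sum_nonneg fun k _ => mul_nonneg (abs_nonneg _) (hC3 k)
  refine ⟨C1 * C2 + S, by positivity, fun t Y ht hY => ?_⟩
  have ht0 : 0 < t := by linarith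
  have hY0 : 0 < Y := by linarith
  have hsub : Ioo 0 b ⊆ Ioi (0:ℝ) := Ioo_subset_Ioi_self
  set T : ℝ → ℝ := fun u => ∑ k ∈ Finset.range (N + 1), c k * u ^ k with hTdef
  set D : ℝ → ℝ := fun u => (ghat u - T u) * u ^ (-κ) * sp (Y - t * u) with hD
  have hbd : ∀ u ∈ Ioo 0 b, ‖D u‖ ≤ C1 * (u ^ ((N : ℝ) + 1 - κ) * sp (Y - t * u)) := by
    intro u hu
    have h1 := hT u ⟨hu.1.le, hu.2.le⟩
    have h2 : u ^ ((N : ℝ) + 1 - κ) = u ^ (N + 1) * u ^ (-κ) := by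
      rw [sub_eq_add_neg, Real.rpow_add hu.1]
      congr 1
      exact_mod_cast Real.rpow_natCast u (N + 1)
    have h3 : 0 ≤ u ^ (-κ) := Real.rpow_nonneg hu.1.le _
    rw [hD]
    simp only [norm_mul, Real.norm_eq_abs]
    rw [abs_of_nonneg h3, abs_of_nonneg (sp_nonneg _), h2, ← mul_assoc, ← mul_assoc]
    exact mul_le_mul_of_nonneg_right (mul_le_mul_of_nonneg_right h1 h3) (sp_nonneg _)
  have hcT : Continuous T := by fun_prop
  have hDm : AEStronglyMeasurable D (volume.restrict (Ioo 0 b)) := by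
    have h1 : ContinuousOn D (Ioo 0 b) := by
      refine ((((hg.continuousOn.mono hbU).mono Ioo_subset_Icc_self).sub hcT.continuousOn).mul
        ?_).mul (sp_cont.comp (by fun_prop)).continuousOn
      exact continuousOn_id.rpow_const fun u hu => Or.inl hu.1.ne'
    exact h1.aestronglyMeasurable measurableSet_Ioo
  have hmaj : IntegrableOn (fun u => C1 * (u ^ ((N : ℝ) + 1 - κ) * sp (Y - t * u))) (Ioi 0) :=
    (int_sp _ t Y hβN ht0).const_mul C1
  have hDi : IntegrableOn D (Ioo 0 b) :=
    Integrable.mono' (hmaj.mono_set hsub) hDm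
      ((ae_restrict_mem measurableSet_Ioo).mono fun u hu => hbd u hu)
  have hDb : |∫ u in Ioo 0 b, D u| ≤
      C1 * C2 * (t ^ (-((N : ℝ) + 2 - κ)) * Y ^ ((N : ℝ) + 3 - κ)) := by
    calc |∫ u in Ioo 0 b, D u| ≤ ∫ u in Ioo 0 b, C1 * (u ^ ((N : ℝ) + 1 - κ) * sp (Y - t * u)) :=
          norm_integral_le_of_norm_le (hmaj.mono_set hsub)
            ((ae_restrict_mem measurableSet_Ioo).mono fun u hu => hbd u hu)
      _ ≤ ∫ u in Ioi 0, C1 * (u ^ ((N : ℝ) + 1 - κ) * sp (Y - t * u)) := by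
          refine setIntegral_mono_set hmaj ?_ hsub.eventuallyLE
          refine (ae_restrict_mem measurableSet_Ioi).mono fun u hu => ?_
          exact mul_nonneg hC1 (mul_nonneg (Real.rpow_nonneg (le_of_lt hu) _) (sp_nonneg _))
      _ = C1 * (t ^ (-((N : ℝ) + 2 - κ)) * ∫ u in Ioi 0, u ^ ((N : ℝ) + 1 - κ) * sp (Y - u)) := by
          rw [integral_const_mul, scale _ t Y ht0,
            show (N : ℝ) + 1 - κ + 1 = (N : ℝ) + 2 - κ by ring]
      _ ≤ C1 * (t ^ (-((N : ℝ) + 2 - κ)) * (C2 * Y ^ ((N : ℝ) + 3 - κ))) := by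
          have := hP Y hY
          rw [show (N : ℝ) + 1 - κ + 2 = (N : ℝ) + 3 - κ by ring] at this
          gcongr
      _ = _ := by ring
  have hki : ∀ k : ℕ, IntegrableOn (fun u => u ^ ((k : ℝ) - κ) * sp (Y - t * u)) (Ioi 0) :=
    fun k => int_sp _ t Y (hβ k) ht0
  have hsplit : ∫ u in Ioo 0 b, ghat u * u ^ (-κ) * sp (Y - t * u) = (∫ u in Ioo 0 b, D u) +
      ∑ k ∈ Finset.range (N + 1), c k * ∫ u in Ioo 0 b, u ^ ((k : ℝ) - κ) * sp (Y - t * u) := by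
    simp only [← integral_const_mul]
    rw [← integral_finsetSum _ (fun k _ => ((hki k).mono_set hsub).const_mul (c k)),
      ← integral_add hDi (integrable_finsetSum _
        (fun k _ => ((hki k).mono_set hsub).const_mul (c k)))]
    refine setIntegral_congr_fun measurableSet_Ioo fun u hu => ?_
    have h1 : ∑ k ∈ Finset.range (N + 1), c k * (u ^ ((k : ℝ) - κ) * sp (Y - t * u)) =
        T u * u ^ (-κ) * sp (Y - t * u) := by
      rw [hTdef]
      simp only [Finset.sum_mul]
      refine Finset.sum_congr rfl fun k _ => ?_
      rw [sub_eq_add_neg (k : ℝ), Real.rpow_add hu.1, Real.rpow_natCast]; ring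
    simp only [h1, hD]; ring
  have hfull : ∀ k : ℕ, ∫ u in Ioo 0 b, u ^ ((k : ℝ) - κ) * sp (Y - t * u) =
      (∫ u in Ioi 0, u ^ ((k : ℝ) - κ) * sp (Y - u)) * t ^ (-((k : ℝ) + 1 - κ)) -
      ∫ u in Ioi b, u ^ ((k : ℝ) - κ) * sp (Y - t * u) := by
    intro k
    have h1 := scale ((k : ℝ) - κ) t Y ht0
    rw [show (k : ℝ) - κ + 1 = (k : ℝ) + 1 - κ by ring] at h1
    rw [mul_comm (∫ u in Ioi 0, _), ← h1, ← integral_Ioc_eq_integral_Ioo,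
      ← Ioc_union_Ioi_eq_Ioi hb.le, setIntegral_union Ioc_disjoint_Ioi_same measurableSet_Ioi
        ((hki k).mono_set Ioc_subset_Ioi_self) ((hki k).mono_set (Ioi_subset_Ioi hb.le))]
    ring
  have hdiff : (∫ u in Ioo 0 b, ghat u * u ^ (-κ) * sp (Y - t * u)) -
        ∑ k ∈ Finset.range (N + 1), c k *
          (∫ u in Ioi 0, u ^ ((k : ℝ) - κ) * sp (Y - u)) * t ^ (-((k : ℝ) + 1 - κ)) =
      (∫ u in Ioo 0 b, D u) - ∑ k ∈ Finset.range (N + 1), c k *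
        ∫ u in Ioi b, u ^ ((k : ℝ) - κ) * sp (Y - t * u) := by
    rw [hsplit]
    simp only [hfull, mul_sub, Finset.sum_sub_distrib, mul_assoc]
    ring
  have htail : |∑ k ∈ Finset.range (N + 1), c k *
        ∫ u in Ioi b, u ^ ((k : ℝ) - κ) * sp (Y - t * u)| ≤ S * Real.exp (Y - b * t) := by
    refine (Finset.abs_sum_le_sum_abs _ _).trans ?_
    rw [hS, Finset.sum_mul]
    refine Finset.sum_le_sum fun k _ => ?_
    have h0 : 0 ≤ ∫ u in Ioi b, u ^ ((k : ℝ) - κ) * sp (Y - t * u) :=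
      setIntegral_nonneg measurableSet_Ioi fun u hu =>
        mul_nonneg (Real.rpow_nonneg (hb.le.trans (le_of_lt hu)) _) (sp_nonneg _)
    rw [abs_mul, abs_of_nonneg h0, mul_assoc]
    exact mul_le_mul_of_nonneg_left (hTail k t Y ht) (abs_nonneg _)
  rw [hdiff]
  have hE := (Real.exp_pos (Y - b * t)).le
  have hQ : 0 ≤ t ^ (-((N : ℝ) + 2 - κ)) * Y ^ ((N : ℝ) + 3 - κ) := by positivity
  have hCC : 0 ≤ C1 * C2 := by positivity
  calc _ ≤ _ := abs_sub _ _
    _ ≤ _ := add_le_add hDb htail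
    _ ≤ _ := by nlinarith

end LapAux

/-- Statement 7 (Laplace-type lemma in the regime `-M t^α ≤ y ≤ -1/M`), with coefficients
`φ_β = φ_β^{(1)} + φ_β^{(2)} + φ_β^{(3)}`. -/
theorem stmt_7
    (a : ℝ≥0∞) (ha : 0 < a)
    (κ : ℝ) (hκ0 : 0 ≤ κ) (hκ1 : κ < 1)
    (I : Set ℝ) (hI : I = {x : ℝ | 0 < x ∧ ENNReal.ofReal x < a})
    (g : ℝ → ℝ) (hg : IntegrableOn g I)
    (δ : ℝ) (hδ0 : 0 < δ) (hδa : ENNReal.ofReal δ < a)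
    (gtil : ℝ → ℝ)
    (hgtil : ∃ U : Set ℝ, IsOpen U ∧ Set.Icc (0 : ℝ) δ ⊆ U ∧ ContDiffOn ℝ (⊤ : ℕ∞) gtil U)
    (hgg : ∀ x : ℝ, 0 < x → x < δ → g x = gtil x * x ^ (-κ))
    (f : ℝ → ℝ) (hfmeas : Measurable f)
    (hfpos : ∀ x ∈ I, 0 < f x)
    (hfsm : ∃ U : Set ℝ, IsOpen U ∧ Set.Icc (0 : ℝ) δ ⊆ U ∧ ContDiffOn ℝ (⊤ : ℕ∞) f U)
    (hf0 : f 0 = 0) (hf'0 : 0 < deriv f 0)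
    (hinf : ∀ δ' : ℝ, 0 < δ' → ENNReal.ofReal δ' < a →
      ∃ c > 0, ∀ x ∈ I, δ' ≤ x → c ≤ f x)
    (φ : ℝ → ℝ → ℝ)
    (hφ : ∀ β y, φ β y =
      |y| ^ (β + 2) / ((β + 1) * (β + 2)) +
      (∫ u in Set.Ioi (0 : ℝ), (|y - u| ^ β + |y + u| ^ β) * Real.log (1 + Real.exp (-u))) -
      ∫ u in Set.Ioi |y|, |y + u| ^ β * Real.log (1 + Real.exp (-u)))
    (M : ℝ) (hM : 0 < M) (α : ℝ) (hα0 : 0 ≤ α) (hα1 : α < 1) (N : ℕ) (hN : 1 ≤ N) :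
    ∃ (ρ ρ₁ : ℝ) (finv ghat : ℝ → ℝ) (U : Set ℝ) (C t0 : ℝ),
      0 < ρ ∧ ρ ≤ δ ∧ 0 < ρ₁ ∧
      (∀ x ∈ Set.Icc (0 : ℝ) ρ, finv (f x) = x) ∧
      (∀ u ∈ Set.Ico (0 : ℝ) ρ₁, f (finv u) = u) ∧
      IsOpen U ∧ (0 : ℝ) ∈ U ∧ ContDiffOn ℝ (⊤ : ℕ∞) ghat U ∧
      (∀ u ∈ Set.Ioo (0 : ℝ) ρ₁, ghat u = u ^ κ * g (finv u) * deriv finv u) ∧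
      0 < C ∧ 0 < t0 ∧
      ∀ t : ℝ, t0 ≤ t → ∀ y : ℝ, -M * t ^ α ≤ y → y ≤ -1 / M →
        |(∫ x in I, g x * Real.log (1 + Real.exp (-y - t * f x))) -
          ∑ k ∈ Finset.range (N + 1),
            (iteratedDeriv k ghat 0 / (k.factorial : ℝ)) * φ ((k : ℝ) - κ) y *
              t ^ (-((k : ℝ) + 1 - κ))|
          ≤ C * t ^ (-((N : ℝ) + 2 - κ)) * |y| ^ ((N : ℝ) + 3 - κ) := by
  obtain ⟨ρ, b, finv, ghat, U, hρ0, hρδ, hb, hleft, hright, hUo, hbU, hgc, hghat, himg, hder⟩ :=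
    LapAux.construct κ g gtil f δ hδ0 hgtil hgg hfsm hf0 hf'0
  have hm : 0 < 1 / M := by positivity
  obtain ⟨C0, hC0, hmain⟩ :=
    LapAux.main_part κ hκ1 ghat U b hb hUo hbU hgc N (1 / M) hm
  have hρa : ENNReal.ofReal ρ < a := (ENNReal.ofReal_le_ofReal hρδ.le).trans_lt hδa
  obtain ⟨c, hc, hfc⟩ := hinf ρ hρ0 hρa
  set p : ℝ := (N : ℝ) + 2 - κ with hp
  set q : ℝ := (N : ℝ) + 3 - κ with hq
  have hq0 : 0 ≤ q := by
    have : (0:ℝ) ≤ N := Nat.cast_nonneg N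
    linarith
  set G := ∫ x in I, ‖g x‖ with hG
  have hG0 : 0 ≤ G := integral_nonneg fun x => norm_nonneg _
  obtain ⟨t1, ht1⟩ := Filter.eventually_atTop.1
    ((LapAux.decay M α b p hα1 hb).and (LapAux.decay M α c p hα1 hc))
  have hK0 : 0 < M ^ q := Real.rpow_pos_of_pos hM q
  have hmI : MeasurableSet I := by
    rw [hI]
    exact measurableSet_Ioi.inter (measurableSet_lt ENNReal.measurable_ofReal measurable_const)
  refine ⟨ρ, b, finv, ghat, U, C0 * (1 + M ^ q) + G * M ^ q + 1, max t1 1, hρ0, hρδ.le, hb, hleft,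
    fun u hu => hright u ⟨hu.1, hu.2.le⟩, hUo, hbU ⟨le_rfl, hb.le⟩, hgc, hghat, by positivity,
    by positivity, ?_⟩
  intro t ht y hy1 hy2
  have htt1 : t1 ≤ t := (le_max_left _ _).trans ht
  have ht1' : 1 ≤ t := (le_max_right _ _).trans ht
  have ht0 : 0 < t := by linarith
  obtain ⟨hd1, hd2⟩ := ht1 t htt1
  obtain ⟨Y, rfl⟩ : ∃ Y, y = -Y := ⟨-y, by ring⟩
  have hYm : 1 / M ≤ Y := by
    rw [neg_div] at hy2; linarith
  have hY0 : 0 < Y := hm.trans_le hYm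
  have hYM : Y ≤ M * t ^ α := by linarith
  have habs : |-Y| = Y := by rw [abs_neg, abs_of_pos hY0]
  have hφY : ∀ k : ℕ, φ ((k : ℝ) - κ) (-Y) =
      ∫ u in Set.Ioi 0, u ^ ((k : ℝ) - κ) * LapAux.sp (Y - u) := by
    intro k
    have hk : -1 < (k : ℝ) - κ := by
      have : (0:ℝ) ≤ k := Nat.cast_nonneg k
      linarith
    rw [hφ, habs, ← LapAux.phi_eq _ Y hk hY0]
    rfl
  have hlog : ∀ x, Real.log (1 + Real.exp (- -Y - t * f x)) = LapAux.sp (Y - t * f x) := by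
    intro x; rw [neg_neg]; rfl
  simp only [hφY, hlog, habs]
  have hspm : Measurable fun x => LapAux.sp (Y - t * f x) :=
    LapAux.sp_cont.measurable.comp (measurable_const.sub (hfmeas.const_mul t))
  have hint : IntegrableOn (fun x => g x * LapAux.sp (Y - t * f x)) I := by
    refine Integrable.mono' (hg.norm.mul_const (Real.exp Y))
      (hg.aestronglyMeasurable.mul hspm.aestronglyMeasurable) ?_
    refine (ae_restrict_mem hmI).mono fun x hx => ?_
    rw [norm_mul, Real.norm_of_nonneg (LapAux.sp_nonneg _)]
    refine mul_le_mul_of_nonneg_left ((LapAux.sp_le_exp _).trans (Real.exp_le_exp.2 ?_))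
      (norm_nonneg _)
    have := mul_pos ht0 (hfpos x hx)
    linarith
  have hIsplit : I = Set.Ioo 0 ρ ∪ (I ∩ Set.Ici ρ) := by
    ext x
    constructor
    · intro hx
      by_cases h : x < ρ
      · exact Or.inl ⟨by rw [hI] at hx; exact hx.1, h⟩
      · exact Or.inr ⟨hx, not_lt.1 h⟩
    · rintro (hx | hx)
      · rw [hI]
        exact ⟨hx.1, (ENNReal.ofReal_le_ofReal hx.2.le).trans_lt hρa⟩
      · exact hx.1
  have hsub1 : Set.Ioo 0 ρ ⊆ I := by rw [hIsplit]; exact Set.subset_union_left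
  have hdisj : Disjoint (Set.Ioo 0 ρ) (I ∩ Set.Ici ρ) := by
    rw [Set.disjoint_left]
    rintro x hx ⟨_, h2⟩
    exact absurd hx.2 (not_lt.2 h2)
  have hsum : ∫ x in I, g x * LapAux.sp (Y - t * f x) =
      (∫ x in Set.Ioo 0 ρ, g x * LapAux.sp (Y - t * f x)) +
      ∫ x in I ∩ Set.Ici ρ, g x * LapAux.sp (Y - t * f x) := by
    have h := setIntegral_union (f := fun x => g x * LapAux.sp (Y - t * f x)) (μ := volume) hdisj
      (hmI.inter measurableSet_Ici) (hint.mono_set hsub1) (hint.mono_set Set.inter_subset_left)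
    rw [← hIsplit] at h
    exact h
  have houter : |∫ x in I ∩ Set.Ici ρ, g x * LapAux.sp (Y - t * f x)| ≤
      G * Real.exp (Y - c * t) := by
    have hgi : IntegrableOn (fun x => ‖g x‖ * Real.exp (Y - c * t)) I := hg.norm.mul_const _
    calc _ ≤ ∫ x in I ∩ Set.Ici ρ, ‖g x‖ * Real.exp (Y - c * t) := by
          rw [← Real.norm_eq_abs]
          refine norm_integral_le_of_norm_le (hgi.mono_set Set.inter_subset_left) ?_
          refine (ae_restrict_mem (hmI.inter measurableSet_Ici)).mono fun x hx => ?_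
          rw [norm_mul, Real.norm_of_nonneg (LapAux.sp_nonneg _)]
          refine mul_le_mul_of_nonneg_left ((LapAux.sp_le_exp _).trans (Real.exp_le_exp.2 ?_))
            (norm_nonneg _)
          have := mul_le_mul_of_nonneg_left (hfc x hx.1 hx.2) ht0.le
          linarith
      _ ≤ ∫ x in I, ‖g x‖ * Real.exp (Y - c * t) := by
          refine setIntegral_mono_set hgi ?_ Set.inter_subset_left.eventuallyLE
          exact Filter.Eventually.of_forall fun x =>
            mul_nonneg (norm_nonneg _) (Real.exp_pos _).le
      _ = _ := integral_mul_const _ _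
  have hcv : ∫ x in Set.Ioo 0 ρ, g x * LapAux.sp (Y - t * f x) =
      ∫ u in Set.Ioo 0 b, ghat u * u ^ (-κ) * LapAux.sp (Y - t * u) := by
    have hinj : Set.InjOn finv (Set.Ioo 0 b) := by
      intro u hu v hv huv
      have := congrArg f huv
      rwa [hright u ⟨hu.1.le, hu.2.le⟩, hright v ⟨hv.1.le, hv.2.le⟩] at this
    have h := integral_image_eq_integral_abs_deriv_smul measurableSet_Ioo
      (fun u hu => (hder u hu).1.hasDerivWithinAt) hinj
      (fun x => g x * LapAux.sp (Y - t * f x))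
    rw [himg] at h
    rw [h]
    refine setIntegral_congr_fun measurableSet_Ioo fun u hu => ?_
    have hk : u ^ κ * u ^ (-κ) = 1 := by rw [← Real.rpow_add hu.1]; simp
    simp only [smul_eq_mul]
    rw [abs_of_pos (hder u hu).2, hright u ⟨hu.1.le, hu.2.le⟩, hghat u hu]
    linear_combination (-(g (finv u) * deriv finv u * LapAux.sp (Y - t * u))) * hk
  have hmn := hmain t Y ht1' hYm
  rw [hsum, hcv]
  have hKY : 1 ≤ M ^ q * Y ^ q := by
    rw [← Real.mul_rpow hM.le hY0.le]
    refine Real.one_le_rpow ?_ hq0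
    have := mul_le_mul_of_nonneg_left hYm hM.le
    rwa [mul_one_div_cancel hM.ne'] at this
  have hTp : 0 < t ^ (-p) := Real.rpow_pos_of_pos ht0 _
  have hYq : 0 < Y ^ q := Real.rpow_pos_of_pos hY0 _
  have hexp : ∀ d, Real.exp (M * t ^ α - d * t) ≤ t ^ (-p) →
      Real.exp (Y - d * t) ≤ M ^ q * (t ^ (-p) * Y ^ q) := by
    intro d hd
    have h1 : Real.exp (Y - d * t) ≤ t ^ (-p) :=
      (Real.exp_le_exp.2 (by linarith)).trans hd
    nlinarith
  have e1 := hexp b hd1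
  have e2 := hexp c hd2
  have hQ : 0 < t ^ (-p) * Y ^ q := mul_pos hTp hYq
  rw [add_sub_right_comm]
  calc _ ≤ _ := abs_add_le _ _
    _ ≤ C0 * (t ^ (-p) * Y ^ q + Real.exp (Y - b * t)) + G * Real.exp (Y - c * t) :=
        add_le_add hmn houter
    _ ≤ C0 * (t ^ (-p) * Y ^ q + M ^ q * (t ^ (-p) * Y ^ q)) +
        G * (M ^ q * (t ^ (-p) * Y ^ q)) := by gcongr
    _ ≤ (C0 * (1 + M ^ q) + G * M ^ q + 1) * t ^ (-p) * Y ^ q := by nlinarith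
end

section
/- Fix s_0 > 0. There exist constants C > 0 and n_0 ≥ 1 such that for all integers n ≥ n_0 and all s ≥ −s_0, | q_0(n,s) − n^{−1/3} · F_{−1/2}(s) / (2π a^{1/2} t^{1/2}) | ≤ C · n^{−2/3}. -/
open MeasureTheory

lemma aux_L (m y z : ℝ) (hy : m ≤ y) (hz : m ≤ z) :
    |Real.log (1 + Real.exp (-y)) - Real.log (1 + Real.exp (-z))| ≤ Real.exp (-m) * |y - z| := by
  wlog h : y ≤ z generalizing y z
  · have := this z y hz hy (by linarith)
    rwa [abs_sub_comm, abs_sub_comm y z]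
  have h1 : Real.exp (-z) ≤ Real.exp (-y) := Real.exp_le_exp.2 (by linarith)
  have p1 := Real.exp_pos (-y)
  have p2 := Real.exp_pos (-z)
  have h2 : Real.log (1 + Real.exp (-z)) ≤ Real.log (1 + Real.exp (-y)) :=
    Real.log_le_log (by linarith) (by linarith)
  rw [abs_of_nonneg (by linarith), abs_of_nonpos (by linarith),
    ← Real.log_div (by positivity) (by positivity)]
  have h3 := Real.log_le_sub_one_of_pos (x := (1 + Real.exp (-y)) / (1 + Real.exp (-z)))
    (by positivity)
  have h4 : (1 + Real.exp (-y)) / (1 + Real.exp (-z)) - 1 ≤ Real.exp (-y) - Real.exp (-z) := by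
    rw [sub_le_iff_le_add, div_le_iff₀ (by positivity)]
    nlinarith
  have h5 : Real.exp (-z) = Real.exp (-y) * Real.exp (-(z - y)) := by
    rw [← Real.exp_add]; ring_nf
  have h6 := Real.add_one_le_exp (-(z - y))
  have h7 : Real.exp (-y) ≤ Real.exp (-m) := Real.exp_le_exp.2 (by linarith)
  have h8 : Real.exp (-y) - Real.exp (-z) ≤ Real.exp (-y) * (z - y) := by
    rw [h5]; nlinarith
  have h9 : Real.exp (-y) * (z - y) ≤ Real.exp (-m) * (z - y) :=
    mul_le_mul_of_nonneg_right h7 (by linarith)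
  linarith

lemma aux_L0 (y : ℝ) : 0 ≤ Real.log (1 + Real.exp (-y)) ∧
    Real.log (1 + Real.exp (-y)) ≤ Real.exp (-y) := by
  have p1 := Real.exp_pos (-y)
  refine ⟨Real.log_nonneg (by linarith), ?_⟩
  have := Real.log_le_sub_one_of_pos (x := 1 + Real.exp (-y)) (by linarith)
  linarith

lemma aux_Q (a t : ℝ) (ha : 0 < a) (ht : 0 < t) (g : ℝ → ℝ)
    (hc : ContinuousOn g (Set.Icc 0 a)) (hp : ∀ u ∈ Set.Ioc 0 a, 0 < g u) (h0 : g 0 = 0)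
    (hs : ContDiffAt ℝ 2 g 0) (hd : deriv g 0 = t) :
    ∃ K > 0, ∃ c > 0, c ≤ t ∧ ∀ u ∈ Set.Icc 0 a, c * u ≤ g u ∧ |g u - t * u| ≤ K * u ^ 2 := by
  obtain ⟨δ, hδ, hδa, K, hK, hKb⟩ : ∃ δ > 0, δ ≤ a ∧ ∃ K > 0, ∀ u ∈ Set.Icc 0 δ,
      |g u - t * u| ≤ K * u ^ 2 := by
    obtain ⟨W, hW, hgW⟩ := hs.contDiffOn (m := 2) le_rfl (by simp)
    have hW' : W ∈ nhds (0 : ℝ) := by simpa using hW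
    obtain ⟨ε, hε, hεW⟩ := Metric.mem_nhds_iff.1 hW'
    set δ := min a (ε / 2) with hδd
    have hδ : 0 < δ := lt_min ha (by linarith)
    have hsub : Set.Icc 0 δ ⊆ W := by
      intro u hu
      apply hεW
      have := min_le_right a (ε / 2)
      simp only [Metric.mem_ball, Real.dist_eq, sub_zero, abs_of_nonneg hu.1]
      linarith [hu.2]
    obtain ⟨C, hC⟩ := exists_taylor_mean_remainder_bound (n := 1) (f := g) hδ.le
      (by norm_num; exact hgW.mono hsub)
    refine ⟨δ, hδ, min_le_left _ _, |C| + 1, by positivity, fun u hu => ?_⟩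
    have h1 := hC u hu
    have h2 : derivWithin g (Set.Icc 0 δ) 0 = t := by
      rw [← hd]
      exact (hs.differentiableAt (by norm_num)).derivWithin
        (uniqueDiffOn_Icc hδ 0 ⟨le_rfl, hδ.le⟩)
    simp [taylorWithinEval_succ, h0, h2] at h1
    rw [mul_comm u t] at h1
    nlinarith [le_abs_self C, sq_nonneg u]
  -- global K
  obtain ⟨B, hB⟩ := (isCompact_Icc (a := (0:ℝ)) (b := a)).exists_bound_of_continuousOn
    (f := fun u => g u - t * u) (by fun_prop)
  have hBn : 0 ≤ B := (norm_nonneg _).trans (hB 0 ⟨le_rfl, ha.le⟩)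
  set δ' := min δ (t / (2 * K)) with hδ'
  have hδ'p : 0 < δ' := lt_min hδ (by positivity)
  have hδ'a : δ' ≤ a := (min_le_left _ _).trans hδa
  obtain ⟨z, hz, hzm⟩ := (isCompact_Icc (a := δ') (b := a)).exists_isMinOn ⟨a, hδ'a, le_rfl⟩
    (hc.mono (Set.Icc_subset_Icc_left hδ'p.le))
  have hgz : 0 < g z := hp z ⟨hδ'p.trans_le hz.1, hz.2⟩
  refine ⟨K + B / δ ^ 2, by positivity, min (t / 2) (g z / a), lt_min (by positivity)
    (by positivity), (min_le_left _ _).trans (by linarith), fun u hu => ⟨?_, ?_⟩⟩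
  · by_cases h : u ≤ δ'
    · have h1 := (abs_le.1 (hKb u ⟨hu.1, h.trans (min_le_left _ _)⟩)).1
      have h2 : u ≤ t / (2 * K) := h.trans (min_le_right _ _)
      rw [le_div_iff₀ (by positivity)] at h2
      have h3 := mul_le_mul_of_nonneg_right (min_le_left (t / 2) (g z / a)) hu.1
      nlinarith [hu.1]
    · have h1 : g z ≤ g u := hzm ⟨(not_le.1 h).le, hu.2⟩
      have h3 := mul_le_mul_of_nonneg_right (min_le_right (t / 2) (g z / a)) hu.1
      have h4 : g z / a * u ≤ g z / a * a := mul_le_mul_of_nonneg_left hu.2 (by positivity)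
      rw [div_mul_cancel₀ _ ha.ne'] at h4
      linarith
  · by_cases h : u ≤ δ
    · have := hKb u ⟨hu.1, h⟩
      have h2 : 0 ≤ B / δ ^ 2 * u ^ 2 := by positivity
      linarith
    · have h1 := hB u hu
      rw [Real.norm_eq_abs] at h1
      have h2 : B ≤ B / δ ^ 2 * u ^ 2 := by
        rw [div_mul_eq_mul_div, le_div_iff₀ (by positivity)]
        apply mul_le_mul_of_nonneg_left _ hBn
        exact pow_le_pow_left₀ hδ.le (not_le.1 h).le 2
      have h3 : 0 ≤ K * u ^ 2 := by positivity
      linarith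

lemma aux_w (a : ℝ) (ha : 0 < a) :
    IntegrableOn (fun u : ℝ => 1 / (Real.sqrt u * Real.sqrt (a - u))) (Set.Ioo 0 a) := by
  have h1 : IntegrableOn (fun u : ℝ => u ^ (-(1:ℝ)/2)) (Set.Ioo 0 a) := by
    have := (intervalIntegral.intervalIntegrable_rpow' (a := 0) (b := a) (r := -(1:ℝ)/2)
      (by norm_num))
    rw [intervalIntegrable_iff_integrableOn_Ioo_of_le ha.le] at this
    exact this
  have h2 : IntegrableOn (fun u : ℝ => (a - u) ^ (-(1:ℝ)/2)) (Set.Ioo 0 a) := by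
    have := (intervalIntegral.intervalIntegrable_rpow' (a := 0) (b := a) (r := -(1:ℝ)/2)
      (by norm_num)).comp_sub_left a
    simp only [sub_zero, sub_self] at this
    have := this.symm
    rw [intervalIntegrable_iff_integrableOn_Ioo_of_le ha.le] at this
    exact this
  refine Integrable.mono' ((h1.add h2).const_mul (1 / Real.sqrt a)) ?_ ?_
  · apply Measurable.aestronglyMeasurable; fun_prop
  · filter_upwards [ae_restrict_mem measurableSet_Ioo] with u hu
    have e : ∀ x : ℝ, 0 < x → x ^ (-(1:ℝ)/2) = 1 / Real.sqrt x := by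
      intro x hx
      rw [neg_div, Real.rpow_neg hx.le, Real.sqrt_eq_rpow, one_div, one_div]
    have hu2 : 0 < a - u := by linarith [hu.2]
    have p1 := Real.sqrt_pos.2 hu.1
    have p2 := Real.sqrt_pos.2 hu2
    have p3 := Real.sqrt_pos.2 ha
    simp only [Pi.add_apply]
    rw [Real.norm_of_nonneg (by positivity), e u hu.1, e _ hu2, div_add_div _ _ p1.ne' p2.ne',
      div_mul_div_comm, div_le_div_iff₀ (by positivity) (by positivity)]
    have h3 : Real.sqrt a ≤ Real.sqrt u + Real.sqrt (a - u) := by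
      rw [Real.sqrt_le_left (by positivity)]
      nlinarith [Real.sq_sqrt hu.1.le, Real.sq_sqrt hu2.le]
    have h4 : 0 < Real.sqrt u * Real.sqrt (a-u) := by positivity
    nlinarith

lemma aux_pt (a t K c s0 : ℝ) (ha : 0 < a) (hK : 0 < K) (hc : 0 < c) (hct : c ≤ t)
    (N s u gu : ℝ) (hN : 0 < N) (hs : -s0 ≤ s) (hu : 0 < u) (hua : u < a)
    (h1 : c * u ≤ gu) (h2 : |gu - t * u| ≤ K * u ^ 2) :
    |Real.log (1 + Real.exp (-(s + N * gu))) -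
      Real.log (1 + Real.exp (-(s + N * (t * u)))) * (Real.sqrt (a - u) / Real.sqrt a)|
      ≤ Real.exp s0 * (2 * K / c ^ 2 + 1 / (a * c)) / N := by
  have htu : c * u ≤ t * u := mul_le_mul_of_nonneg_right hct hu.le
  have hA := aux_L (s + N * (c * u)) (s + N * gu) (s + N * (t * u))
    (by nlinarith) (by nlinarith)
  obtain ⟨hB0, hB⟩ := aux_L0 (s + N * (t * u))
  set L1 := Real.log (1 + Real.exp (-(s + N * gu)))
  set L2 := Real.log (1 + Real.exp (-(s + N * (t * u))))
  set y := N * (c * u) with hy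
  have hy0 : 0 < y := by positivity
  set p := Real.exp (-y) with hp
  have hp0 : 0 < p := Real.exp_pos _
  have hE : 0 < Real.exp s0 := Real.exp_pos _
  have hpe : p * Real.exp y = 1 := by rw [hp, ← Real.exp_add]; simp
  have hq := Real.quadratic_le_exp_of_nonneg hy0.le
  have hpy2 : p * y ^ 2 ≤ 2 := by nlinarith
  have hpy : p * y ≤ 1 := by nlinarith [sq_nonneg y]
  have hm : Real.exp (-(s + y)) ≤ Real.exp s0 * p := by
    rw [hp, ← Real.exp_add]; exact Real.exp_le_exp.2 (by linarith)
  have hB' : L2 ≤ Real.exp s0 * p := by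
    refine hB.trans (le_trans (Real.exp_le_exp.2 ?_) hm)
    nlinarith
  have e1 : |s + N * gu - (s + N * (t * u))| = N * |gu - t * u| := by
    rw [← abs_of_pos hN, ← abs_mul, abs_of_pos hN]; ring_nf
  rw [e1] at hA
  have hA2 : |L1 - L2| ≤ Real.exp s0 * (2 * K / c ^ 2) / N := by
    calc |L1 - L2| ≤ (Real.exp s0 * p) * (N * (K * u ^ 2)) := by
          refine hA.trans ?_
          gcongr
      _ = Real.exp s0 * K / (c ^ 2 * N) * (p * y ^ 2) := by rw [hy]; field_simp
      _ ≤ Real.exp s0 * K / (c ^ 2 * N) * 2 := by gcongr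
      _ = _ := by field_simp
  have hau : 0 < a - u := by linarith
  set ρ := Real.sqrt (a - u) / Real.sqrt a with hρ
  have pa := Real.sqrt_pos.2 ha
  have hρ0 : 0 ≤ ρ := by positivity
  have hρ2 : ρ ^ 2 = 1 - u / a := by
    rw [hρ, div_pow, Real.sq_sqrt hau.le, Real.sq_sqrt ha.le]; field_simp
  have hua0 : 0 < u / a := by positivity
  have hρ1 : ρ ≤ 1 := by nlinarith
  have hρ3 : 1 - ρ ≤ u / a := by nlinarith
  have hB2 : |L2 * (1 - ρ)| ≤ Real.exp s0 * (1 / (a * c)) / N := by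
    rw [abs_of_nonneg (mul_nonneg hB0 (by linarith))]
    calc L2 * (1 - ρ) ≤ (Real.exp s0 * p) * (u / a) := by gcongr
      _ = Real.exp s0 / (a * c * N) * (p * y) := by rw [hy]; field_simp
      _ ≤ Real.exp s0 / (a * c * N) * 1 := by gcongr
      _ = _ := by field_simp
  calc |L1 - L2 * ρ| = |(L1 - L2) + L2 * (1 - ρ)| := by ring_nf
    _ ≤ |L1 - L2| + |L2 * (1 - ρ)| := abs_add_le _ _
    _ ≤ _ := by rw [mul_add, add_div]; linarith

lemma aux_main (a t K c s0 : ℝ) (ha : 0 < a) (hK : 0 < K) (hc : 0 < c) (hct : c ≤ t)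
    (g : ℝ → ℝ) (hg : ContinuousOn g (Set.Icc 0 a))
    (hb : ∀ u ∈ Set.Icc 0 a, c * u ≤ g u ∧ |g u - t * u| ≤ K * u ^ 2) :
    ∃ C > 0, ∀ N : ℝ, 0 < N → ∀ s : ℝ, -s0 ≤ s →
      |(∫ u in Set.Ioo 0 a, Real.log (1 + Real.exp (-(s + N * g u))) *
          (1 / (Real.sqrt u * Real.sqrt (a - u)))) -
        ∫ u in Set.Ioi (0:ℝ), Real.log (1 + Real.exp (-(s + N * (t * u)))) *
          (1 / (Real.sqrt u * Real.sqrt a))| ≤ C / N := by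
  have ht : 0 < t := hc.trans_le hct
  have pa := Real.sqrt_pos.2 ha
  have hw := aux_w a ha
  have hr := integrableOn_Ioi_rpow_of_lt (a := -(3:ℝ)/2) (by norm_num) ha
  set D := Real.exp s0 * (2 * K / c ^ 2 + 1 / (a * c)) with hD
  have hD0 : 0 < D := by positivity
  set I1 := ∫ u in Set.Ioo 0 a, 1 / (Real.sqrt u * Real.sqrt (a - u))
  set I2 := ∫ u in Set.Ioi a, u ^ (-(3:ℝ)/2)
  have hI1 : 0 ≤ I1 := integral_nonneg fun u => by positivity
  have hI2 : 0 ≤ I2 := setIntegral_nonneg measurableSet_Ioi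
    fun u hu => Real.rpow_nonneg (ha.le.trans (le_of_lt hu)) _
  set D2 := Real.exp s0 / (t * Real.sqrt a) with hD2
  have hD20 : 0 < D2 := by positivity
  refine ⟨D * I1 + D2 * I2 + 1, by positivity, fun N hN s hs => ?_⟩
  set G : ℝ → ℝ := fun u => Real.log (1 + Real.exp (-(s + N * g u))) *
          (1 / (Real.sqrt u * Real.sqrt (a - u))) with hG
  set H : ℝ → ℝ := fun u => Real.log (1 + Real.exp (-(s + N * (t * u)))) *
          (1 / (Real.sqrt u * Real.sqrt a)) with hH
  have hHm : Measurable H := by fun_prop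
  have hexp : ∀ z, 0 ≤ z → Real.exp (-(s + z)) ≤ Real.exp s0 := fun z hz =>
    Real.exp_le_exp.2 (by linarith)
  have hGi : IntegrableOn G (Set.Ioo 0 a) := by
    refine Integrable.mono' (hw.const_mul (Real.exp s0)) ?_ ?_
    · apply ContinuousOn.aestronglyMeasurable _ measurableSet_Ioo
      have hg' : ContinuousOn g (Set.Ioo 0 a) := hg.mono Set.Ioo_subset_Icc_self
      apply ContinuousOn.mul
      · apply ContinuousOn.log (by fun_prop)
        intro u _; positivity
      · apply ContinuousOn.div (by fun_prop) (by fun_prop)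
        intro u hu
        have := Real.sqrt_pos.2 hu.1
        have := Real.sqrt_pos.2 (sub_pos.2 hu.2)
        positivity
    · filter_upwards [ae_restrict_mem measurableSet_Ioo] with u hu
      obtain ⟨l0, l1⟩ := aux_L0 (s + N * g u)
      have h3 := (hb u ⟨hu.1.le, hu.2.le⟩).1
      have h4 : 0 ≤ g u := le_trans (by have := hu.1; positivity) h3
      rw [hG, Real.norm_of_nonneg (by positivity)]
      exact mul_le_mul_of_nonneg_right (l1.trans (hexp _ (by positivity))) (by positivity)
  have hHi1 : IntegrableOn H (Set.Ioo 0 a) := by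
    refine Integrable.mono' (hw.const_mul (Real.exp s0)) hHm.aestronglyMeasurable ?_
    filter_upwards [ae_restrict_mem measurableSet_Ioo] with u hu
    obtain ⟨l0, l1⟩ := aux_L0 (s + N * (t * u))
    have hu1 := hu.1
    have q1 := Real.sqrt_pos.2 hu.1
    have q2 := Real.sqrt_pos.2 (sub_pos.2 hu.2)
    rw [hH, Real.norm_of_nonneg (by positivity)]
    have := l1.trans (hexp _ (by positivity))
    dsimp only
    gcongr
    linarith
  have hHb : ∀ u ∈ Set.Ioi a, ‖H u‖ ≤ D2 / N * u ^ (-(3:ℝ)/2) := by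
    intro u hu
    have hu0 : 0 < u := ha.trans hu
    obtain ⟨l0, l1⟩ := aux_L0 (s + N * (t * u))
    have q1 := Real.sqrt_pos.2 hu0
    rw [hH, Real.norm_of_nonneg (by positivity)]
    have e1 : u ^ (-(3:ℝ)/2) = 1 / (u * Real.sqrt u) := by
      rw [show (-(3:ℝ)/2) = -(1 + 1/2) by norm_num, Real.rpow_neg hu0.le, Real.rpow_add hu0,
        Real.rpow_one, ← Real.sqrt_eq_rpow, one_div]
    set y := N * (t * u) with hy
    have hy0 : 0 < y := by positivity
    have h5 : Real.exp (-(s + y)) ≤ Real.exp s0 * (1 / y) := by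
      calc Real.exp (-(s + y)) ≤ Real.exp s0 * Real.exp (-y) := by
            rw [← Real.exp_add]; exact Real.exp_le_exp.2 (by linarith)
        _ ≤ Real.exp s0 * (1 / y) := by
            gcongr
            rw [Real.exp_neg, one_div]
            apply inv_anti₀ hy0
            linarith [Real.add_one_le_exp y]
    calc _ ≤ (Real.exp s0 * (1 / y)) * (1 / (Real.sqrt u * Real.sqrt a)) := by
          dsimp only; gcongr; exact l1.trans h5
      _ = _ := by rw [e1, hy, hD2]; field_simp
  have hHi2 : IntegrableOn H (Set.Ioi a) := by
    refine Integrable.mono' (hr.const_mul (D2 / N)) hHm.aestronglyMeasurable ?_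
    filter_upwards [ae_restrict_mem measurableSet_Ioi] with u hu using hHb u hu
  have hsplit : ∫ u in Set.Ioi 0, H u = (∫ u in Set.Ioo 0 a, H u) + ∫ u in Set.Ioi a, H u := by
    rw [← Set.Ioc_union_Ioi_eq_Ioi ha.le, setIntegral_union (Set.Ioc_disjoint_Ioi le_rfl)
      measurableSet_Ioi _ hHi2, integral_Ioc_eq_integral_Ioo]
    rwa [integrableOn_Ioc_iff_integrableOn_Ioo]
  have b1 : ‖∫ u in Set.Ioo 0 a, (G u - H u)‖ ≤ D / N * I1 := by
    rw [← integral_const_mul]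
    apply norm_integral_le_of_norm_le (hw.const_mul _)
    filter_upwards [ae_restrict_mem measurableSet_Ioo] with u hu
    obtain ⟨h1, h2⟩ := hb u ⟨hu.1.le, hu.2.le⟩
    have := aux_pt a t K c s0 ha hK hc hct N s u (g u) hN hs hu.1 hu.2 h1 h2
    have q1 := Real.sqrt_pos.2 hu.1
    have q2 := Real.sqrt_pos.2 (sub_pos.2 hu.2)
    have e : G u - H u = (Real.log (1 + Real.exp (-(s + N * g u))) -
      Real.log (1 + Real.exp (-(s + N * (t * u)))) * (Real.sqrt (a - u) / Real.sqrt a)) *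
        (1 / (Real.sqrt u * Real.sqrt (a - u))) := by
      rw [hG, hH]; field_simp
    rw [e, norm_mul, Real.norm_eq_abs, Real.norm_of_nonneg (by positivity)]
    exact mul_le_mul_of_nonneg_right this (by positivity)
  have b2 : ‖∫ u in Set.Ioi a, H u‖ ≤ D2 / N * I2 := by
    rw [← integral_const_mul]
    apply norm_integral_le_of_norm_le (hr.const_mul _)
    filter_upwards [ae_restrict_mem measurableSet_Ioi] with u hu using hHb u hu
  rw [integral_sub hGi hHi1] at b1
  rw [hsplit]
  rw [Real.norm_eq_abs] at b1 b2
  have e3 : (D * I1 + D2 * I2 + 1) / N = D / N * I1 + D2 / N * I2 + 1 / N := by ring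
  have : 0 < 1 / N := by positivity
  rw [e3, abs_le]
  rw [abs_le] at b1 b2
  constructor <;> linarith [b1.1, b1.2, b2.1, b2.2]


/-- first-order asymptotics of the Szegő-type constant `q_0(n,s)`, uniformly for
`s ≥ -s₀`. -/
theorem stmt_8
    (a t : ℝ) (ha : 0 < a) (ht : 0 < t)
    (Q : ℝ → ℝ)
    (hQcont : ContinuousOn Q (Set.Icc (-a) 0))
    (hQpos : ∀ x ∈ Set.Ico (-a) (0 : ℝ), 0 < Q x)
    (hQ0 : Q 0 = 0)
    (hQsm : ∃ U : Set ℝ, IsOpen U ∧ (0 : ℝ) ∈ U ∧ ContDiffOn ℝ (⊤ : ℕ∞) Q U)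
    (hQder : deriv Q 0 = -t)
    (q0 : ℕ → ℝ → ℝ)
    (hq0 : ∀ (n : ℕ) (s : ℝ), q0 n s = (2 * Real.pi)⁻¹ *
      ∫ x in Set.Ioo (-a) (0 : ℝ),
        Real.log (1 + Real.exp (-s - (n : ℝ) ^ ((2 : ℝ) / 3) * Q x)) /
          Real.sqrt (|x| * (x + a)))
    (F : ℝ → ℝ → ℝ)
    (hF : ∀ β y, F β y = ∫ v in Set.Ioi (0 : ℝ), v ^ β * Real.log (1 + Real.exp (-y - v)))
    (s0 : ℝ) (hs0 : 0 < s0) :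
    ∃ C > 0, ∃ n0 : ℕ, 1 ≤ n0 ∧
      ∀ n : ℕ, n0 ≤ n → ∀ s : ℝ, -s0 ≤ s →
        |q0 n s - (n : ℝ) ^ (-(1 : ℝ) / 3) *
            (F (-(1 : ℝ) / 2) s / (2 * Real.pi * Real.sqrt a * Real.sqrt t))|
          ≤ C * (n : ℝ) ^ (-(2 : ℝ) / 3) := by
  have hQat : ContDiffAt ℝ 2 Q 0 := by
    obtain ⟨U, hU, h0, hs⟩ := hQsm
    exact (hs.contDiffAt (hU.mem_nhds h0)).of_le (WithTop.coe_le_coe.2 (le_top : (2:ℕ∞) ≤ ⊤))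
  set g : ℝ → ℝ := fun u => Q (-u) with hgdef
  have hgc : ContinuousOn g (Set.Icc 0 a) := by
    apply hQcont.comp (by fun_prop)
    intro u hu
    exact ⟨by linarith [hu.2], by linarith [hu.1]⟩
  have hgs : ContDiffAt ℝ 2 g 0 := by
    apply ContDiffAt.comp (0:ℝ) (g := Q) (f := fun u : ℝ => -u) (by simpa using hQat) (by fun_prop)
  have hgd : deriv g 0 = t := by
    rw [hgdef, deriv_comp_neg]; simp [hQder]
  obtain ⟨K, hK, c, hc, hct, hb⟩ := aux_Q a t ha ht g hgc
    (fun u hu => hQpos _ ⟨by linarith [hu.2], by linarith [hu.1]⟩) (by simp [hgdef, hQ0]) hgs hgd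
  obtain ⟨C, hC, hmain⟩ := aux_main a t K c s0 ha hK hc hct g hgc hb
  have hpi := Real.pi_pos
  refine ⟨(2 * Real.pi)⁻¹ * C, by positivity, 1, le_rfl, fun n hn s hs => ?_⟩
  have hn0 : (0:ℝ) < n := by exact_mod_cast hn
  set N := (n:ℝ) ^ ((2:ℝ)/3) with hNdef
  have hN : 0 < N := Real.rpow_pos_of_pos hn0 _
  have e1 : (n:ℝ) ^ (-(2:ℝ)/3) = 1 / N := by
    rw [neg_div, Real.rpow_neg hn0.le, one_div]
  have e2 : (n:ℝ) ^ (-(1:ℝ)/3) = 1 / Real.sqrt N := by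
    rw [Real.sqrt_eq_rpow, hNdef, ← Real.rpow_mul hn0.le, neg_div, Real.rpow_neg hn0.le, one_div]
    norm_num
  have m := hmain N hN s hs
  have pa := Real.sqrt_pos.2 ha
  have pt := Real.sqrt_pos.2 ht
  have pN := Real.sqrt_pos.2 hN
  have hq : q0 n s = (2 * Real.pi)⁻¹ * ∫ u in Set.Ioo 0 a,
      Real.log (1 + Real.exp (-(s + N * g u))) * (1 / (Real.sqrt u * Real.sqrt (a - u))) := by
    rw [hq0]
    congr 1
    rw [← integral_Ioc_eq_integral_Ioo, ← intervalIntegral.integral_of_le (by linarith)]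
    have := intervalIntegral.integral_comp_neg (a := 0) (b := a) (fun x =>
      Real.log (1 + Real.exp (-s - N * Q x)) / Real.sqrt (|x| * (x + a)))
    rw [neg_zero] at this
    rw [← this, intervalIntegral.integral_of_le ha.le, integral_Ioc_eq_integral_Ioo]
    apply setIntegral_congr_fun measurableSet_Ioo
    intro u hu
    dsimp only
    rw [abs_neg, abs_of_pos hu.1, Real.sqrt_mul hu.1.le, div_eq_mul_one_div,
      show -u + a = a - u by ring, show -s - N * Q (-u) = -(s + N * g u) by rw [hgdef]; ring]
  have hFe : F (-(1:ℝ)/2) s / (Real.sqrt N * Real.sqrt a * Real.sqrt t) =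
      ∫ u in Set.Ioi (0:ℝ), Real.log (1 + Real.exp (-(s + N * (t * u)))) *
          (1 / (Real.sqrt u * Real.sqrt a)) := by
    rw [hF]
    have h := integral_comp_mul_left_Ioi
      (fun v : ℝ => v ^ (-(1:ℝ)/2) * Real.log (1 + Real.exp (-s - v))) 0 (b := N * t)
      (by positivity)
    rw [mul_zero, smul_eq_mul, eq_inv_mul_iff_mul_eq₀ (by positivity)] at h
    rw [← h, ← integral_const_mul, ← integral_div]
    apply setIntegral_congr_fun measurableSet_Ioi
    intro u hu
    have hu0 : 0 < u := hu
    have q := Real.sqrt_pos.2 hu0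
    dsimp only
    rw [neg_div, Real.rpow_neg (by positivity), ← Real.sqrt_eq_rpow,
      show -s - N * t * u = -(s + N * (t * u)) by ring, Real.sqrt_mul (by positivity),
      Real.sqrt_mul hN.le]
    field_simp
    rw [Real.sq_sqrt hN.le, Real.sq_sqrt ht.le]
  rw [← hFe] at m
  rw [hq, e1, e2]
  set J := ∫ u in Set.Ioo 0 a,
      Real.log (1 + Real.exp (-(s + N * g u))) * (1 / (Real.sqrt u * Real.sqrt (a - u)))
  have e4 : (2 * Real.pi)⁻¹ * J - 1 / Real.sqrt N *
      (F (-(1:ℝ)/2) s / (2 * Real.pi * Real.sqrt a * Real.sqrt t)) =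
      (2 * Real.pi)⁻¹ * (J - F (-(1:ℝ)/2) s / (Real.sqrt N * Real.sqrt a * Real.sqrt t)) := by
    field_simp
  rw [e4, abs_mul, abs_of_pos (by positivity), mul_one_div, mul_div_assoc]
  exact mul_le_mul_of_nonneg_left m (by positivity)
end
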